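/- arXiv:1708.00203 — 2 statements merged into one kernel-verified Lean document; each statement's English description precedes it below -/
import Mathlib

section
/- Let A and B be k-algebras and M a B-A-bimodule. Consider the cochain complex K• with K⁰ = 0 and, for n ≥ 1, Kⁿ = ⊕_{p+q+1=n, p,q≥0} Hom_k(B^{⊗q} ⊗ M ⊗ A^{⊗p}, M), whose differential sends f ∈ Hom_k(B^{⊗q} ⊗ M ⊗ A^{⊗p}, M) to the sum of two components: the component in Hom_k(B^{⊗(q+1)} ⊗ M ⊗ A^{⊗p}, M) given by (b₁,…,b_{q+1},m,a₁,…,a_p) ↦ b₁·f(b₂,…,b_{q+1},m,a₁,…,a_p) + Σ_{i=1}^{q} (−1)^i f(b₁,…,b_i b_{i+1},…,b_{q+1},m,a₁,…,a_p) + (−1)^{q+1} f(b₁,…,b_q, b_{q+1}·m, a₁,…,a_p), and the component in Hom_k(B^{⊗q} ⊗ M ⊗ A^{⊗(p+1)}, M) given by (b₁,…,b_q,m,a₁,…,a_{p+1}) ↦ (−1)^q [ f(b₁,…,b_q, m·a₁, a₂,…,a_{p+1}) + Σ_{i=1}^{p} (−1)^i f(b₁,…,b_q, m, a₁,…,a_i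 a_{i+1},…,a_{p+1}) + (−1)^{p+1} f(b₁,…,b_q, m, a₁,…,a_p)·a_{p+1} ]. Then for every r ≥ 0 the (1+r)-th cohomology of K• is isomorphic as a k-vector space to Ext^r_{B⊗[k]A^op}(M, M); in particular the first cohomology is isomorphic to End_{B⊗[k]A^op}(M). -/
open scoped TensorProduct
open CategoryTheory MulOpposite

noncomputable section

/-- Merging two adjacent entries of a tuple by multiplication:
`(x₁, …, x_{q+1}) ↦ (x₁, …, xⱼ·x_{j+1}, …, x_{q+1})`. -/
def merge {X : Type} [Mul X] {q : ℕ} (b : Fin (q + 1) → X) (j : Fin q) : Fin q → X :=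
  fun l => if (l : ℕ) < (j : ℕ) then b l.castSucc
    else if (l : ℕ) = (j : ℕ) then b l.castSucc * b l.succ else b l.succ

/-- Decompositions `q + 1 + p = n` indexing the summands of the degree `n` term of `K•`. -/
abbrev Idx (n : ℕ) : Type := {qp : ℕ × ℕ // qp.1 + 1 + qp.2 = n}

section

variable (k A B M : Type) [Field k] [Ring A] [Ring B] [Algebra k A] [Algebra k B]
  [AddCommGroup M] [Module k M] [Module B M] [Module Aᵐᵒᵖ M]
  [SMulCommClass B Aᵐᵒᵖ M] [IsScalarTower k B M] [IsScalarTower k Aᵐᵒᵖ M]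

/-- The `B`-`A`-bimodule `M` as a left module over `B ⊗[k] Aᵐᵒᵖ`. -/
instance cornerModule : Module (B ⊗[k] Aᵐᵒᵖ) M := TensorProduct.Algebra.module

instance cornerTower : IsScalarTower k (B ⊗[k] Aᵐᵒᵖ) M :=
  ⟨fun c x m => by
    show TensorProduct.Algebra.moduleAux (c • x) m = c • TensorProduct.Algebra.moduleAux x m
    rw [map_smul]; rfl⟩

instance : SMulCommClass k (B ⊗[k] Aᵐᵒᵖ) M := IsScalarTower.to_smulCommClass
instance : SMulCommClass (B ⊗[k] Aᵐᵒᵖ) k M := SMulCommClass.symm _ _ _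

/-- `Ext^n_{B ⊗[k] Aᵐᵒᵖ}(M, M)`. -/
def cornerExt (n : ℕ) : ModuleCat k :=
  ((Ext k (ModuleCat (B ⊗[k] Aᵐᵒᵖ)) n).obj
    (Opposite.op (ModuleCat.of (B ⊗[k] Aᵐᵒᵖ) M))).obj (ModuleCat.of (B ⊗[k] Aᵐᵒᵖ) M)

/-- The space of raw `n`-cochains: a family, indexed by the decompositions `q + 1 + p = n`,
of functions `B^q × M × A^p → M`.  The `k`-multilinear members of the `(q,p)`-component
correspond exactly to the elements of `Hom_k(B^{⊗q} ⊗ M ⊗ A^{⊗p}, M)`. -/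
abbrev Raw (n : ℕ) : Type :=
  ∀ i : Idx n, (Fin i.1.1 → B) → M → (Fin i.1.2 → A) → M

/-- Multilinearity over `k` of a function `B^q × M × A^p → M` in each of its arguments. -/
structure IsML {q p : ℕ} (f : (Fin q → B) → M → (Fin p → A) → M) : Prop where
  addB : ∀ (b : Fin q → B) (i : Fin q) (x y : B) (m : M) (a : Fin p → A),
    f (Function.update b i (x + y)) m a
      = f (Function.update b i x) m a + f (Function.update b i y) m a
  smulB : ∀ (b : Fin q → B) (i : Fin q) (c : k) (x : B) (m : M) (a : Fin p → A),
    f (Function.update b i (c • x)) m a = c • f (Function.update b i x) m a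
  addM : ∀ (b : Fin q → B) (m m' : M) (a : Fin p → A),
    f b (m + m') a = f b m a + f b m' a
  smulM : ∀ (b : Fin q → B) (c : k) (m : M) (a : Fin p → A),
    f b (c • m) a = c • f b m a
  addA : ∀ (b : Fin q → B) (m : M) (a : Fin p → A) (j : Fin p) (x y : A),
    f b m (Function.update a j (x + y))
      = f b m (Function.update a j x) + f b m (Function.update a j y)
  smulA : ∀ (b : Fin q → B) (m : M) (a : Fin p → A) (j : Fin p) (c : k) (x : A),
    f b m (Function.update a j (c • x)) = c • f b m (Function.update a j x)

/-- The subspace `Kⁿ = ⊕_{q+1+p=n} Hom_k(B^{⊗q} ⊗ M ⊗ A^{⊗p}, M)` of multilinear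
cochains. -/
def mlSub (n : ℕ) : Submodule k (Raw A B M n) where
  carrier := {F | ∀ i : Idx n, IsML k A B M (F i)}
  zero_mem' := by
    intro i
    exact ⟨by intros; simp, by intros; simp, by intros; simp,
      by intros; simp, by intros; simp, by intros; simp⟩
  add_mem' := by
    intro F G hF hG i
    obtain ⟨F1, F2, F3, F4, F5, F6⟩ := hF i
    obtain ⟨G1, G2, G3, G4, G5, G6⟩ := hG i
    refine ⟨?_, ?_, ?_, ?_, ?_, ?_⟩ <;> intros <;> simp only [Pi.add_apply]
    · rw [F1, G1]; abel
    · rw [F2, G2, smul_add]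
    · rw [F3, G3]; abel
    · rw [F4, G4, smul_add]
    · rw [F5, G5]; abel
    · rw [F6, G6, smul_add]
  smul_mem' := by
    intro c F hF i
    obtain ⟨F1, F2, F3, F4, F5, F6⟩ := hF i
    refine ⟨?_, ?_, ?_, ?_, ?_, ?_⟩ <;> intros <;> simp only [Pi.smul_apply]
    · rw [F1, smul_add]
    · rw [F2, smul_comm]
    · rw [F3, smul_add]
    · rw [F4, smul_comm]
    · rw [F5, smul_add]
    · rw [F6, smul_comm]

/-- The component space `B^q × M × A^p → M` of raw cochains. -/
abbrev RawC (q p : ℕ) : Type := (Fin q → B) → M → (Fin p → A) → M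

section builders

variable {q p : ℕ}

/-- `g ↦ ((b₁,…,b_{q+1}),m,a) ↦ b₁ · g((b₂,…,b_{q+1}),m,a)`. -/
def tB : RawC A B M q p →ₗ[k] RawC A B M (q + 1) p where
  toFun g := fun b m a => b 0 • g (Fin.tail b) m a
  map_add' g g' := by funext b m a; exact smul_add _ _ _
  map_smul' c g := by funext b m a; exact smul_comm _ _ _

/-- `g ↦ (b,m,a) ↦ g((b₁,…,bⱼ·b_{j+1},…),m,a)`. -/
def mB (j : Fin q) : RawC A B M q p →ₗ[k] RawC A B M (q + 1) p where
  toFun g := fun b m a => g (merge b j) m a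
  map_add' g g' := rfl
  map_smul' c g := rfl

/-- `g ↦ (b,m,a) ↦ g((b₁,…,b_q), b_{q+1}·m, a)`. -/
def lB : RawC A B M q p →ₗ[k] RawC A B M (q + 1) p where
  toFun g := fun b m a => g (Fin.init b) (b (Fin.last q) • m) a
  map_add' g g' := rfl
  map_smul' c g := rfl

/-- `g ↦ (b,m,a) ↦ g(b, m·a₁, (a₂,…,a_{p+1}))`. -/
def tA : RawC A B M q p →ₗ[k] RawC A B M q (p + 1) where
  toFun g := fun b m a => g b (op (a 0) • m) (Fin.tail a)
  map_add' g g' := rfl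
  map_smul' c g := rfl

/-- `g ↦ (b,m,a) ↦ g(b, m, (a₁,…,aⱼ·a_{j+1},…))`. -/
def mA (j : Fin p) : RawC A B M q p →ₗ[k] RawC A B M q (p + 1) where
  toFun g := fun b m a => g b m (merge a j)
  map_add' g g' := rfl
  map_smul' c g := rfl

/-- `g ↦ (b,m,a) ↦ g(b, m, (a₁,…,a_p))·a_{p+1}`. -/
def lA : RawC A B M q p →ₗ[k] RawC A B M q (p + 1) where
  toFun g := fun b m a => op (a (Fin.last p)) • g b m (Fin.init a)
  map_add' g g' := by funext b m a; exact smul_add _ _ _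
  map_smul' c g := by funext b m a; exact smul_comm _ _ _

end builders

/-- The Hochschild-type coboundary of the complex `K•` computing the cohomology along an
arrow.  Its component landing in `Hom_k(B^{⊗(q+1)} ⊗ M ⊗ A^{⊗p}, M)` is
`(b₁,…,b_{q+1},m,a) ↦ b₁·f(b₂,…,b_{q+1},m,a) + Σᵢ (-1)^i f(…,bᵢb_{i+1},…,m,a)
+ (-1)^{q+1} f(b₁,…,b_q,b_{q+1}·m,a)`, and its component landing in
`Hom_k(B^{⊗q} ⊗ M ⊗ A^{⊗(p+1)}, M)` is
`(-1)^q [f(b,m·a₁,a₂,…,a_{p+1}) + Σᵢ (-1)^i f(b,m,…,aᵢa_{i+1},…)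
+ (-1)^{p+1} f(b,m,a₁,…,a_p)·a_{p+1}]`. -/
def dLin (n : ℕ) : Raw A B M n →ₗ[k] Raw A B M (n + 1) :=
  LinearMap.pi fun i =>
    (match i with
      | ⟨(0, _), _⟩ => 0
      | ⟨(qq + 1, p), h⟩ =>
          (tB k A B M
            + (∑ j : Fin qq, ((-1 : ℤ) ^ ((j : ℕ) + 1)) • mB k A B M j)
            + ((-1 : ℤ) ^ (qq + 1)) • lB k A B M) ∘ₗ
            LinearMap.proj (⟨(qq, p), by omega⟩ : Idx n))
    + (match i with
      | ⟨(_, 0), _⟩ => 0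
      | ⟨(q, pp + 1), h⟩ =>
          (((-1 : ℤ) ^ q) •
            (tA k A B M
              + (∑ j : Fin pp, ((-1 : ℤ) ^ ((j : ℕ) + 1)) • mA k A B M j)
              + ((-1 : ℤ) ^ (pp + 1)) • lA k A B M)) ∘ₗ
            LinearMap.proj (⟨(q, pp), by omega⟩ : Idx n))

/-- The `n`-cocycles of the complex `K•`. -/
def Zsub (n : ℕ) : Submodule k (Raw A B M n) :=
  mlSub k A B M n ⊓ LinearMap.ker (dLin k A B M n)

/-- The `n`-coboundaries of the complex `K•`. -/
def Bsub : (n : ℕ) → Submodule k (Raw A B M n)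
  | 0 => ⊥
  | (n + 1) => (mlSub k A B M n).map (dLin k A B M n)

/-- The `n`-th cohomology of the complex `K•`. -/
def Hcoh (n : ℕ) : Type :=
  Zsub k A B M n ⧸
    ((Bsub k A B M n ⊓ Zsub k A B M n).comap (Zsub k A B M n).subtype)

instance (n : ℕ) : AddCommGroup (Hcoh k A B M n) :=
  inferInstanceAs (AddCommGroup (Zsub k A B M n ⧸
    ((Bsub k A B M n ⊓ Zsub k A B M n).comap (Zsub k A B M n).subtype)))

instance (n : ℕ) : Module k (Hcoh k A B M n) :=
  inferInstanceAs (Module k (Zsub k A B M n ⧸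
    ((Bsub k A B M n ⊓ Zsub k A B M n).comap (Zsub k A B M n).subtype)))



namespace Corner3

section hoch

variable {k Y : Type} [Field k] [Ring Y] [Algebra k Y]

theorem merge_cons_zero {q : ℕ} (x : Y) (y : Fin (q + 1) → Y) :
    merge (Fin.cons x y : Fin (q + 2) → Y) 0 = Fin.cons (x * y 0) (Fin.tail y) := by
  funext l
  refine Fin.cases ?_ (fun l => ?_) l
  · simp [merge]
  · simp [merge, Fin.tail]

theorem merge_cons_succ {q : ℕ} (x : Y) (y : Fin (q + 1) → Y) (j : Fin q) :
    merge (Fin.cons x y : Fin (q + 2) → Y) j.succ = Fin.cons x (merge y j) := by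
  funext l
  refine Fin.cases ?_ (fun l => ?_) l
  · simp [merge]
  · simp [merge, ← Fin.succ_castSucc]

theorem init_cons {q : ℕ} (x : Y) (y : Fin (q + 1) → Y) :
    Fin.init (Fin.cons x y : Fin (q + 2) → Y) = Fin.cons x (Fin.init y) := by
  funext l
  refine Fin.cases ?_ (fun l => ?_) l
  · simp [Fin.init]
  · simp [Fin.init, ← Fin.succ_castSucc]

theorem snoc_cons {q : ℕ} (x : Y) (y : Fin q → Y) (z : Y) :
    (Fin.snoc (Fin.cons x y : Fin (q + 1) → Y) z : Fin (q + 2) → Y)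
      = Fin.cons x (Fin.snoc y z : Fin (q + 1) → Y) :=
  (Fin.cons_snoc_eq_snoc_cons x y z).symm

variable {W : Type} [AddCommGroup W] [Module k W]

/-- The Hochschild coboundary of raw functions. -/
def dH (L R : Y → W →ₗ[k] W) (q : ℕ) :
    ((Fin q → Y) → W) →ₗ[k] ((Fin (q + 1) → Y) → W) where
  toFun g := fun x => L (x 0) (g (Fin.tail x))
    + (∑ j : Fin q, ((-1 : ℤ) ^ ((j : ℕ) + 1)) • g (merge x j))
    + ((-1 : ℤ) ^ (q + 1)) • R (x (Fin.last q)) (g (Fin.init x))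
  map_add' g g' := by
    funext x
    simp only [Pi.add_apply, map_add, smul_add, Finset.sum_add_distrib]
    abel
  map_smul' c g := by
    funext x
    simp only [Pi.smul_apply, map_smul, smul_add, Finset.smul_sum, RingHom.id_apply]
    simp only [smul_comm c]

theorem dH_apply (L R : Y → W →ₗ[k] W) (q : ℕ) (g : (Fin q → Y) → W) (x : Fin (q + 1) → Y) :
    dH L R q g x = L (x 0) (g (Fin.tail x))
    + (∑ j : Fin q, ((-1 : ℤ) ^ ((j : ℕ) + 1)) • g (merge x j))
    + ((-1 : ℤ) ^ (q + 1)) • R (x (Fin.last q)) (g (Fin.init x)) := rfl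

theorem dH_comp {L R : Y → W →ₗ[k] W} (U : W →ₗ[k] W) (hL : ∀ x w, U (L x w) = L x (U w))
    (hR : ∀ x w, U (R x w) = R x (U w)) (q : ℕ) (g : (Fin q → Y) → W) (x : Fin (q + 1) → Y) :
    dH L R q (fun y => U (g y)) x = U (dH L R q g x) := by
  simp only [dH_apply, map_add, map_sum, map_zsmul, hL, hR]

/-- The left action on `Y → W` making currying compatible with `dH`. -/
def Lc (L : Y → W →ₗ[k] W) (b : Y) : (Y → W) →ₗ[k] (Y → W) where
  toFun φ := fun x => φ (x * b) - L x (φ b)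
  map_add' φ ψ := by funext x; simp only [Pi.add_apply, map_add]; abel
  map_smul' c φ := by funext x; simp [smul_sub]

/-- The right action on `Y → W` making currying compatible with `dH`. -/
def Rc (R : Y → W →ₗ[k] W) (b : Y) : (Y → W) →ₗ[k] (Y → W) where
  toFun φ := fun x => R b (φ x)
  map_add' φ ψ := by funext x; simp only [Pi.add_apply, map_add]
  map_smul' c φ := by funext x; simp

/-- Currying the first variable. -/
def cur {q : ℕ} (g : (Fin (q + 1) → Y) → W) : (Fin q → Y) → (Y → W) :=
  fun z x => g (Fin.cons x z)

theorem cur_injective {q : ℕ} {g g' : (Fin (q + 1) → Y) → W} (h : cur g = cur g') : g = g' := by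
  funext x
  have := congrFun (congrFun h (Fin.tail x)) (x 0)
  simpa [cur] using this

theorem cur_dH (L R : Y → W →ₗ[k] W) (q : ℕ) (g : (Fin (q + 1) → Y) → W) :
    cur (dH L R (q + 1) g) = - dH (Lc L) (Rc R) q (cur g) := by
  funext y x
  have h1 : (Fin.cons (y 0) (Fin.tail y) : Fin (q + 1) → Y) = y := Fin.cons_self_tail y
  have h2 : (Fin.cons x y : Fin (q + 2) → Y) (Fin.last (q + 1)) = y (Fin.last q) := by
    rw [← Fin.succ_last, Fin.cons_succ]
  simp only [cur, dH_apply, Pi.neg_apply, Pi.add_apply, Finset.sum_apply, Pi.smul_apply,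
    Fin.sum_univ_succ, merge_cons_zero, merge_cons_succ, init_cons, Fin.tail_cons, Fin.cons_zero,
    h2, Lc, Rc, LinearMap.coe_mk, AddHom.coe_mk, h1, Fin.val_zero, Fin.val_succ]
  simp only [pow_succ (-1 : ℤ) (_ + 1), mul_neg, mul_one, neg_smul, Finset.sum_neg_distrib,
    zero_add, pow_one, one_smul]
  abel

theorem dH_dH : ∀ (q : ℕ) (W : Type) [AddCommGroup W] [Module k W] (L R : Y → W →ₗ[k] W)
    (_ : ∀ x y w, L (x * y) w = L x (L y w)) (_ : ∀ x y w, R (x * y) w = R y (R x w))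
    (_ : ∀ x y w, L x (R y w) = R y (L x w)) (g : (Fin q → Y) → W),
    dH L R (q + 1) (dH L R q g) = 0 := by
  intro q
  induction q with
  | zero =>
    intro W _ _ L R hL hR hLR g
    funext x
    have e : ∀ y : Fin 0 → Y, y = ![] := fun y => Subsingleton.elim _ _
    simp only [dH_apply, Finset.univ_eq_empty, Finset.sum_empty, add_zero, e, map_add, map_zsmul,
      Fin.sum_univ_succ]
    simp [merge, Fin.tail, Fin.init, hL, hR, hLR]
    abel
  | succ q ih =>
    intro W _ _ L R hL hR hLR g
    apply cur_injective
    rw [cur_dH, cur_dH, map_neg, ih (Y → W) (Lc L) (Rc R)]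
    · rw [neg_zero, neg_zero]; rfl
    · intro x y w; funext z
      simp [Lc, mul_assoc, hL]
    · intro x y w; funext z
      simp [Rc, hR]
    · intro x y w; funext z
      simp [Rc, Lc, hLR]

/-- Contraction in the last variable. -/
theorem dH_last : ∀ (q : ℕ) (W : Type) [AddCommGroup W] [Module k W] (L R : Y → W →ₗ[k] W)
    (S : (Y → W) →ₗ[k] W) (Q : (Y → W) → Prop) (E : W → Prop)
    (_ : ∀ b φ, S (fun x => L b (φ x)) = L b (S φ))
    (_ : ∀ b φ, Q φ → S (fun x => φ (b * x)) = R b (S φ))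
    (_ : ∀ w, E w → S (fun x => R x w) = w)
    (f : (Fin (q + 1) → Y) → W) (_ : ∀ b : Fin q → Y, Q (fun x => f (Fin.snoc b x)))
    (_ : ∀ b, E (f b)) (b : Fin (q + 1) → Y),
    S (fun x => dH L R (q + 1) f (Fin.snoc b x))
      = dH L R q (fun b' => S (fun x => f (Fin.snoc b' x))) b + ((-1 : ℤ) ^ q) • f b := by
  intro q
  induction q with
  | zero =>
    intro W _ _ L R S Q E h1 h2 h3 f hQ hE b
    obtain ⟨b0, rfl⟩ : ∃ b0, b = fun _ => b0 := ⟨b 0, by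
      funext i; rw [Fin.fin_one_eq_zero i]⟩
    have e : ∀ (x : Y), (Fin.snoc (α := fun _ => Y) (![] : Fin 0 → Y) x : Fin 1 → Y) = fun _ => x := by
      intro x; funext i; rw [Fin.fin_one_eq_zero i]; exact Fin.snoc_last (α := fun _ => Y) x ![]
    have key : ∀ x, dH L R 1 f (Fin.snoc (α := fun _ => Y) (fun _ : Fin 1 => b0) x)
        = L b0 (f (fun _ => x)) - f (fun _ => b0 * x) + R x (f (fun _ => b0)) := by
      intro x
      have e0 : (Fin.snoc (α := fun _ => Y) (fun _ : Fin 1 => b0) x : Fin 2 → Y) 0 = b0 := rfl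
      have e1 : Fin.tail (Fin.snoc (α := fun _ => Y) (fun _ : Fin 1 => b0) x : Fin 2 → Y)
        = fun _ => x := by
        funext i; rw [Subsingleton.elim i 0]; rfl
      have e2 : merge (Fin.snoc (α := fun _ => Y) (fun _ : Fin 1 => b0) x : Fin 2 → Y) 0
        = fun _ => b0 * x := by
        funext i; rw [Subsingleton.elim i 0]; rfl
      rw [dH_apply]
      simp [e0, e1, e2]
      abel
    have e' : ∀ y : Fin 0 → Y, y = ![] := fun y => Subsingleton.elim _ _
    have hq := hQ ![]
    simp only [e] at hq
    have : (fun x => dH L R 1 f (Fin.snoc (α := fun _ => Y) (fun _ : Fin 1 => b0) x))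
       = (fun x => L b0 (f (fun _ => x))) - (fun x => (fun x => f (fun _ => x)) (b0 * x))
         + (fun x => R x (f (fun _ => b0))) := by
      funext x; rw [key]; rfl
    rw [this, map_add, map_sub, h1, h2 _ _ hq, h3 _ (hE _), dH_apply]
    simp only [e', e]
    simp
    abel
  | succ q ih =>
    intro W _ _ L R S Q E h1 h2 h3 f hQ hE b
    -- the pointwise contraction
    let S' : (Y → (Y → W)) →ₗ[k] (Y → W) :=
      { toFun := fun φ y => S (fun x => φ x y)
        map_add' := fun φ ψ => by
          funext y; exact map_add S (fun x => φ x y) (fun x => ψ x y)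
        map_smul' := fun c φ => by
          funext y; exact map_smul S c (fun x => φ x y) }
    have := ih (Y → W) (Lc L) (Rc R) S' (fun φ => ∀ y, Q (fun x => φ x y)) (fun w => ∀ y, E (w y))
      (by
        intro b φ; funext y
        show S ((fun x => φ x (y * b)) - (fun x => L y (φ x b))) = _
        rw [map_sub, h1]; rfl)
      (by
        intro b φ hφ; funext y
        exact h2 b (fun x => φ x y) (hφ y))
      (by
        intro w hw; funext y
        exact h3 (w y) (hw y))
      (cur f)
      (by
        intro b y
        have := hQ (Fin.cons y b)
        simp only [snoc_cons] at this
        exact this)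
      (by intro b y; exact hE _)
      (Fin.tail b)
    have h := congrFun this (b 0)
    rw [← Fin.cons_self_tail b]
    simp only [snoc_cons]
    have c1 : ∀ x, dH L R (q + 1 + 1) f (Fin.cons (b 0) (Fin.snoc (α := fun _ => Y) (Fin.tail b) x : Fin (q + 2) → Y))
      = - dH (Lc L) (Rc R) (q + 1) (cur f) (Fin.snoc (α := fun _ => Y) (Fin.tail b) x) (b 0) := by
      intro x
      exact congrFun (congrFun (cur_dH L R (q + 1) f) _) _
    have c2 : dH L R (q + 1) (fun b' => S (fun x => f (Fin.snoc b' x)))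
        (Fin.cons (b 0) (Fin.tail b))
      = - dH (Lc L) (Rc R) q (cur (fun b' => S (fun x => f (Fin.snoc b' x)))) (Fin.tail b) (b 0) :=
      congrFun (congrFun (cur_dH L R q _) _) _
    rw [c2]
    simp only [c1]
    have c3 : (fun x => - dH (Lc L) (Rc R) (q + 1) (cur f) (Fin.snoc (α := fun _ => Y) (Fin.tail b) x) (b 0))
      = - (fun x => dH (Lc L) (Rc R) (q + 1) (cur f) (Fin.snoc (α := fun _ => Y) (Fin.tail b) x) (b 0)) := rfl
    rw [c3, map_neg]
    have c4 : cur (fun b' : Fin (q + 1) → Y => S (fun x => f (Fin.snoc b' x)))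
      = fun b' => S' (fun x => cur f (Fin.snoc b' x)) := by
      funext z y
      simp only [cur, snoc_cons]; rfl
    rw [c4]
    have h' : S (fun x => dH (Lc L) (Rc R) (q + 1) (cur f) (Fin.snoc (α := fun _ => Y) (Fin.tail b) x) (b 0))
      = _ := h
    rw [h', Pi.add_apply, neg_add, pow_succ]
    simp [cur]

/-- Contraction in the first variable. -/
theorem dH_first (q : ℕ) (L R : Y → W →ₗ[k] W) (S : (Y → W) →ₗ[k] W)
    (Q : (Y → W) → Prop) (E : W → Prop)
    (h1 : ∀ b φ, S (fun x => R b (φ x)) = R b (S φ))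
    (h2 : ∀ b φ, Q φ → S (fun x => φ (x * b)) = L b (S φ))
    (h3 : ∀ w, E w → S (fun x => L x w) = w)
    (f : (Fin (q + 1) → Y) → W) (hQ : ∀ b : Fin q → Y, Q (fun x => f (Fin.cons x b)))
    (hE : ∀ b, E (f b)) (y : Fin (q + 1) → Y) :
    S (fun x => dH L R (q + 1) f (Fin.cons x y))
      = f y - dH L R q (fun b' => S (fun x => f (Fin.cons x b'))) y := by
  have key : (fun x => dH L R (q + 1) f (Fin.cons x y)) =
      (fun x => L x (f y)) - ((fun x => (fun x => f (Fin.cons x (Fin.tail y))) (x * y 0))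
        + (∑ j : Fin q, ((-1 : ℤ) ^ ((j : ℕ) + 1)) • fun x => f (Fin.cons x (merge y j)))
        + ((-1 : ℤ) ^ (q + 1)) • fun x => R (y (Fin.last q)) (f (Fin.cons x (Fin.init y)))) := by
    funext x
    have := congrFun (congrFun (cur_dH L R q f) y) x
    rw [cur] at this
    rw [this]
    simp only [Pi.neg_apply, dH_apply, Pi.add_apply, Finset.sum_apply, Pi.smul_apply, Pi.sub_apply,
      Lc, Rc, LinearMap.coe_mk, AddHom.coe_mk, cur, Fin.cons_self_tail]
    abel
  rw [key, map_sub, map_add, map_add, h3 _ (hE _), h2 _ _ (hQ _), map_sum, map_zsmul, h1, dH_apply]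
  simp only [map_zsmul]

end hoch


section multi

variable {k Y : Type} [Field k] [Ring Y] [Algebra k Y]
variable {W V V' : Type} [AddCommGroup W] [Module k W] [AddCommGroup V] [Module k V]
  [AddCommGroup V'] [Module k V']

theorem isLin_of {f : V → W} (g : V →ₗ[k] W) (h : ∀ x, f x = g x) : IsLinearMap k f := by
  have : f = g := funext h
  rw [this]; exact g.isLinear

theorem isLin_zero : IsLinearMap k (0 : V → W) := (0 : V →ₗ[k] W).isLinear

theorem isLin_add {f g : V → W} (hf : IsLinearMap k f) (hg : IsLinearMap k g) :
    IsLinearMap k (fun x => f x + g x) := (hf.mk' f + hg.mk' g).isLinear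

theorem isLin_smul {f : V → W} (c : k) (hf : IsLinearMap k f) :
    IsLinearMap k (fun x => c • f x) := (c • hf.mk' f).isLinear

theorem isLin_zsmul {f : V → W} (c : ℤ) (hf : IsLinearMap k f) :
    IsLinearMap k (fun x => c • f x) := (c • hf.mk' f).isLinear

theorem isLin_comp {f : V → W} {g : V' → V} (hf : IsLinearMap k f) (hg : IsLinearMap k g) :
    IsLinearMap k (fun x => f (g x)) := (hf.mk' f ∘ₗ hg.mk' g).isLinear

theorem isLin_sum {ι : Type} (s : Finset ι) {f : ι → V → W} (hf : ∀ i, IsLinearMap k (f i)) :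
    IsLinearMap k (fun x => ∑ i ∈ s, f i x) :=
  isLin_of (∑ i ∈ s, (hf i).mk' (f i)) (fun x => by simp [LinearMap.sum_apply])

theorem isLin_pi {ι : Type} {f : V → ι → W} (hf : ∀ i, IsLinearMap k (fun x => f x i)) :
    IsLinearMap k f :=
  ⟨fun x y => funext fun i => (hf i).map_add x y, fun c x => funext fun i => (hf i).map_smul c x⟩

theorem isLin_eval {ι : Type} {f : V → ι → W} (hf : IsLinearMap k f) (i : ι) :
    IsLinearMap k (fun x => f x i) :=
  ⟨fun x y => congrFun (hf.map_add x y) i, fun c x => congrFun (hf.map_smul c x) i⟩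

variable (k) in
/-- Multilinearity of a raw function of several variables. -/
def multi {q : ℕ} (g : (Fin q → Y) → W) : Prop :=
  ∀ b i, IsLinearMap k (fun x => g (Function.update b i x))

theorem merge_update {q : ℕ} (b : Fin (q + 1) → Y) (i : Fin (q + 1)) (j : Fin q) :
    ∃ (l : Fin q) (t : Y →ₗ[k] Y), ∀ x,
      merge (Function.update b i x) j = Function.update (merge b j) l (t x) := by
  have key : ∀ (l : Fin q) (x : Y), Function.update b i x l.castSucc
      = if (l : ℕ) = i then x else b l.castSucc := by
    intro l x; simp only [Function.update_apply, Fin.ext_iff, Fin.val_castSucc]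
  have key' : ∀ (l : Fin q) (x : Y), Function.update b i x l.succ
      = if (l : ℕ) + 1 = i then x else b l.succ := by
    intro l x; simp only [Function.update_apply, Fin.ext_iff, Fin.val_succ]
  rcases lt_trichotomy (i : ℕ) (j : ℕ) with h | h | h
  · refine ⟨⟨i, by omega⟩, LinearMap.id, fun x => ?_⟩
    funext l
    simp only [merge, key, key', Function.update_apply, Fin.ext_iff, LinearMap.id_apply]
    split_ifs <;> first | rfl | omega
  · refine ⟨j, LinearMap.mulRight k (b j.succ), fun x => ?_⟩
    funext l
    simp only [merge, key, key', Function.update_apply, Fin.ext_iff, LinearMap.mulRight_apply]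
    split_ifs <;> first | rfl | omega | skip
    rename_i h1 h2 h3 h4
    have : l = j := Fin.ext h2
    rw [this]
  · by_cases h' : (i : ℕ) = j + 1
    · refine ⟨j, LinearMap.mulLeft k (b j.castSucc), fun x => ?_⟩
      funext l
      simp only [merge, key, key', Function.update_apply, Fin.ext_iff, LinearMap.mulLeft_apply]
      split_ifs <;> first | rfl | omega | skip
      rename_i h1 h2 h3 h4
      have : l = j := Fin.ext h2
      rw [this]
    · refine ⟨⟨i - 1, by omega⟩, LinearMap.id, fun x => ?_⟩
      funext l
      simp only [merge, key, key', Function.update_apply, Fin.ext_iff, LinearMap.id_apply]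
      split_ifs <;> first | rfl | omega

theorem dH_multi {L R : Y → W →ₗ[k] W} (E : W → Prop)
    (hL : ∀ w, E w → IsLinearMap k (fun x => L x w))
    (hR : ∀ w, E w → IsLinearMap k (fun x => R x w)) {q : ℕ} {g : (Fin q → Y) → W}
    (hE : ∀ b, E (g b)) (hg : multi k g) : multi k (dH L R q g) := by
  intro b i
  simp only [dH_apply]
  refine isLin_add (isLin_add ?_ (isLin_sum _ fun j => isLin_zsmul _ ?_)) (isLin_zsmul _ ?_)
  · refine Fin.cases ?_ (fun i => ?_) i
    · simp only [Fin.tail_update_zero, Function.update_self]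
      exact hL _ (hE _)
    · simp only [Fin.tail_update_succ]
      have : ∀ x, Function.update b i.succ x 0 = b 0 := fun x =>
        Function.update_of_ne (Fin.succ_ne_zero i).symm _ _
      simp only [this]
      exact isLin_comp (L (b 0)).isLinear (hg _ _)
  · obtain ⟨l, t, h⟩ := merge_update (k := k) b i j
    simp only [h]
    exact isLin_comp (f := fun y => g (Function.update (merge b j) l y)) (hg _ _) t.isLinear
  · refine Fin.lastCases ?_ (fun i => ?_) i
    · simp only [Fin.init_update_last, Function.update_self]
      exact hR _ (hE _)
    · simp only [Fin.init_update_castSucc]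
      have : ∀ x, Function.update b i.castSucc x (Fin.last q) = b (Fin.last q) := fun x =>
        Function.update_of_ne (Fin.castSucc_lt_last i).ne' _ _
      simp only [this]
      exact isLin_comp (R (b (Fin.last q))).isLinear (hg _ _)

theorem dH_mem {L R : Y → W →ₗ[k] W} (E : Submodule k W)
    (hL : ∀ x, ∀ w ∈ E, L x w ∈ E) (hR : ∀ x, ∀ w ∈ E, R x w ∈ E)
    {q : ℕ} {g : (Fin q → Y) → W}
    (hE : ∀ b, g b ∈ E) (b : Fin (q + 1) → Y) : dH L R q g b ∈ E := by
  rw [dH_apply]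
  refine add_mem (add_mem (hL _ _ (hE _)) (sum_mem fun j _ => zsmul_mem (hE _) _))
    (zsmul_mem (hR _ _ (hE _)) _)

theorem dH_comm {Y' : Type} [Ring Y'] [Algebra k Y'] {L R : Y → W →ₗ[k] W} {L' R' : Y' → W →ₗ[k] W}
    (h1 : ∀ x y w, L' y (L x w) = L x (L' y w)) (h2 : ∀ x y w, L' y (R x w) = R x (L' y w))
    (h3 : ∀ x y w, R' y (L x w) = L x (R' y w)) (h4 : ∀ x y w, R' y (R x w) = R x (R' y w))
    {q p : ℕ} (f : (Fin q → Y) → (Fin p → Y') → W) (b : Fin (q + 1) → Y) (a : Fin (p + 1) → Y') :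
    dH L R q (fun b' => dH L' R' p (f b') a) b
      = dH L' R' p (fun a' => dH L R q (fun b' => f b' a') b) a := by
  have key : (fun b' => dH L' R' p (f b') a) = (fun b' => L' (a 0) (f b' (Fin.tail a)))
    + (∑ j : Fin p, ((-1 : ℤ) ^ ((j : ℕ) + 1)) • fun b' => f b' (merge a j))
    + ((-1 : ℤ) ^ (p + 1)) • fun b' => R' (a (Fin.last p)) (f b' (Fin.init a)) := by
    funext b'
    simp only [dH_apply, Pi.add_apply, Finset.sum_apply, Pi.smul_apply]
  rw [key, map_add, map_add, map_sum, map_zsmul]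
  simp only [Pi.add_apply, Finset.sum_apply, Pi.smul_apply, map_zsmul]
  rw [dH_comp (L' (a 0)) (fun x w => h1 x _ w) (fun x w => h2 x _ w),
    dH_comp (R' _) (fun x w => h3 x _ w) (fun x w => h4 x _ w), dH_apply (L := L')]

end multi

section cochains

variable {k A B R N : Type} [Field k] [Ring A] [Ring B] [Ring R] [Algebra k A] [Algebra k B]
  [Algebra k R] [AddCommGroup N] [Module k N] [Module R N] [IsScalarTower k R N]
  [SMulCommClass R k N]

/-- Raw functions of bidegree `(q,p)`. -/
abbrev RC (A B N X : Type) (q p : ℕ) : Type := (Fin q → B) → X → (Fin p → A) → N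

/-- Families of raw functions over all bidegrees. -/
abbrev T (A B N X : Type) : Type := ∀ q p : ℕ, RC A B N X q p

section X

variable {X : Type} [AddCommGroup X] [Module k X] [Module R X] [IsScalarTower k R X]

/-- Postcomposition with the action. -/
def postOp (k N X : Type) [Field k] {R : Type} [Ring R] [AddCommGroup N] [Module k N] [Module R N]
    [SMulCommClass R k N] (r : R) : (X → N) →ₗ[k] (X → N) where
  toFun w := fun m => r • w m
  map_add' w w' := by funext m; exact smul_add _ _ _
  map_smul' c w := by funext m; exact smul_comm _ _ _

/-- Precomposition with the action. -/
def preOp (k N X : Type) [Field k] {R : Type} [Ring R] [AddCommGroup N] [Module k N]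
    [AddCommGroup X] [Module R X] (r : R) : (X → N) →ₗ[k] (X → N) where
  toFun w := fun m => w (r • m)
  map_add' w w' := rfl
  map_smul' c w := rfl

@[simp] theorem postOp_apply (r : R) (w : X → N) (m : X) : postOp k N X r w m = r • w m := rfl
@[simp] theorem preOp_apply (r : R) (w : X → N) (m : X) : preOp k N X r w m = w (r • m) := rfl

variable (k N X) in
/-- `k`-linear maps as a submodule of functions. -/
def linS : Submodule k (X → N) where
  carrier := {w | IsLinearMap k w}
  zero_mem' := isLin_zero
  add_mem' h h' := isLin_add h h'
  smul_mem' c _ h := isLin_smul c h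

theorem post_linS (r : R) (w : X → N) (h : w ∈ linS k N X) : postOp k N X r w ∈ linS k N X := by
  refine ⟨fun x y => ?_, fun c x => ?_⟩
  · simp only [postOp_apply]; rw [h.map_add, smul_add]
  · simp only [postOp_apply]; rw [h.map_smul, smul_comm]

theorem pre_linS (r : R) (w : X → N) (h : w ∈ linS k N X) : preOp k N X r w ∈ linS k N X := by
  have : SMulCommClass k R X := IsScalarTower.to_smulCommClass
  refine ⟨fun x y => ?_, fun c x => ?_⟩
  · simp only [preOp_apply]; rw [smul_add, h.map_add]
  · simp only [preOp_apply]; rw [← smul_comm c, h.map_smul]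

theorem post_lin {Y : Type} [Ring Y] [Algebra k Y] (β : Y →ₗ[k] R) (w : X → N) :
    IsLinearMap k (fun y => postOp k N X (β y) w) := by
  refine ⟨fun x y => ?_, fun c x => ?_⟩
  · funext m; simp [add_smul]
  · funext m; simp

theorem pre_lin {Y : Type} [Ring Y] [Algebra k Y] (β : Y →ₗ[k] R) (w : X → N)
    (h : w ∈ linS k N X) :
    IsLinearMap k (fun y => preOp k N X (β y) w) := by
  refine ⟨fun x y => ?_, fun c x => ?_⟩
  · funext m; simp only [preOp_apply, map_add, add_smul, h.map_add, Pi.add_apply]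
  · funext m; simp only [preOp_apply, map_smul, smul_assoc, h.map_smul, Pi.smul_apply]

variable (β : B →ₐ[k] R) (α : Aᵐᵒᵖ →ₐ[k] R)

/-- `α` as a linear map on `A`. -/
def αl (α : Aᵐᵒᵖ →ₐ[k] R) : A →ₗ[k] R := α.toLinearMap ∘ₗ (opLinearEquiv k).toLinearMap

theorem αl_apply (a : A) : αl α a = α (op a) := rfl

theorem αl_mul (a a' : A) : αl α (a * a') = αl α a' * αl α a := by
  simp [αl_apply]

variable (N X) in
/-- The `B`-part of the coboundary. -/
def dB (q p : ℕ) : RC A B N X q p →ₗ[k] RC A B N X (q + 1) p where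
  toFun f := fun b m a => dH (fun x => postOp k N X (β x)) (fun x => preOp k N X (β x)) q
    (fun b' m' => f b' m' a) b m
  map_add' f g := by
    funext b m a
    exact congrFun (congrFun (map_add (dH (fun x => postOp k N X (β x))
      (fun x => preOp k N X (β x)) q) (fun b' m' => f b' m' a) (fun b' m' => g b' m' a)) b) m
  map_smul' c f := by
    funext b m a
    exact congrFun (congrFun (map_smul (dH (fun x => postOp k N X (β x))
      (fun x => preOp k N X (β x)) q) c (fun b' m' => f b' m' a)) b) m

variable (N X) in
/-- The `A`-part of the coboundary. -/
def dA (q p : ℕ) : RC A B N X q p →ₗ[k] RC A B N X q (p + 1) where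
  toFun f := fun b m a => dH (fun x => preOp k N X (αl α x)) (fun x => postOp k N X (αl α x)) p
    (fun a' m' => f b m' a') a m
  map_add' f g := by
    funext b m a
    exact congrFun (congrFun (map_add (dH (fun x => preOp k N X (αl α x))
      (fun x => postOp k N X (αl α x)) p) (fun a' m' => f b m' a') (fun a' m' => g b m' a')) a) m
  map_smul' c f := by
    funext b m a
    exact congrFun (congrFun (map_smul (dH (fun x => preOp k N X (αl α x))
      (fun x => postOp k N X (αl α x)) p) c (fun a' m' => f b m' a')) a) m

theorem dB_apply (q p : ℕ) (f : RC A B N X q p) (b m a) : dB N X β q p f b m a =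
  dH (fun x => postOp k N X (β x)) (fun x => preOp k N X (β x)) q
    (fun b' m' => f b' m' a) b m := rfl

theorem dA_apply (q p : ℕ) (f : RC A B N X q p) (b m a) : dA N X α q p f b m a =
  dH (fun x => preOp k N X (αl α x)) (fun x => postOp k N X (αl α x)) p
    (fun a' m' => f b m' a') a m := rfl

theorem dB_dB (q p : ℕ) (f : RC A B N X q p) : dB N X β (q + 1) p (dB N X β q p f) = 0 := by
  funext b m a
  refine congrFun (congrFun (dH_dH q (X → N) (fun x => postOp k N X (β x))
    (fun x => preOp k N X (β x)) ?_ ?_ ?_ (fun b' m' => f b' m' a)) b) m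
  · intro x y w; funext m; simp [mul_smul]
  · intro x y w; funext m; simp [mul_smul]
  · intro x y w; funext m; simp

theorem dA_dA (q p : ℕ) (f : RC A B N X q p) : dA N X α q (p + 1) (dA N X α q p f) = 0 := by
  funext b m a
  refine congrFun (congrFun (dH_dH p (X → N) (fun x => preOp k N X (αl α x))
    (fun x => postOp k N X (αl α x)) ?_ ?_ ?_ (fun a' m' => f b m' a')) a) m
  · intro x y w; funext m; simp [mul_smul, αl_mul]
  · intro x y w; funext m; simp [mul_smul, αl_mul]
  · intro x y w; funext m; simp

theorem dB_dA (hc : ∀ (b : B) (a : A), β b * αl α a = αl α a * β b) (q p : ℕ) (f : RC A B N X q p) :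
    dB N X β q (p + 1) (dA N X α q p f) = dA N X α (q + 1) p (dB N X β q p f) := by
  funext b m a
  refine congrFun (dH_comm (k := k) (L := fun x => postOp k N X (β x))
    (R := fun x => preOp k N X (β x)) (L' := fun x => preOp k N X (αl α x))
    (R' := fun x => postOp k N X (αl α x)) ?_ ?_ ?_ ?_ (fun b' a' m' => f b' m' a') b a) m
  · intro x y w; funext m; simp
  · intro x y w; funext m; simp only [preOp_apply, ← mul_smul, hc]
  · intro x y w; funext m; simp only [postOp_apply, ← mul_smul, hc]
  · intro x y w; funext m; simp

variable (N X) in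
/-- The `B`-part of the total coboundary. -/
def bP : T A B N X →ₗ[k] T A B N X where
  toFun F := fun q p => match q with
    | 0 => 0
    | q + 1 => dB N X β q p (F q p)
  map_add' F G := by
    funext q p
    cases q
    · exact (add_zero _).symm
    · exact map_add _ _ _
  map_smul' c F := by
    funext q p
    cases q
    · exact (smul_zero c).symm
    · exact map_smul (dB N X β _ p) c (F _ p)

variable (N X) in
/-- The `A`-part of the total coboundary. -/
def aP : T A B N X →ₗ[k] T A B N X where
  toFun F := fun q p => match p with
    | 0 => 0
    | p + 1 => ((-1 : ℤ) ^ q) • dA N X α q p (F q p)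
  map_add' F G := by
    funext q p
    cases p
    · exact (add_zero _).symm
    · show _ • dA N X α q _ (F q _ + G q _) = _
      rw [map_add, smul_add]; rfl
  map_smul' c F := by
    funext q p
    cases p
    · exact (smul_zero c).symm
    · show _ • dA N X α q _ (c • F q _) = _
      rw [map_smul, smul_comm]; rfl

variable (N X) in
/-- The total coboundary. -/
def D : T A B N X →ₗ[k] T A B N X := bP N X β + aP N X α

theorem D_apply (F : T A B N X) (q p : ℕ) :
    D N X β α F q p = bP N X β F q p + aP N X α F q p := rfl

theorem bP_zero (F : T A B N X) (p : ℕ) : bP N X β F 0 p = 0 := rfl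
theorem bP_succ (F : T A B N X) (q p : ℕ) : bP N X β F (q + 1) p = dB N X β q p (F q p) := rfl
theorem aP_zero (F : T A B N X) (q : ℕ) : aP N X α F q 0 = 0 := rfl
theorem aP_succ (F : T A B N X) (q p : ℕ) :
    aP N X α F q (p + 1) = ((-1 : ℤ) ^ q) • dA N X α q p (F q p) := rfl

theorem D_D (hc : ∀ (b : B) (a : A), β b * αl α a = αl α a * β b) (F : T A B N X) : D N X β α (D N X β α F) = 0 := by
  have h1 : bP N X β (bP N X β F) = 0 := by
    funext q p
    rcases q with _ | _ | q
    · rfl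
    · rw [bP_succ, bP_zero, map_zero]; rfl
    · rw [bP_succ, bP_succ, dB_dB]; rfl
  have h2 : aP N X α (aP N X α F) = 0 := by
    funext q p
    rcases p with _ | _ | p
    · rfl
    · rw [aP_succ, aP_zero, map_zero, smul_zero]; rfl
    · rw [aP_succ, aP_succ, map_zsmul, dA_dA, smul_zero, smul_zero]; rfl
  have h3 : bP N X β (aP N X α F) + aP N X α (bP N X β F) = 0 := by
    funext q p
    show bP N X β (aP N X α F) q p + aP N X α (bP N X β F) q p = 0
    rcases q with _ | q <;> rcases p with _ | p
    · rw [bP_zero, aP_zero, add_zero]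
    · rw [bP_zero, aP_succ, bP_zero, map_zero, smul_zero, add_zero]
    · rw [aP_zero, bP_succ, aP_zero, map_zero, add_zero]
    · rw [aP_succ, bP_succ, bP_succ, aP_succ, map_zsmul, dB_dA β α hc, pow_succ]
      simp
  have : D N X β α (D N X β α F) = bP N X β (bP N X β F) + aP N X α (aP N X α F)
      + (bP N X β (aP N X α F) + aP N X α (bP N X β F)) := by
    simp only [D, LinearMap.add_apply, map_add]; abel
  rw [this, h1, h2, h3]; simp

variable (k) in
/-- Multilinear raw functions. -/
structure ML {q p : ℕ} (f : RC A B N X q p) : Prop where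
  hB : ∀ a, multi k (fun b m => f b m a)
  hM : ∀ b a, IsLinearMap k (fun m => f b m a)
  hA : ∀ b, multi k (fun a m => f b m a)

variable (k) in
theorem ML.zero {q p : ℕ} : ML k (0 : RC A B N X q p) :=
  ⟨fun _ _ _ => isLin_zero, fun _ _ => isLin_zero, fun _ _ _ => isLin_zero⟩

theorem ML.add {q p : ℕ} {f g : RC A B N X q p} (hf : ML k f) (hg : ML k g) : ML k (f + g) :=
  ⟨fun a b i => isLin_add (hf.hB a b i) (hg.hB a b i),
   fun b a => isLin_add (hf.hM b a) (hg.hM b a),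
   fun b a i => isLin_add (hf.hA b a i) (hg.hA b a i)⟩

theorem ML.smul {q p : ℕ} {f : RC A B N X q p} (c : k) (hf : ML k f) : ML k (c • f) :=
  ⟨fun a b i => isLin_smul c (hf.hB a b i),
   fun b a => isLin_smul c (hf.hM b a),
   fun b a i => isLin_smul c (hf.hA b a i)⟩

theorem ML.zsmul {q p : ℕ} {f : RC A B N X q p} (c : ℤ) (hf : ML k f) : ML k (c • f) :=
  ⟨fun a b i => isLin_zsmul c (hf.hB a b i),
   fun b a => isLin_zsmul c (hf.hM b a),
   fun b a i => isLin_zsmul c (hf.hA b a i)⟩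

theorem ML.dB {q p : ℕ} {f : RC A B N X q p} (hf : ML k f) : ML k (dB N X β q p f) := by
  refine ⟨fun a => ?_, fun b a => ?_, fun b a i => ?_⟩
  · exact dH_multi (fun w => w ∈ linS k N X) (fun w _ => post_lin β.toLinearMap w)
      (fun w hw => pre_lin β.toLinearMap w hw) (fun b => hf.hM b a) (hf.hB a)
  · exact dH_mem (linS k N X) (fun x w hw => post_linS _ w hw)
      (fun x w hw => pre_linS _ w hw) (fun b => hf.hM b a) b
  · have : IsLinearMap k (fun x => (fun b' m' => f b' m' (Function.update a i x))) :=
      isLin_pi fun b' => hf.hA b' a i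
    exact isLin_eval (isLin_comp (dH (fun x => postOp k N X (β x))
      (fun x => preOp k N X (β x)) q).isLinear this) b

theorem ML.dA {q p : ℕ} {f : RC A B N X q p} (hf : ML k f) : ML k (dA N X α q p f) := by
  refine ⟨fun a b i => ?_, fun b a => ?_, fun b => ?_⟩
  · have : IsLinearMap k (fun x => (fun a' m' => f (Function.update b i x) m' a')) :=
      isLin_pi fun a' => hf.hB a' b i
    exact isLin_eval (isLin_comp (dH (fun x => preOp k N X (αl α x))
      (fun x => postOp k N X (αl α x)) p).isLinear this) a
  · exact dH_mem (linS k N X) (fun x w hw => pre_linS _ w hw)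
      (fun x w hw => post_linS _ w hw) (fun a => hf.hM b a) a
  · exact dH_multi (fun w => w ∈ linS k N X) (fun w hw => pre_lin (αl α) w hw)
      (fun w _ => post_lin (αl α) w) (fun a => hf.hM b a) (hf.hA b)

variable (k A B N X) in
/-- Multilinear cochains of total degree `n`. -/
def G (n : ℕ) : Submodule k (T A B N X) where
  carrier := {F | ∀ q p, ML k (F q p) ∧ (q + p ≠ n → F q p = 0)}
  zero_mem' := fun q p => ⟨ML.zero k, fun _ => rfl⟩
  add_mem' := by
    intro F H hF hH q p
    refine ⟨(hF q p).1.add (hH q p).1, fun h => ?_⟩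
    show F q p + H q p = 0
    rw [(hF q p).2 h, (hH q p).2 h, add_zero]
  smul_mem' := by
    intro c F hF q p
    refine ⟨(hF q p).1.smul c, fun h => ?_⟩
    show c • F q p = 0
    rw [(hF q p).2 h, smul_zero]

theorem D_mem {n : ℕ} {F : T A B N X} (hF : F ∈ G k A B N X n) :
    D N X β α F ∈ G k A B N X (n + 1) := by
  intro q p
  rw [D_apply]
  refine ⟨ML.add ?_ ?_, fun h => ?_⟩
  · cases q
    · exact ML.zero k
    · exact (hF _ _).1.dB β
  · cases p
    · exact ML.zero k
    · exact ((hF _ _).1.dA α).zsmul _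
  · have h1 : bP N X β F q p = 0 := by
      cases q
      · rfl
      · rw [bP_succ, (hF _ _).2 (by omega), map_zero]
    have h2 : aP N X α F q p = 0 := by
      cases p
      · rfl
      · rw [aP_succ, (hF _ _).2 (by omega), map_zero, smul_zero]
    rw [h1, h2, add_zero]

variable (N X) in
/-- cocycles -/
def Zc (n : ℕ) : Submodule k (T A B N X) := G k A B N X n ⊓ LinearMap.ker (D N X β α)

variable (N X) in
/-- coboundaries -/
def Bc : ℕ → Submodule k (T A B N X)
  | 0 => ⊥
  | n + 1 => (G k A B N X n).map (D N X β α)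

end X

section pull

variable {X Y Z : Type} [AddCommGroup X] [Module k X] [Module R X] [IsScalarTower k R X]
  [AddCommGroup Y] [Module k Y] [Module R Y] [IsScalarTower k R Y]

variable (k A B N) in
/-- Pullback of cochains. -/
def pull (φ : X → Y) : T A B N Y →ₗ[k] T A B N X where
  toFun F := fun q p b m a => F q p b (φ m) a
  map_add' F G := rfl
  map_smul' c F := rfl

theorem pull_apply (φ : X → Y) (F : T A B N Y) (q p b m a) :
    pull k A B N φ F q p b m a = F q p b (φ m) a := rfl

theorem pull_mem {φ : X → Y} (h : IsLinearMap k φ) {n : ℕ} {F : T A B N Y}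
    (hF : F ∈ G k A B N Y n) : pull k A B N φ F ∈ G k A B N X n := by
  intro q p
  obtain ⟨⟨h1, h2, h3⟩, h4⟩ := hF q p
  refine ⟨⟨fun a b i => ?_, fun b a => isLin_comp (h2 b a) h, fun b a i => ?_⟩, fun hn => ?_⟩
  · exact isLin_pi fun m => isLin_eval (h1 a b i) (φ m)
  · exact isLin_pi fun m => isLin_eval (h3 b a i) (φ m)
  · funext b m a
    rw [pull_apply, h4 hn]; rfl

theorem D_pull (β : B →ₐ[k] R) (α : Aᵐᵒᵖ →ₐ[k] R) (φ : X →ₗ[R] Y) (F : T A B N Y) :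
    D N X β α (pull k A B N φ F) = pull k A B N φ (D N Y β α F) := by
  funext q p b m a
  rw [D_apply, pull_apply, D_apply]
  show bP N X β _ q p b m a + aP N X α _ q p b m a = bP N Y β F q p b (φ m) a + aP N Y α F q p b (φ m) a
  congr 1
  · cases q
    · rfl
    · simp only [bP_succ, dB_apply, dH_apply, Pi.add_apply, Finset.sum_apply, Pi.smul_apply,
        postOp_apply, preOp_apply, pull_apply, map_smul]
  · cases p
    · rfl
    · simp only [aP_succ, dA_apply, dH_apply, Pi.add_apply, Finset.sum_apply, Pi.smul_apply,
        postOp_apply, preOp_apply, pull_apply, map_smul]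

end pull

end cochains


section contraction

variable {k A B R N : Type} [Field k] [Ring A] [Ring B] [Ring R] [Algebra k A] [Algebra k B]
  [Algebra k R] [AddCommGroup N] [Module k N] [Module R N] [IsScalarTower k R N]
  [SMulCommClass R k N]
variable {X : Type} [AddCommGroup X] [Module k X] [Module R X] [IsScalarTower k R X]
variable {Y : Type} [Ring Y] [Algebra k Y]

/-- A finite family representing a tensor. -/
def rep (t : Y ⊗[k] X) : Finset (Y × X) := (TensorProduct.exists_finset t).choose

theorem rep_spec (t : Y ⊗[k] X) : t = ∑ i ∈ rep t, i.1 ⊗ₜ[k] i.2 :=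
  (TensorProduct.exists_finset t).choose_spec

variable (N) in
/-- Contraction against a section. -/
def contr (s : X →ₗ[k] Y ⊗[k] X) : (Y → X → N) →ₗ[k] (X → N) where
  toFun φ := fun m => ∑ i ∈ rep (s m), φ i.1 i.2
  map_add' φ ψ := by funext m; simp [Finset.sum_add_distrib]
  map_smul' c φ := by funext m; simp [Finset.smul_sum]

theorem contr_apply (s : X →ₗ[k] Y ⊗[k] X) (φ : Y → X → N) (m : X) :
    contr N s φ m = ∑ i ∈ rep (s m), φ i.1 i.2 := rfl

variable (k) in
/-- Bilinearity. -/
def bil (φ : Y → X → N) : Prop := (∀ x, IsLinearMap k (φ x)) ∧ IsLinearMap k φ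

/-- The bundled bilinear map. -/
def bil.mk {φ : Y → X → N} (h : bil k φ) : Y →ₗ[k] X →ₗ[k] N :=
  LinearMap.mk₂ k φ (fun x y m => congrFun (h.2.map_add x y) m)
    (fun c x m => congrFun (h.2.map_smul c x) m) (fun x m m' => (h.1 x).map_add m m')
    (fun c x m => (h.1 x).map_smul c m)

theorem contr_bil (s : X →ₗ[k] Y ⊗[k] X) {φ : Y → X → N} (h : bil k φ) (m : X) :
    contr N s φ m = TensorProduct.lift h.mk (s m) := by
  conv_rhs => rw [rep_spec (s m)]
  rw [map_sum, contr_apply]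
  rfl

theorem contr_lin (s : X →ₗ[k] Y ⊗[k] X) {φ : Y → X → N} (h : bil k φ) :
    IsLinearMap k (contr N s φ) :=
  isLin_of (TensorProduct.lift h.mk ∘ₗ s) (fun m => contr_bil s h m)

theorem contr_post (s : X →ₗ[k] Y ⊗[k] X) (φ : Y → X → N) (r : R) :
    contr N s (fun x => postOp k N X r (φ x)) = postOp k N X r (contr N s φ) := by
  funext m
  simp [contr_apply, Finset.smul_sum]

theorem contr_map (s : X →ₗ[k] Y ⊗[k] X) {φ : Y → X → N} (h : bil k φ) (r : R) (g : Y →ₗ[k] Y)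
    (hs : ∀ m, s (r • m) = LinearMap.rTensor X g (s m)) (m : X) :
    contr N s (fun x => φ (g x)) m = contr N s φ (r • m) := by
  rw [contr_bil s h, hs, contr_apply]
  conv_rhs => rw [rep_spec (s m)]
  rw [map_sum, map_sum]
  rfl

theorem contr_pre (s : X →ₗ[k] Y ⊗[k] X) {φ : Y → X → N} (h : bil k φ) (r : R)
    (hs : ∀ m, s (r • m) = LinearMap.lTensor Y (Algebra.lsmul k k X r) (s m)) :
    contr N s (fun x => preOp k N X r (φ x)) = preOp k N X r (contr N s φ) := by
  funext m
  rw [preOp_apply, contr_bil s h, hs, contr_apply]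
  conv_rhs => rw [rep_spec (s m)]
  rw [map_sum, map_sum]
  rfl

/-- The action map. -/
def actL (X : Type) [AddCommGroup X] [Module k X] [Module R X] [IsScalarTower k R X]
    (γ : Y →ₗ[k] R) : Y ⊗[k] X →ₗ[k] X :=
  TensorProduct.lift ((Algebra.lsmul k k X).toLinearMap ∘ₗ γ)

theorem actL_tmul (γ : Y →ₗ[k] R) (y : Y) (m : X) : actL X γ (y ⊗ₜ m) = γ y • m := rfl

theorem contr_act (s : X →ₗ[k] Y ⊗[k] X) (γ : Y →ₗ[k] R) (hs : ∀ m, actL X γ (s m) = m)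
    {w : X → N} (hw : IsLinearMap k w) :
    contr N s (fun x => preOp k N X (γ x) w) = w := by
  funext m
  conv_rhs => rw [← hs m, rep_spec (s m)]
  rw [map_sum, contr_apply]
  have : w = hw.mk' w := rfl
  conv_rhs => rw [this, map_sum]
  rfl

/-- Sections exhibiting relative projectivity. -/
structure Sec (β : B →ₐ[k] R) (α : Aᵐᵒᵖ →ₐ[k] R) (X : Type) [AddCommGroup X] [Module k X]
    [Module R X] [IsScalarTower k R X] where
  sB : X →ₗ[k] B ⊗[k] X
  sB_B : ∀ b m, sB (β b • m) = LinearMap.rTensor X (LinearMap.mulLeft k b) (sB m)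
  sB_A : ∀ a m, sB (αl α a • m) = LinearMap.lTensor B (Algebra.lsmul k k X (αl α a)) (sB m)
  sB_act : ∀ m, actL X β.toLinearMap (sB m) = m
  sA : X →ₗ[k] A ⊗[k] X
  sA_A : ∀ a m, sA (αl α a • m) = LinearMap.rTensor X (LinearMap.mulRight k a) (sA m)
  sA_B : ∀ b m, sA (β b • m) = LinearMap.lTensor A (Algebra.lsmul k k X (β b)) (sA m)
  sA_act : ∀ m, actL X (αl α) (sA m) = m

variable {β : B →ₐ[k] R} {α : Aᵐᵒᵖ →ₐ[k] R}

variable (N) in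
/-- Contraction of the last `B`-variable. -/
def hB (s : X →ₗ[k] B ⊗[k] X) (q p : ℕ) : RC A B N X (q + 1) p →ₗ[k] RC A B N X q p where
  toFun f := fun b m a => contr N s (fun x m' => f (Fin.snoc b x) m' a) m
  map_add' f g := by
    funext b m a
    exact congrFun (map_add (contr N s) (fun x m' => f (Fin.snoc b x) m' a)
      (fun x m' => g (Fin.snoc b x) m' a)) m
  map_smul' c f := by
    funext b m a
    exact congrFun (map_smul (contr N s) c (fun x m' => f (Fin.snoc b x) m' a)) m

variable (N) in
/-- Contraction of the first `A`-variable. -/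
def hA (s : X →ₗ[k] A ⊗[k] X) (q p : ℕ) : RC A B N X q (p + 1) →ₗ[k] RC A B N X q p where
  toFun f := fun b m a => contr N s (fun x m' => f b m' (Fin.cons x a)) m
  map_add' f g := by
    funext b m a
    exact congrFun (map_add (contr N s) (fun x m' => f b m' (Fin.cons x a))
      (fun x m' => g b m' (Fin.cons x a))) m
  map_smul' c f := by
    funext b m a
    exact congrFun (map_smul (contr N s) c (fun x m' => f b m' (Fin.cons x a))) m

theorem bil_B {q p : ℕ} {f : RC A B N X (q + 1) p} (hf : ML k f) (b : Fin q → B) (a : Fin p → A) :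
    bil k (fun x m' => f (Fin.snoc b x) m' a) := by
  refine ⟨fun x => hf.hM _ _, ?_⟩
  have := hf.hB a (Fin.snoc (α := fun _ => B) b 0) (Fin.last q)
  simpa only [Fin.update_snoc_last] using this

theorem bil_A {q p : ℕ} {f : RC A B N X q (p + 1)} (hf : ML k f) (b : Fin q → B) (a : Fin p → A) :
    bil k (fun x m' => f b m' (Fin.cons x a)) := by
  refine ⟨fun x => hf.hM _ _, ?_⟩
  have := hf.hA b (Fin.cons (α := fun _ => A) 0 a) 0
  simpa only [Fin.update_cons_zero] using this

theorem mlB {s : X →ₗ[k] B ⊗[k] X} {q p : ℕ} {f : RC A B N X (q + 1) p} (hf : ML k f) :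
    ML k (hB N s q p f) := by
  refine ⟨fun a b i => ?_, fun b a => contr_lin s (bil_B hf b a), fun b a i => ?_⟩
  · refine isLin_comp (contr N s).isLinear (g := fun y x m' =>
      f (Fin.snoc (Function.update b i y) x) m' a) (isLin_pi fun x => ?_)
    have := hf.hB a (Fin.snoc (α := fun _ => B) b x) i.castSucc
    simpa only [Fin.snoc_update] using this
  · exact isLin_comp (contr N s).isLinear (g := fun y x m' =>
      f (Fin.snoc b x) m' (Function.update a i y)) (isLin_pi fun x => hf.hA _ _ _)

theorem mlA {s : X →ₗ[k] A ⊗[k] X} {q p : ℕ} {f : RC A B N X q (p + 1)} (hf : ML k f) :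
    ML k (hA N s q p f) := by
  refine ⟨fun a b i => ?_, fun b a => contr_lin s (bil_A hf b a), fun b a i => ?_⟩
  · exact isLin_comp (contr N s).isLinear (g := fun y x m' =>
      f (Function.update b i y) m' (Fin.cons x a)) (isLin_pi fun x => hf.hB _ _ _)
  · refine isLin_comp (contr N s).isLinear (g := fun y x m' =>
      f b m' (Fin.cons x (Function.update a i y))) (isLin_pi fun x => ?_)
    have := hf.hA b (Fin.cons (α := fun _ => A) x a) i.succ
    simpa only [Fin.cons_update] using this

theorem hB_dB (S : Sec β α X) {q p : ℕ} {f : RC A B N X (q + 1) p} (hf : ML k f) :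
    hB N S.sB (q + 1) p (dB N X β (q + 1) p f)
      = dB N X β q p (hB N S.sB q p f) + ((-1 : ℤ) ^ q) • f := by
  funext b m a
  refine congrFun (dH_last q (X → N) (fun x => postOp k N X (β x)) (fun x => preOp k N X (β x))
    (contr N S.sB) (bil k) (fun w => IsLinearMap k w) ?_ ?_ ?_ (fun b' m' => f b' m' a)
    (fun b' => bil_B hf b' a) (fun b' => hf.hM b' a) b) m
  · intro b φ; exact contr_post _ _ _
  · intro b φ hφ; funext m
    exact contr_map S.sB hφ (β b) (LinearMap.mulLeft k b) (S.sB_B b) m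
  · intro w hw; exact contr_act S.sB β.toLinearMap S.sB_act hw

theorem hA_dA (S : Sec β α X) {q p : ℕ} {f : RC A B N X q (p + 1)} (hf : ML k f) :
    hA N S.sA q (p + 1) (dA N X α q (p + 1) f) = f - dA N X α q p (hA N S.sA q p f) := by
  funext b m a
  refine congrFun (dH_first p (fun x => preOp k N X (αl α x)) (fun x => postOp k N X (αl α x))
    (contr N S.sA) (bil k) (fun w => IsLinearMap k w) ?_ ?_ ?_ (fun a' m' => f b m' a')
    (fun a' => bil_A hf b a') (fun a' => hf.hM b a') a) m
  · intro b φ; exact contr_post _ _ _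
  · intro b φ hφ; funext m
    exact contr_map S.sA hφ (αl α b) (LinearMap.mulRight k b) (S.sA_A b) m
  · intro w hw; exact contr_act S.sA (αl α) S.sA_act hw

theorem hB_dA (S : Sec β α X) {q p : ℕ} {f : RC A B N X (q + 1) p} (hf : ML k f) :
    hB N S.sB q (p + 1) (dA N X α (q + 1) p f) = dA N X α q p (hB N S.sB q p f) := by
  funext b m a
  have key : (fun x m' => dA N X α (q + 1) p f (Fin.snoc b x) m' a)
    = (fun x => preOp k N X (αl α (a 0)) ((fun x m' => f (Fin.snoc b x) m' (Fin.tail a)) x))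
    + (∑ j : Fin p, ((-1 : ℤ) ^ ((j : ℕ) + 1)) • fun x m' => f (Fin.snoc b x) m' (merge a j))
    + ((-1 : ℤ) ^ (p + 1)) • (fun x => postOp k N X (αl α (a (Fin.last p)))
        ((fun x m' => f (Fin.snoc b x) m' (Fin.init a)) x)) := by
    funext x m'
    simp only [dA_apply, dH_apply, Pi.add_apply, Finset.sum_apply, Pi.smul_apply]
  show contr N S.sB (fun x m' => dA N X α (q + 1) p f (Fin.snoc b x) m' a) m = _
  rw [key, map_add, map_add, map_sum, map_zsmul, contr_post,
    contr_pre S.sB (bil_B hf b _) _ (S.sB_A _), dA_apply, dH_apply]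
  simp only [Pi.add_apply, Finset.sum_apply, Pi.smul_apply, map_zsmul]
  rfl

theorem hA_dB0 (S : Sec β α X) {p : ℕ} {f : RC A B N X 0 (p + 1)} (hf : ML k f)
    (h0 : dB N X β 0 (p + 1) f = 0) : dB N X β 0 p (hA N S.sA 0 p f) = 0 := by
  have e' : ∀ y : Fin 0 → B, y = ![] := fun y => Subsingleton.elim _ _
  have h1 : ∀ (b : B) m a, β b • f ![] m a = f ![] (β b • m) a := by
    intro b m a
    have := congrFun (congrFun (congrFun h0 (fun _ => b)) m) a
    rw [dB_apply, dH_apply] at this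
    simp only [e'] at this
    simpa [sub_eq_zero, ← sub_eq_add_neg] using this
  funext b m a
  rw [dB_apply, dH_apply]
  simp only [e']
  have h2 : postOp k N X (β (b 0)) (contr N S.sA (fun x m' => f ![] m' (Fin.cons x a)))
    = preOp k N X (β (b 0)) (contr N S.sA (fun x m' => f ![] m' (Fin.cons x a))) := by
    rw [← contr_post, ← contr_pre S.sA (bil_A hf _ _) _ (S.sA_B _)]
    congr 1
    funext x m'
    exact h1 _ _ _
  have h3 := congrFun h2 m
  have h4 : β (b 0) • hA N S.sA 0 p f ![] m a = hA N S.sA 0 p f ![] (β (b 0) • m) a := h3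
  simp [h4]

theorem acyclic (hc : ∀ (b : B) (a : A), β b * αl α a = αl α a * β b) (S : Sec β α X) (n : ℕ)
    {F : T A B N X} (hF : F ∈ Zc N X β α (n + 1)) :
    ∃ U ∈ G k A B N X n, D N X β α U = F := by
  obtain ⟨hF1, hF2⟩ := hF
  replace hF2 : D N X β α F = 0 := hF2
  let H : T A B N X := fun q p => ((-1 : ℤ) ^ q) • hB N S.sB q p (F (q + 1) p)
  have hH : H ∈ G k A B N X n := by
    intro q p
    refine ⟨(mlB (hF1 _ _).1).zsmul _, fun h => ?_⟩
    show ((-1 : ℤ) ^ q) • hB N S.sB q p (F (q + 1) p) = 0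
    rw [(hF1 _ _).2 (by omega), map_zero, smul_zero]
  have sq : ∀ q : ℕ, ((-1 : ℤ) ^ q) * ((-1 : ℤ) ^ q) = 1 := by
    intro q; rw [← mul_pow]; simp
  let E : T A B N X := F + D N X β α H
  have hE : E ∈ G k A B N X (n + 1) := add_mem hF1 (D_mem β α hH)
  have hDE : D N X β α E = 0 := by
    show D N X β α (F + D N X β α H) = 0
    rw [map_add, hF2, D_D β α hc, add_zero]
  have hE0 : ∀ q p, E (q + 1) p = 0 := by
    intro q p
    show F (q + 1) p + (bP N X β H (q + 1) p + aP N X α H (q + 1) p) = 0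
    have h1 : bP N X β F (q + 2) p + aP N X α F (q + 2) p = 0 := congrFun (congrFun hF2 (q + 2)) p
    rw [bP_succ] at h1 ⊢
    have h2 := congrArg (hB N S.sB (q + 1) p) h1
    rw [map_add, hB_dB S (hF1 _ _).1, map_zero] at h2
    have h3 := congrArg (fun z => ((-1 : ℤ) ^ q) • z) h2
    simp only [smul_add, smul_zero, smul_smul, sq, one_smul] at h3
    show F (q + 1) p + (dB N X β q p (((-1 : ℤ) ^ q) • hB N S.sB q p (F (q + 1) p)) + _) = 0
    rw [map_zsmul]
    rcases p with _ | p
    · rw [aP_zero]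
      rw [aP_zero, map_zero, smul_zero, add_zero] at h3
      rw [add_zero]; exact (add_comm _ _).trans h3
    · rw [aP_succ, map_zsmul, hB_dA S (hF1 _ _).1, smul_smul] at h3
      rw [aP_succ]
      show _ + (_ + _ • dA N X α (q + 1) p (((-1 : ℤ) ^ (q + 1)) •
        hB N S.sB (q + 1) p (F (q + 2) p))) = 0
      rw [map_zsmul, smul_smul, sq]
      have e : (-1 : ℤ) ^ q * (-1) ^ (q + 2) = 1 := by rw [pow_add, ← mul_assoc, sq]; norm_num
      rw [e] at h3
      rw [← h3]; abel
  let U : T A B N X := fun q p => if q = 0 then hA N S.sA q p (E q (p + 1)) else 0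
  have hU0 : ∀ p, U 0 p = hA N S.sA 0 p (E 0 (p + 1)) := fun p => if_pos rfl
  have hU1 : ∀ q p, U (q + 1) p = 0 := fun q p => if_neg (by omega)
  have hU : U ∈ G k A B N X n := by
    intro q p
    rcases q with _ | q
    · rw [hU0]
      refine ⟨mlA (hE _ _).1, fun h => ?_⟩
      rw [(hE _ _).2 (by omega), map_zero]
    · rw [hU1]
      exact ⟨ML.zero k, fun _ => rfl⟩
  have hDU : D N X β α U = E := by
    funext q p
    rw [D_apply]
    rcases q with _ | _ | q
    · rw [bP_zero]
      rcases p with _ | p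
      · rw [aP_zero, (hE 0 0).2 (by omega), add_zero]
      · have h1 : bP N X β E 0 (p + 2) + aP N X α E 0 (p + 2) = 0 :=
          congrFun (congrFun hDE 0) (p + 2)
        rw [bP_zero, aP_succ, zero_add, pow_zero, one_smul] at h1
        have h2 := hA_dA S (hE 0 (p + 1)).1
        rw [h1, map_zero] at h2
        rw [aP_succ, hU0, zero_add, pow_zero, one_smul]
        exact (sub_eq_zero.mp h2.symm).symm
    · have h1 : bP N X β E 1 (p + 1) + aP N X α E 1 (p + 1) = 0 :=
        congrFun (congrFun hDE 1) (p + 1)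
      rw [bP_succ, aP_succ, hE0, map_zero, smul_zero, add_zero] at h1
      have h2 : aP N X α U (0 + 1) p = 0 := by
        cases p
        · rfl
        · rw [aP_succ, hU1, map_zero, smul_zero]
      rw [h2, bP_succ, hU0, hA_dB0 S (hE _ _).1 h1, hE0, add_zero]
    · have h2 : aP N X α U (q + 2) p = 0 := by
        cases p
        · rfl
        · rw [aP_succ, hU1, map_zero, smul_zero]
      rw [h2, bP_succ, hU1, map_zero, hE0, add_zero]
  refine ⟨U - H, sub_mem hU hH, ?_⟩
  rw [map_sub, hDU]
  exact add_sub_cancel_right F _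

end contraction


section sq

variable {k V W : Type*} [Field k] [AddCommGroup V] [Module k V] [AddCommGroup W] [Module k W]

/-- Subquotients. -/
abbrev SQ (Z B : Submodule k V) : Type _ := Z ⧸ B.comap Z.subtype

theorem sq_equiv {Z1 B1 : Submodule k V} {Z2 B2 : Submodule k W} (φ : V →ₗ[k] W)
    (h1 : ∀ z ∈ Z1, φ z ∈ Z2) (h2 : ∀ w ∈ Z2, ∃ z ∈ Z1, w - φ z ∈ B2)
    (h3 : ∀ z ∈ Z1, φ z ∈ B2 ↔ z ∈ B1) : Nonempty (SQ Z1 B1 ≃ₗ[k] SQ Z2 B2) := by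
  let f : Z1 →ₗ[k] SQ Z2 B2 := (B2.comap Z2.subtype).mkQ ∘ₗ φ.restrict h1
  have hs : Function.Surjective f := by
    intro w
    obtain ⟨w, rfl⟩ := Submodule.mkQ_surjective _ w
    obtain ⟨z, hz, h⟩ := h2 w w.2
    refine ⟨⟨z, hz⟩, ?_⟩
    symm
    refine (Submodule.Quotient.eq _).2 ?_
    exact h
  have hk : B1.comap Z1.subtype = LinearMap.ker f := by
    ext z
    have : f z = 0 ↔ φ z ∈ B2 := Submodule.Quotient.mk_eq_zero _
    rw [LinearMap.mem_ker, this, h3 z z.2]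
    rfl
  exact ⟨(Submodule.quotEquivOfEq _ _ hk).trans (f.quotKerEquivOfSurjective hs)⟩

theorem sq_congr {Z1 B1 B2 : Submodule k V} (h3 : ∀ z ∈ Z1, z ∈ B2 ↔ z ∈ B1) :
    Nonempty (SQ Z1 B1 ≃ₗ[k] SQ Z1 B2) :=
  sq_equiv LinearMap.id (fun _ h => h) (fun w hw => ⟨w, hw, by simp⟩) h3

theorem ne_trans {V1 V2 V3 : Type*} [AddCommGroup V1] [Module k V1] [AddCommGroup V2]
    [Module k V2] [AddCommGroup V3] [Module k V3] (h : Nonempty (V1 ≃ₗ[k] V2))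
    (h' : Nonempty (V2 ≃ₗ[k] V3)) : Nonempty (V1 ≃ₗ[k] V3) :=
  ⟨h.some.trans h'.some⟩

end sq

section shift

variable {k A B R N : Type} [Field k] [Ring A] [Ring B] [Ring R] [Algebra k A] [Algebra k B]
  [Algebra k R] [AddCommGroup N] [Module k N] [Module R N] [IsScalarTower k R N]
  [SMulCommClass R k N]
variable {X P Z : Type} [AddCommGroup X] [Module k X] [Module R X] [IsScalarTower k R X]
  [AddCommGroup P] [Module k P] [Module R P] [IsScalarTower k R P]
  [AddCommGroup Z] [Module k Z] [Module R Z] [IsScalarTower k R Z]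
  {β : B →ₐ[k] R} {α : Aᵐᵒᵖ →ₐ[k] R}

/-- Exact sequences with a linear splitting. -/
structure Spl (k : Type) {R X P Z : Type} [Field k] [Ring R] [AddCommGroup X] [Module k X]
    [Module R X] [AddCommGroup P] [Module k P] [Module R P]
    [AddCommGroup Z] [Module k Z] [Module R Z] (i : Z →ₗ[R] P) (π : P →ₗ[R] X) where
  ρ : P →ₗ[k] Z
  σ : X →ₗ[k] P
  hρ : ∀ z, ρ (i z) = z
  hσ : ∀ x, π (σ x) = x
  hs : ∀ p, i (ρ p) + σ (π p) = p
  h0 : ∀ z, π (i z) = 0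

theorem lin_of_R {X P : Type} [AddCommGroup X] [Module k X] [Module R X] [IsScalarTower k R X]
    [AddCommGroup P] [Module k P] [Module R P] [IsScalarTower k R P] (f : P →ₗ[R] X) :
    IsLinearMap k f :=
  isLin_of (f.restrictScalars k) (fun _ => rfl)

variable {i : Z →ₗ[R] P} {π : P →ₗ[R] X}

theorem pull_split (s : Spl k i π) {n : ℕ} {g : T A B N P} (hg : g ∈ G k A B N P n)
    (h : pull k A B N i g = 0) : pull k A B N π (pull k A B N s.σ g) = g := by
  funext q p b m a
  rw [pull_apply, pull_apply]
  conv_rhs => rw [← s.hs m]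
  rw [((hg q p).1.hM b a).map_add]
  have : g q p b (i (s.ρ m)) a = 0 :=
    congrFun (congrFun (congrFun (congrFun (congrFun h q) p) b) (s.ρ m)) a
  rw [this, zero_add]

theorem pull_inj (s : Spl k i π) {f g : T A B N X}
    (h : pull k A B N π f = pull k A B N π g) : f = g := by
  have := congrArg (pull k A B N s.σ) h
  funext q p b m a
  have := congrFun (congrFun (congrFun (congrFun (congrFun this q) p) b) m) a
  simpa only [pull_apply, s.hσ] using this

theorem pull_ρ (s : Spl k i π) (f : T A B N Z) : pull k A B N i (pull k A B N s.ρ f) = f := by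
  funext q p b m a
  simp only [pull_apply, s.hρ]

theorem pull_pull0 (s : Spl k i π) {n : ℕ} {f : T A B N X} (hf : f ∈ G k A B N X n) :
    pull k A B N i (pull k A B N π f) = 0 := by
  funext q p b m a
  simp only [pull_apply, s.h0]
  exact ((hf q p).1.hM b a).map_zero

theorem mem_Zc {n : ℕ} {F : T A B N X} :
    F ∈ Zc N X β α n ↔ F ∈ G k A B N X n ∧ D N X β α F = 0 := Iff.rfl

theorem shift (s : Spl k i π) (hc : ∀ (b : B) (a : A), β b * αl α a = αl α a * β b)
    (S : Sec β α P) (n : ℕ) :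
    Nonempty (SQ (Zc N Z β α n) ((Zc N P β α n).map (pull k A B N i)) ≃ₗ[k]
      SQ (Zc N X β α (n + 1)) (Bc N X β α (n + 1))) := by
  have hd : ∀ f ∈ Zc N Z β α n, pull k A B N π (pull k A B N s.σ (D N P β α (pull k A B N s.ρ f)))
      = D N P β α (pull k A B N s.ρ f) := by
    intro f hf
    refine pull_split s (n := n + 1) (D_mem β α (pull_mem s.ρ.isLinear hf.1)) ?_
    rw [← D_pull, pull_ρ]
    exact hf.2
  refine sq_equiv (pull k A B N s.σ ∘ₗ D N P β α ∘ₗ pull k A B N s.ρ) ?_ ?_ ?_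
  · intro f hf
    refine ⟨pull_mem s.σ.isLinear (D_mem β α (pull_mem s.ρ.isLinear hf.1)), ?_⟩
    refine pull_inj s ?_
    rw [← D_pull, map_zero]
    show D N P β α (pull k A B N π (pull k A B N s.σ (D N P β α (pull k A B N s.ρ f)))) = 0
    rw [hd f hf, D_D β α hc]
  · intro w hw
    have hw' : pull k A B N π w ∈ Zc N P β α (n + 1) := by
      refine ⟨pull_mem (lin_of_R π) hw.1, ?_⟩
      show D N P β α (pull k A B N π w) = 0
      rw [D_pull, (mem_Zc.1 hw).2, map_zero]
    obtain ⟨U, hU, hDU⟩ := acyclic hc S n hw'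
    have hf : pull k A B N i U ∈ Zc N Z β α n := by
      refine ⟨pull_mem (lin_of_R i) hU, ?_⟩
      show D N Z β α (pull k A B N i U) = 0
      rw [D_pull, hDU, pull_pull0 s hw.1]
    refine ⟨_, hf, ?_⟩
    have hV : U - pull k A B N s.ρ (pull k A B N i U) ∈ G k A B N P n :=
      sub_mem hU (pull_mem s.ρ.isLinear hf.1)
    refine ⟨pull k A B N s.σ (U - pull k A B N s.ρ (pull k A B N i U)),
      pull_mem s.σ.isLinear hV, ?_⟩
    refine pull_inj s ?_
    rw [← D_pull, pull_split s hV (by rw [map_sub, pull_ρ, sub_self]), map_sub, map_sub, hDU]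
    show _ = _ - pull k A B N π (pull k A B N s.σ (D N P β α (pull k A B N s.ρ _)))
    rw [hd _ hf]
  · intro f hf
    have hd' := hd f hf
    constructor
    · rintro ⟨u, hu, h⟩
      refine ⟨pull k A B N s.ρ f - pull k A B N π u,
        ⟨sub_mem (pull_mem s.ρ.isLinear hf.1) (pull_mem (lin_of_R π) hu), ?_⟩, ?_⟩
      · show D N P β α _ = 0
        rw [map_sub, D_pull, h, ← hd', sub_eq_zero]
        rfl
      · rw [map_sub, pull_ρ, pull_pull0 s hu, sub_zero]
    · rintro ⟨g, hg, rfl⟩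
      have hV : pull k A B N s.ρ (pull k A B N i g) - g ∈ G k A B N P n :=
        sub_mem (pull_mem s.ρ.isLinear hf.1) hg.1
      refine ⟨pull k A B N s.σ (pull k A B N s.ρ (pull k A B N i g) - g),
        pull_mem s.σ.isLinear hV, ?_⟩
      refine pull_inj s ?_
      rw [← D_pull, pull_split s hV (by rw [map_sub, pull_ρ, sub_self]), map_sub,
        (mem_Zc.1 hg).2, sub_zero]
      exact hd'.symm

theorem shift_succ (s : Spl k i π) (hc : ∀ (b : B) (a : A), β b * αl α a = αl α a * β b)
    (S : Sec β α P) (n : ℕ) :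
    Nonempty (SQ (Zc N Z β α (n + 1)) (Bc N Z β α (n + 1)) ≃ₗ[k]
      SQ (Zc N X β α (n + 2)) (Bc N X β α (n + 2))) := by
  refine ne_trans (sq_congr ?_) (shift s hc S (n + 1))
  intro z hz
  constructor
  · rintro ⟨g, hg, rfl⟩
    obtain ⟨U, hU, rfl⟩ := acyclic hc S n hg
    exact ⟨pull k A B N i U, pull_mem (lin_of_R i) hU, D_pull _ _ _ _⟩
  · rintro ⟨V, hV, rfl⟩
    refine ⟨D N P β α (pull k A B N s.ρ V),
      ⟨D_mem β α (pull_mem s.ρ.isLinear hV), D_D β α hc _⟩, ?_⟩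
    rw [← D_pull, pull_ρ]

end shift


section degzero

variable {k A B R N : Type} [Field k] [Ring A] [Ring B] [Ring R] [Algebra k A] [Algebra k B]
  [Algebra k R] [AddCommGroup N] [Module k N] [Module R N] [IsScalarTower k R N]
  [SMulCommClass R k N]
variable {X P : Type} [AddCommGroup X] [Module k X] [Module R X] [IsScalarTower k R X]
  [AddCommGroup P] [Module k P] [Module R P] [IsScalarTower k R P]
  {β : B →ₐ[k] R} {α : Aᵐᵒᵖ →ₐ[k] R}

variable (k A B R N X) in
/-- Homomorphisms as cochains of degree zero. -/
def psi : (X →ₗ[R] N) →ₗ[k] T A B N X where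
  toFun g := fun q p _ m _ => if q + p = 0 then g m else 0
  map_add' g g' := by
    funext q p b m a
    show (if q + p = 0 then (g + g') m else 0) = (if q + p = 0 then g m else 0)
      + (if q + p = 0 then g' m else 0)
    split_ifs <;> simp
  map_smul' c g := by
    funext q p b m a
    show (if q + p = 0 then (c • g) m else 0) = c • (if q + p = 0 then g m else 0)
    split_ifs <;> simp

theorem psi_zero (g : X →ₗ[R] N) (b m a) : psi k A B R N X g 0 0 b m a = g m := rfl

theorem psi_ne (g : X →ₗ[R] N) {q p : ℕ} (h : q + p ≠ 0) : psi k A B R N X g q p = 0 := by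
  funext b m a
  exact if_neg h

theorem psi_inj {g g' : X →ₗ[R] N} (h : psi k A B R N X g = psi k A B R N X g') : g = g' := by
  ext m
  exact congrFun (congrFun (congrFun (congrFun (congrFun h 0) 0) ![]) m) ![]

theorem psi_pull (φ : X →ₗ[R] P) (g : P →ₗ[R] N) :
    pull k A B N φ (psi k A B R N P g) = psi k A B R N X (g ∘ₗ φ) := rfl

theorem D_one_zero (F : T A B N X) (b m a) : D N X β α F 1 0 b m a
    = β (b 0) • F 0 0 ![] m ![] - F 0 0 ![] (β (b 0) • m) ![] := by
  have e' : ∀ (y : Fin 0 → B), y = ![] := fun y => Subsingleton.elim _ _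
  have e : ∀ (y : Fin 0 → A), y = ![] := fun y => Subsingleton.elim _ _
  show dB N X β 0 0 (F 0 0) b m a + 0 = _
  rw [dB_apply, dH_apply]
  simp only [e', e]
  simp [sub_eq_add_neg]

theorem D_zero_one (F : T A B N X) (b m a) : D N X β α F 0 1 b m a
    = F 0 0 ![] (αl α (a 0) • m) ![] - αl α (a 0) • F 0 0 ![] m ![] := by
  have e' : ∀ (y : Fin 0 → B), y = ![] := fun y => Subsingleton.elim _ _
  have e : ∀ (y : Fin 0 → A), y = ![] := fun y => Subsingleton.elim _ _
  show 0 + ((-1 : ℤ) ^ 0 • dA N X α 0 0 (F 0 0)) b m a = _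
  rw [pow_zero, one_smul, dA_apply, dH_apply]
  simp only [e', e]
  simp [sub_eq_add_neg]

theorem psi_mem (g : X →ₗ[R] N) : psi k A B R N X g ∈ Zc N X β α 0 := by
  have h1 : psi k A B R N X g ∈ G k A B N X 0 := by
    intro q p
    by_cases h : q + p = 0
    · obtain ⟨rfl, rfl⟩ : q = 0 ∧ p = 0 := by omega
      exact ⟨⟨fun a b i => i.elim0, fun b a => lin_of_R g, fun b a i => i.elim0⟩,
        fun h => absurd rfl h⟩
    · rw [psi_ne g h]
      exact ⟨ML.zero k, fun _ => rfl⟩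
  refine ⟨h1, ?_⟩
  show D N X β α _ = 0
  funext q p
  by_cases h : q + p = 1
  · obtain ⟨rfl, rfl⟩ | ⟨rfl, rfl⟩ : (q = 0 ∧ p = 1) ∨ (q = 1 ∧ p = 0) := by omega
    · funext b m a
      rw [D_zero_one, psi_zero, psi_zero, map_smul, sub_self]; rfl
    · funext b m a
      rw [D_one_zero, psi_zero, psi_zero, map_smul, sub_self]; rfl
  · exact (D_mem β α h1 q p).2 h

theorem psi_surj (hR : ∀ S : Submodule k R, (∀ b a, β b * αl α a ∈ S) → S = ⊤)
    {F : T A B N X} (hF : F ∈ Zc N X β α 0) : ∃ g, psi k A B R N X g = F := by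
  have hD : D N X β α F = 0 := hF.2
  have hb : ∀ (b : B) m, F 0 0 ![] (β b • m) ![] = β b • F 0 0 ![] m ![] := by
    intro b m
    have := D_one_zero (β := β) (α := α) F (fun _ => b) m ![]
    rw [hD] at this
    exact (sub_eq_zero.1 this.symm).symm
  have ha : ∀ (a : A) m, F 0 0 ![] (αl α a • m) ![] = αl α a • F 0 0 ![] m ![] := by
    intro b m
    have := D_zero_one (β := β) (α := α) F ![] m (fun _ => b)
    rw [hD] at this
    exact (sub_eq_zero.1 this.symm)
  have hl := (hF.1 0 0).1.hM ![] ![]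
  let S : Submodule k R :=
    { carrier := {r | ∀ m, F 0 0 ![] (r • m) ![] = r • F 0 0 ![] m ![]}
      zero_mem' := fun m => by rw [zero_smul, zero_smul]; exact hl.map_zero
      add_mem' := fun {r r'} h h' m => by
        rw [add_smul, add_smul, hl.map_add, h m, h' m]
      smul_mem' := fun c r h m => by
        rw [smul_assoc, smul_assoc, hl.map_smul, h m] }
  have hS : S = ⊤ := hR S fun b a m => by rw [mul_smul, mul_smul, hb, ha]
  refine ⟨{ toFun := fun m => F 0 0 ![] m ![], map_add' := hl.map_add, map_smul' := fun r m => ?_ }, ?_⟩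
  · have : r ∈ S := hS ▸ Submodule.mem_top
    exact this m
  · funext q p
    by_cases h : q + p = 0
    · obtain ⟨rfl, rfl⟩ : q = 0 ∧ p = 0 := by omega
      funext b m a
      rw [psi_zero, Subsingleton.elim b ![], Subsingleton.elim a ![]]; rfl
    · rw [psi_ne _ h, (hF.1 q p).2 h]

end degzero


section projsec

variable {k A B : Type} [Field k] [Ring A] [Ring B] [Algebra k A] [Algebra k B]

variable (k A B) in
/-- The left factor. -/
abbrev bL : B →ₐ[k] B ⊗[k] Aᵐᵒᵖ := Algebra.TensorProduct.includeLeft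

variable (k A B) in
/-- The right factor. -/
abbrev aR : Aᵐᵒᵖ →ₐ[k] B ⊗[k] Aᵐᵒᵖ := Algebra.TensorProduct.includeRight

theorem ba_comm (b : B) (a : A) : bL k A B b * αl (aR k A B) a = αl (aR k A B) a * bL k A B b := by
  simp [αl_apply]

theorem ba_span (S : Submodule k (B ⊗[k] Aᵐᵒᵖ)) (h : ∀ b a, bL k A B b * αl (aR k A B) a ∈ S) :
    S = ⊤ := by
  rw [eq_top_iff]
  rintro t -
  induction t with
  | zero => exact zero_mem _
  | add x y hx hy => exact add_mem hx hy
  | tmul b a =>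
    have := h b (unop a)
    simpa [αl_apply] using this

variable {X : Type} [AddCommGroup X] [Module k X] [Module (B ⊗[k] Aᵐᵒᵖ) X]
  [IsScalarTower k (B ⊗[k] Aᵐᵒᵖ) X]

/-- Evaluation at a point. -/
def ev {Y : Type} [Ring Y] [Algebra k Y] (γ : Y →ₗ[k] B ⊗[k] Aᵐᵒᵖ) (x : X) : Y →ₗ[k] X :=
  (LinearMap.toSpanSingleton (B ⊗[k] Aᵐᵒᵖ) X x).restrictScalars k ∘ₗ γ

theorem ev_apply {Y : Type} [Ring Y] [Algebra k Y] (γ : Y →ₗ[k] B ⊗[k] Aᵐᵒᵖ) (x : X) (y : Y) :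
    ev γ x y = γ y • x := rfl

/-- `b ⊗ a ↦ b ⊗ a x`. -/
def LB (x : X) : B ⊗[k] Aᵐᵒᵖ →ₗ[k] B ⊗[k] X :=
  TensorProduct.map LinearMap.id (ev (aR k A B).toLinearMap x)

/-- `b ⊗ a ↦ a ⊗ b x`. -/
def LA (x : X) : B ⊗[k] Aᵐᵒᵖ →ₗ[k] A ⊗[k] X :=
  TensorProduct.map (opLinearEquiv k).symm.toLinearMap (ev (bL k A B).toLinearMap x)
    ∘ₗ (TensorProduct.comm k B Aᵐᵒᵖ).toLinearMap

theorem LB_tmul (x : X) (b : B) (a : Aᵐᵒᵖ) : LB x (b ⊗ₜ a) = b ⊗ₜ[k] (((1 : B) ⊗ₜ[k] a) • x) := rfl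
theorem LA_tmul (x : X) (b : B) (a : Aᵐᵒᵖ) :
    LA x (b ⊗ₜ a) = unop a ⊗ₜ[k] ((b ⊗ₜ[k] (1 : Aᵐᵒᵖ)) • x) := rfl

/-- Extension to the free module. -/
def ext {V : Type} [AddCommGroup V] [Module k V] (L : X → B ⊗[k] Aᵐᵒᵖ →ₗ[k] V) :
    (X →₀ B ⊗[k] Aᵐᵒᵖ) →ₗ[k] V := Finsupp.lsum k L

theorem ext_smul {V : Type} [AddCommGroup V] [Module k V] (L : X → B ⊗[k] Aᵐᵒᵖ →ₗ[k] V)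
    (r : B ⊗[k] Aᵐᵒᵖ) (g : V →ₗ[k] V) (h : ∀ x b a, L x (r * (b ⊗ₜ a)) = g (L x (b ⊗ₜ a)))
    (t : X →₀ B ⊗[k] Aᵐᵒᵖ) : ext L (r • t) = g (ext L t) := by
  induction t using Finsupp.induction_linear with
  | zero => simp
  | add f g hf hg => rw [smul_add, map_add, map_add, map_add, hf, hg]
  | single x u =>
    simp only [ext, Finsupp.smul_single, Finsupp.lsum_single, smul_eq_mul]
    induction u with
    | zero => simp
    | add x y hx hy => rw [mul_add, map_add, map_add, map_add, hx, hy]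
    | tmul b a => exact h x b a

theorem ext_act {V : Type} [AddCommGroup V] [Module k V] (L : X → B ⊗[k] Aᵐᵒᵖ →ₗ[k] V)
    (g : V →ₗ[k] X) (h : ∀ x b a, g (L x (b ⊗ₜ a)) = (b ⊗ₜ[k] a) • x)
    (t : X →₀ B ⊗[k] Aᵐᵒᵖ) : g (ext L t) = Finsupp.linearCombination (B ⊗[k] Aᵐᵒᵖ) id t := by
  induction t using Finsupp.induction_linear with
  | zero => simp
  | add f g hf hg => rw [map_add, map_add, map_add, hf, hg]
  | single x u =>
    simp only [ext, Finsupp.lsum_single, Finsupp.linearCombination_single, id]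
    induction u with
    | zero => rw [map_zero, map_zero]; exact (zero_smul (B ⊗[k] Aᵐᵒᵖ) x).symm
    | add x y hx hy => rw [map_add, map_add, hx, hy, add_smul]
    | tmul b a => exact h x b a

theorem sec_of_proj [Module.Projective (B ⊗[k] Aᵐᵒᵖ) X] :
    Nonempty (Sec (bL k A B) (aR k A B) X) := by
  obtain ⟨s, hs⟩ := Module.Projective.out (R := B ⊗[k] Aᵐᵒᵖ) (P := X)
  refine ⟨⟨ext LB ∘ₗ s.restrictScalars k, ?_, ?_, ?_, ext LA ∘ₗ s.restrictScalars k, ?_, ?_, ?_⟩⟩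
  · intro b m
    show ext LB (s _) = _
    rw [map_smul]
    refine ext_smul _ _ _ (fun x b' a' => ?_) _
    simp [LB_tmul]
  · intro b m
    show ext LB (s _) = _
    rw [map_smul]
    refine ext_smul _ _ _ (fun x b' a' => ?_) _
    simp [LB_tmul, αl_apply, smul_smul]
  · intro m
    refine (ext_act _ _ (fun x b' a' => ?_) _).trans (hs m)
    simp [LB_tmul, actL_tmul, smul_smul]
  · intro b m
    show ext LA (s _) = _
    rw [map_smul]
    refine ext_smul _ _ _ (fun x b' a' => ?_) _
    simp [LA_tmul, αl_apply]
  · intro b m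
    show ext LA (s _) = _
    rw [map_smul]
    refine ext_smul _ _ _ (fun x b' a' => ?_) _
    simp [LA_tmul, smul_smul]
  · intro m
    refine (ext_act _ _ (fun x b' a' => ?_) _).trans (hs m)
    simp [LA_tmul, actL_tmul, smul_smul, αl_apply]

end projsec


section main

variable {k A B R N : Type} [Field k] [Ring A] [Ring B] [Ring R] [Algebra k A] [Algebra k B]
  [Algebra k R] [AddCommGroup N] [Module k N] [Module R N] [IsScalarTower k R N]
  [SMulCommClass R k N]

variable (k N) in
/-- Precomposition. -/
def pc {X P : Type} [AddCommGroup X] [Module R X] [AddCommGroup P] [Module R P]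
    (φ : X →ₗ[R] P) : (P →ₗ[R] N) →ₗ[k] (X →ₗ[R] N) where
  toFun g := g ∘ₗ φ
  map_add' g g' := rfl
  map_smul' c g := rfl

theorem factor {X P : Type} [AddCommGroup X] [Module R X] [AddCommGroup P] [Module R P]
    {ε : P →ₗ[R] X} (hε : Function.Surjective ε) (w : P →ₗ[R] N)
    (h : LinearMap.ker ε ≤ LinearMap.ker w) : ∃ g : X →ₗ[R] N, g ∘ₗ ε = w := by
  refine ⟨(LinearMap.ker ε).liftQ w h ∘ₗ (ε.quotKerEquivOfSurjective hε).symm.toLinearMap, ?_⟩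
  ext p
  have : (ε.quotKerEquivOfSurjective hε).symm (ε p) = (LinearMap.ker ε).mkQ p := by
    rw [LinearEquiv.symm_apply_eq]; rfl
  show (LinearMap.ker ε).liftQ w h ((ε.quotKerEquivOfSurjective hε).symm (ε p)) = w p
  rw [this]
  rfl

theorem exists_spl {X P : Type} [AddCommGroup X] [Module k X] [Module R X] [IsScalarTower k R X]
    [AddCommGroup P] [Module k P] [Module R P] [IsScalarTower k R P] {ε : P →ₗ[R] X}
    (hε : Function.Surjective ε) : Nonempty (Spl k (LinearMap.ker ε).subtype ε) := by
  obtain ⟨σ, hσ⟩ := (ε.restrictScalars k).exists_rightInverse_of_surjective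
    (LinearMap.range_eq_top.2 hε)
  have hσ' : ∀ x, ε (σ x) = x := fun x => LinearMap.congr_fun hσ x
  refine ⟨⟨⟨⟨fun p => ⟨p - σ (ε p), ?_⟩, ?_⟩, ?_⟩, σ, ?_, hσ', ?_, ?_⟩⟩
  · rw [LinearMap.mem_ker, map_sub, hσ', sub_self]
  · intro x y
    ext
    simp only [map_add, Submodule.coe_add]
    abel
  · intro c x
    ext
    have : ε (c • x) = c • ε x := (lin_of_R ε).map_smul c x
    show c • x - σ (ε (c • x)) = c • (x - σ (ε x))
    rw [this, map_smul, smul_sub]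
  · intro z
    ext
    have : ε z = 0 := z.2
    simp [this]
  · intro p
    simp
  · intro z
    exact z.2

variable (k R N) in
/-- Coboundaries of the resolution. -/
def Bd {P : ℕ → Type} [∀ n, AddCommGroup (P n)] [∀ n, Module R (P n)]
    (d : ∀ n, P (n + 1) →ₗ[R] P n) : ∀ r, Submodule k (P r →ₗ[R] N)
  | 0 => ⊥
  | r + 1 => LinearMap.range (pc k N (d r))

theorem main_equiv {β : B →ₐ[k] R} {α : Aᵐᵒᵖ →ₐ[k] R}
    (hc : ∀ (b : B) (a : A), β b * αl α a = αl α a * β b)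
    (hR : ∀ S : Submodule k R, (∀ b a, β b * αl α a ∈ S) → S = ⊤) (r : ℕ) :
    ∀ (X : Type) [AddCommGroup X] [Module k X] [Module R X] [IsScalarTower k R X]
    (P : ℕ → Type) [∀ n, AddCommGroup (P n)] [∀ n, Module k (P n)] [∀ n, Module R (P n)]
    [∀ n, IsScalarTower k R (P n)] (d : ∀ n, P (n + 1) →ₗ[R] P n) (ε : P 0 →ₗ[R] X)
    (hε : Function.Surjective ε) (h0 : LinearMap.range (d 0) = LinearMap.ker ε)
    (hd : ∀ n, LinearMap.range (d (n + 1)) = LinearMap.ker (d n))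
    (S : ∀ n, Nonempty (Sec β α (P n))),
    Nonempty (SQ (Zc N X β α r) (Bc N X β α r) ≃ₗ[k]
      SQ (LinearMap.ker (pc k N (d r))) (Bd k R N d r)) := by
  induction r with
  | zero =>
    intro X _ _ _ _ P _ _ _ _ d ε hε h0 hd S
    have e1 : Nonempty (SQ (⊤ : Submodule k (X →ₗ[R] N)) ⊥ ≃ₗ[k]
        SQ (Zc N X β α 0) (Bc N X β α 0)) := by
      refine sq_equiv (psi k A B R N X) (fun z _ => psi_mem z) ?_ ?_
      · intro w hw
        obtain ⟨g, rfl⟩ := psi_surj hR hw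
        exact ⟨g, trivial, by rw [sub_self]; exact zero_mem _⟩
      · intro z _
        show psi k A B R N X z = 0 ↔ z = 0
        constructor
        · intro h
          exact psi_inj (h.trans (map_zero _).symm)
        · rintro rfl
          exact map_zero _
    have e2 : Nonempty (SQ (⊤ : Submodule k (X →ₗ[R] N)) ⊥ ≃ₗ[k]
        SQ (LinearMap.ker (pc k N (d 0))) (Bd k R N d 0)) := by
      refine sq_equiv (pc k N ε) ?_ ?_ ?_
      · intro z _
        rw [LinearMap.mem_ker]
        ext p
        have : ε (d 0 p) = 0 := by
          rw [← LinearMap.mem_ker, ← h0]; exact ⟨p, rfl⟩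
        show z (ε (d 0 p)) = 0
        rw [this, map_zero]
      · intro w hw
        obtain ⟨g, hg⟩ := factor hε w (by
          rw [← h0]
          rintro _ ⟨p, rfl⟩
          exact LinearMap.congr_fun hw p)
        refine ⟨g, trivial, ?_⟩
        have : w - pc k N ε g = 0 := sub_eq_zero.2 hg.symm
        rw [this]
        exact zero_mem _
      · intro z _
        show z ∘ₗ ε = 0 ↔ z = 0
        constructor
        · intro h
          ext x
          obtain ⟨p, rfl⟩ := hε x
          exact LinearMap.congr_fun h p
        · rintro rfl
          rfl
    exact ⟨e1.some.symm.trans e2.some⟩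
  | succ r ih =>
    intro X _ _ _ _ P _ _ _ _ d ε hε h0 hd S
    obtain ⟨s⟩ := exists_spl (k := k) hε
    let d0 : P 1 →ₗ[R] LinearMap.ker ε := (d 0).codRestrict (LinearMap.ker ε)
      (fun p => by rw [← h0]; exact ⟨p, rfl⟩)
    have hd0 : Function.Surjective d0 := by
      rintro ⟨z, hz⟩
      obtain ⟨p, hp⟩ : z ∈ LinearMap.range (d 0) := by rw [h0]; exact hz
      exact ⟨p, Subtype.ext hp⟩
    have hk : LinearMap.range (d 1) = LinearMap.ker d0 := by
      rw [hd 0, LinearMap.ker_codRestrict]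
    rcases r with _ | r
    · have e0 := shift (N := N) s hc (S 0).some 0
      have e1 : Nonempty (SQ (⊤ : Submodule k (LinearMap.ker ε →ₗ[R] N))
          (LinearMap.range (pc k N (LinearMap.ker ε).subtype)) ≃ₗ[k]
          SQ (Zc N (LinearMap.ker ε) β α 0)
            ((Zc N (P 0) β α 0).map (pull k A B N (LinearMap.ker ε).subtype))) := by
        refine sq_equiv (psi k A B R N _) (fun z _ => psi_mem z) ?_ ?_
        · intro w hw
          obtain ⟨g, rfl⟩ := psi_surj hR hw
          exact ⟨g, trivial, by rw [sub_self]; exact zero_mem _⟩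
        · intro z _
          constructor
          · rintro ⟨u, hu, h⟩
            obtain ⟨g, rfl⟩ := psi_surj hR hu
            rw [psi_pull] at h
            exact ⟨g, psi_inj h⟩
          · rintro ⟨g, rfl⟩
            exact ⟨_, psi_mem g, psi_pull _ _⟩
      have e2 : Nonempty (SQ (⊤ : Submodule k (LinearMap.ker ε →ₗ[R] N))
          (LinearMap.range (pc k N (LinearMap.ker ε).subtype)) ≃ₗ[k]
          SQ (LinearMap.ker (pc k N (d 1))) (Bd k R N d 1)) := by
        refine sq_equiv (pc k N d0) ?_ ?_ ?_
        · intro z _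
          rw [LinearMap.mem_ker]
          ext p
          have : d0 (d 1 p) = 0 := by
            rw [← LinearMap.mem_ker, ← hk]; exact ⟨p, rfl⟩
          show z (d0 (d 1 p)) = 0
          rw [this, map_zero]
        · intro w hw
          obtain ⟨g, hg⟩ := factor hd0 w (by
            rw [← hk]
            rintro _ ⟨p, rfl⟩
            exact LinearMap.congr_fun hw p)
          refine ⟨g, trivial, ?_⟩
          have : w - pc k N d0 g = 0 := sub_eq_zero.2 hg.symm
          rw [this]
          exact zero_mem _
        · intro z _
          constructor
          · rintro ⟨h, hh⟩
            refine ⟨h, ?_⟩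
            ext x
            obtain ⟨p, rfl⟩ := hd0 x
            exact LinearMap.congr_fun hh p
          · rintro ⟨h, rfl⟩
            exact ⟨h, rfl⟩
      exact ⟨e0.some.symm.trans (e1.some.symm.trans e2.some)⟩
    · have e0 := shift_succ (N := N) s hc (S 0).some r
      have e1 := ih (LinearMap.ker ε) (fun n => P (n + 1)) (fun n => d (n + 1)) d0 hd0 hk
        (fun n => hd (n + 1)) (fun n => S (n + 1))
      exact ⟨e0.some.symm.trans e1.some⟩

end main


section extside

theorem homology_sq {k : Type} [Field k] (S : ShortComplex (ModuleCat.{0} k)) {V : Type}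
    [AddCommGroup V] [Module k V] (e : S.X₂ ≃ₗ[k] V) (Z B : Submodule k V)
    (hZ : ∀ x, e x ∈ Z ↔ S.g.hom x = 0) (hB : ∀ x, e x ∈ B ↔ ∃ y, S.f.hom y = x) :
    Nonempty (SQ Z B ≃ₗ[k] S.homology) := by
  have e1 : Nonempty (SQ (LinearMap.ker S.g.hom) (LinearMap.range S.f.hom) ≃ₗ[k] SQ Z B) := by
    refine sq_equiv e.toLinearMap (fun z hz => (hZ z).2 hz) ?_ (fun z _ => hB z)
    intro w hw
    refine ⟨e.symm w, ?_, ?_⟩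
    · exact (hZ _).1 (by simpa using hw)
    · simp
  have e2 : SQ (LinearMap.ker S.g.hom) (LinearMap.range S.f.hom) ≃ₗ[k]
      (LinearMap.ker S.g.hom ⧸ LinearMap.range S.moduleCatToCycles) :=
    Submodule.quotEquivOfEq _ _ (LinearMap.range_codRestrict _ _ _).symm
  exact ⟨e1.some.symm.trans (e2.trans S.moduleCatHomologyIso.toLinearEquiv.symm)⟩

variable {k R N X : Type} [Field k] [Ring R] [Algebra k R] [AddCommGroup N] [Module k N]
  [Module R N] [IsScalarTower k R N] [SMulCommClass R k N] [AddCommGroup X] [Module R X]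

/-- Morphisms in the category of modules. -/
def homE (P : ModuleCat.{0} R) :
    (((linearYoneda k (ModuleCat.{0} R)).obj (ModuleCat.of R N)).obj (Opposite.op P) : ModuleCat k)
      ≃ₗ[k] (P →ₗ[R] N) where
  toFun f := ModuleCat.Hom.hom f
  invFun f := ModuleCat.ofHom f
  left_inv f := rfl
  right_inv f := rfl
  map_add' f g := rfl
  map_smul' c f := LinearMap.ext fun x =>
    algebraMap_smul R c (show N from (ModuleCat.Hom.hom f) x)

theorem ext_sq (P : ProjectiveResolution (ModuleCat.of R X)) (r : ℕ) :
    Nonempty (SQ (LinearMap.ker (pc k N (P.complex.d (r + 1) r).hom))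
      (Bd (P := fun n => P.complex.X n) k R N (fun n => (P.complex.d (n + 1) n).hom) r) ≃ₗ[k]
      (((Ext k (ModuleCat.{0} R) r).obj (Opposite.op (ModuleCat.of R X))).obj
        (ModuleCat.of R N) : ModuleCat k)) := by
  have e1 := (P.isoExt (R := k) r (ModuleCat.of R N)).toLinearEquiv
  rcases r with _ | r
  · have e2 := ((P.complex.linearYonedaObj k (ModuleCat.of R N)).homologyIsoSc' 0 0 1
      (by simp) (by simp)).toLinearEquiv
    have e3 := homology_sq ((P.complex.linearYonedaObj k (ModuleCat.of R N)).sc' 0 0 1)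
      (homE (k := k) (N := N) (P.complex.X 0)) (LinearMap.ker (pc k N (P.complex.d 1 0).hom))
      ⊥ (by
        intro x
        constructor
        · intro h
          exact ModuleCat.hom_ext h
        · intro h
          exact congrArg ModuleCat.Hom.hom h) (by
        intro x
        have h0 : ((P.complex.linearYonedaObj k (ModuleCat.of R N)).sc' 0 0 1).f = 0 :=
          (P.complex.linearYonedaObj k (ModuleCat.of R N)).shape 0 0 (by simp)
        rw [h0]
        constructor
        · intro h
          refine ⟨0, ?_⟩
          symm
          exact ModuleCat.hom_ext h
        · rintro ⟨y, rfl⟩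
          exact rfl)
    exact ⟨e3.some.trans (e2.symm.trans e1.symm)⟩
  · have e2 := ((P.complex.linearYonedaObj k (ModuleCat.of R N)).homologyIsoSc' r (r + 1) (r + 2)
      (by simp) (by simp)).toLinearEquiv
    have e3 := homology_sq ((P.complex.linearYonedaObj k (ModuleCat.of R N)).sc' r (r + 1) (r + 2))
      (homE (k := k) (N := N) (P.complex.X (r + 1)))
      (LinearMap.ker (pc k N (P.complex.d (r + 2) (r + 1)).hom))
      (LinearMap.range (pc k N (P.complex.d (r + 1) r).hom)) (by
        intro x
        constructor
        · intro h
          exact ModuleCat.hom_ext h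
        · intro h
          exact congrArg ModuleCat.Hom.hom h) (by
        intro x
        constructor
        · rintro ⟨y, hy⟩
          exact ⟨(homE (k := k) (N := N) (P.complex.X r)).symm y, ModuleCat.hom_ext hy⟩
        · rintro ⟨y, rfl⟩
          exact ⟨homE (k := k) (N := N) (P.complex.X r) y, rfl⟩)
    exact ⟨e3.some.trans (e2.symm.trans e1.symm)⟩

theorem res_data (P : ProjectiveResolution (ModuleCat.of R X)) :
    ∃ ε : P.complex.X 0 →ₗ[R] X, Function.Surjective ε ∧
      LinearMap.range (P.complex.d 1 0).hom = LinearMap.ker ε := by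
  have h1 : Epi (P.π.f 0) := inferInstance
  refine ⟨(P.π.f 0).hom, ?_, ?_⟩
  · exact (ModuleCat.epi_iff_surjective _).1 h1
  · exact P.exact₀.moduleCat_range_eq_ker

theorem res_exact (P : ProjectiveResolution (ModuleCat.of R X)) (n : ℕ) :
    LinearMap.range (P.complex.d (n + 2) (n + 1)).hom
      = LinearMap.ker (P.complex.d (n + 1) n).hom :=
  (P.exact_succ n).moduleCat_range_eq_ker

end extside

section final

variable (k A B M : Type) [Field k] [Ring A] [Ring B] [Algebra k A] [Algebra k B]
  [AddCommGroup M] [Module k M] [Module B M] [Module Aᵐᵒᵖ M]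
  [SMulCommClass B Aᵐᵒᵖ M] [IsScalarTower k B M] [IsScalarTower k Aᵐᵒᵖ M]

theorem ext_main (r : ℕ) :
    Nonempty (SQ (Zc M M (bL k A B) (aR k A B) r) (Bc M M (bL k A B) (aR k A B) r) ≃ₗ[k]
      (cornerExt k A B M r : Type)) := by
  let P := projectiveResolution (ModuleCat.of (B ⊗[k] Aᵐᵒᵖ) M)
  letI : ∀ n, Module k (P.complex.X n) := fun n => ModuleCat.moduleOfAlgebraModule _
  haveI : ∀ n, IsScalarTower k (B ⊗[k] Aᵐᵒᵖ) (P.complex.X n) :=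
    fun n => ModuleCat.isScalarTower_of_algebra_moduleCat _
  obtain ⟨ε, h1, h2⟩ := res_data P
  have e1 := main_equiv (k := k) (N := M) (β := bL k A B) (α := aR k A B) ba_comm ba_span r M
    (fun n => P.complex.X n) (fun n => (P.complex.d (n + 1) n).hom) ε h1 h2 (res_exact P)
    (fun n => by
      haveI : Module.Projective (B ⊗[k] Aᵐᵒᵖ) (P.complex.X n) :=
        (IsProjective.iff_projective _).2 (P.projective n)
      exact sec_of_proj)
  exact ne_trans e1 (ext_sq P r)

theorem end_main :
    Nonempty (SQ (Zc M M (bL k A B) (aR k A B) 0) (Bc M M (bL k A B) (aR k A B) 0) ≃ₗ[k]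
      Module.End (B ⊗[k] Aᵐᵒᵖ) M) := by
  have e1 : Nonempty (SQ (⊤ : Submodule k (M →ₗ[B ⊗[k] Aᵐᵒᵖ] M)) ⊥ ≃ₗ[k]
      SQ (Zc M M (bL k A B) (aR k A B) 0) (Bc M M (bL k A B) (aR k A B) 0)) := by
    refine sq_equiv (psi k A B (B ⊗[k] Aᵐᵒᵖ) M M) (fun z _ => psi_mem z) ?_ ?_
    · intro w hw
      obtain ⟨g, rfl⟩ := psi_surj ba_span hw
      exact ⟨g, trivial, by rw [sub_self]; exact zero_mem _⟩
    · intro z _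
      show psi k A B (B ⊗[k] Aᵐᵒᵖ) M M z = 0 ↔ z = 0
      constructor
      · intro h
        exact psi_inj (h.trans (map_zero _).symm)
      · rintro rfl
        exact map_zero _
  have e2 : SQ (⊤ : Submodule k (M →ₗ[B ⊗[k] Aᵐᵒᵖ] M)) ⊥ ≃ₗ[k] (M →ₗ[B ⊗[k] Aᵐᵒᵖ] M) :=
    (Submodule.quotEquivOfEqBot _ (by rw [eq_bot_iff]; rintro x hx; exact Subtype.ext hx)).trans
      Submodule.topEquiv
  exact ⟨e1.some.symm.trans e2⟩

end final


section frozen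

variable (k A B M : Type) [Field k] [Ring A] [Ring B] [Algebra k A] [Algebra k B]
  [AddCommGroup M] [Module k M] [Module B M] [Module Aᵐᵒᵖ M]
  [SMulCommClass B Aᵐᵒᵖ M] [IsScalarTower k B M] [IsScalarTower k Aᵐᵒᵖ M]

theorem smul_bL (b : B) (m : M) : bL k A B b • m = b • m := by
  refine (TensorProduct.Algebra.smul_def b (1 : Aᵐᵒᵖ) m).trans ?_
  rw [one_smul]

theorem smul_aR (a : A) (m : M) : αl (aR k A B) a • m = op a • m := by
  refine (TensorProduct.Algebra.smul_def (1 : B) (op a) m).trans ?_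
  rw [one_smul]

theorem dB_eq {q p : ℕ} (f : RawC A B M q p) :
    (tB k A B M + (∑ j : Fin q, ((-1 : ℤ) ^ ((j : ℕ) + 1)) • mB k A B M j)
      + ((-1 : ℤ) ^ (q + 1)) • lB k A B M : RawC A B M q p →ₗ[k] RawC A B M (q + 1) p) f = dB M M (bL k A B) q p f := by
  funext b m a
  rw [dB_apply, dH_apply]
  simp only [LinearMap.add_apply, LinearMap.sum_apply, LinearMap.smul_apply, Pi.add_apply,
    Finset.sum_apply, Pi.smul_apply, postOp_apply, preOp_apply, smul_bL]
  rfl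

theorem dA_eq {q p : ℕ} (f : RawC A B M q p) :
    (tA k A B M + (∑ j : Fin p, ((-1 : ℤ) ^ ((j : ℕ) + 1)) • mA k A B M j)
      + ((-1 : ℤ) ^ (p + 1)) • lA k A B M : RawC A B M q p →ₗ[k] RawC A B M q (p + 1)) f = dA M M (aR k A B) q p f := by
  funext b m a
  rw [dA_apply, dH_apply]
  simp only [LinearMap.add_apply, LinearMap.sum_apply, LinearMap.smul_apply, Pi.add_apply,
    Finset.sum_apply, Pi.smul_apply, postOp_apply, preOp_apply, smul_aR]
  rfl

/-- Restriction to the summands of one degree. -/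
def res (n : ℕ) : T A B M M →ₗ[k] Raw A B M n where
  toFun F := fun i => F i.1.1 i.1.2
  map_add' F G := rfl
  map_smul' c F := rfl

theorem res_D (n : ℕ) (F : T A B M M) :
    dLin k A B M n (res k A B M n F) = res k A B M (n + 1) (D M M (bL k A B) (aR k A B) F) := by
  funext ⟨⟨q, p⟩, h⟩
  show _ = bP M M (bL k A B) F q p + aP M M (aR k A B) F q p
  rcases q with _ | q <;> rcases p with _ | p
  · rfl
  · rw [bP_zero, aP_succ, ← dA_eq]; rfl
  · rw [bP_succ, aP_zero, ← dB_eq]; rfl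
  · rw [bP_succ, aP_succ, ← dA_eq, ← dB_eq]; rfl

theorem ml_iff {q p : ℕ} (f : RawC A B M q p) : IsML k A B M f ↔ ML k f := by
  constructor
  · rintro ⟨h1, h2, h3, h4, h5, h6⟩
    exact ⟨fun a b i => ⟨fun x y => funext fun m => h1 b i x y m a,
      fun c x => funext fun m => h2 b i c x m a⟩,
      fun b a => ⟨fun m m' => h3 b m m' a, fun c m => h4 b c m a⟩,
      fun b a i => ⟨fun x y => funext fun m => h5 b m a i x y,
      fun c x => funext fun m => h6 b m a i c x⟩⟩
  · rintro ⟨h1, h2, h3⟩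
    exact ⟨fun b i x y m a => congrFun ((h1 a b i).map_add x y) m,
      fun b i c x m a => congrFun ((h1 a b i).map_smul c x) m,
      fun b m m' a => (h2 b a).map_add m m', fun b c m a => (h2 b a).map_smul c m,
      fun b m a i x y => congrFun ((h3 b a i).map_add x y) m,
      fun b m a i c x => congrFun ((h3 b a i).map_smul c x) m⟩

theorem res_mem {n m : ℕ} {F : T A B M M} (hF : F ∈ G k A B M M m) :
    res k A B M n F ∈ mlSub k A B M n :=
  fun i => (ml_iff k A B M _).2 (hF _ _).1

theorem res_surj {n : ℕ} {w : Raw A B M (n + 1)} (hw : w ∈ mlSub k A B M (n + 1)) :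
    ∃ F ∈ G k A B M M n, res k A B M (n + 1) F = w := by
  refine ⟨fun q p => if h : q + 1 + p = n + 1 then w ⟨(q, p), h⟩ else 0, fun q p => ⟨?_, ?_⟩, ?_⟩
  · by_cases h : q + 1 + p = n + 1
    · simp only [dif_pos h]
      exact (ml_iff k A B M _).1 (hw _)
    · simp only [dif_neg h]
      exact ML.zero k
  · intro h
    exact dif_neg (by omega)
  · funext ⟨⟨q, p⟩, h⟩
    exact dif_pos h

theorem res_inj {n : ℕ} {F : T A B M M} (hF : F ∈ G k A B M M n)
    (h : res k A B M (n + 1) F = 0) : F = 0 := by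
  funext q p
  by_cases hn : q + p = n
  · exact congrFun h ⟨(q, p), by show q + 1 + p = n + 1; omega⟩
  · exact (hF q p).2 hn

theorem res_eq {n : ℕ} {F F' : T A B M M} (hF : F ∈ G k A B M M n) (hF' : F' ∈ G k A B M M n)
    (h : res k A B M (n + 1) F = res k A B M (n + 1) F') : F = F' := by
  refine sub_eq_zero.1 (res_inj k A B M (sub_mem hF hF') ?_)
  rw [map_sub, h, sub_self]

theorem res_Z {r : ℕ} {F : T A B M M} (hF : F ∈ Zc M M (bL k A B) (aR k A B) r) :
    res k A B M (r + 1) F ∈ Zsub k A B M (r + 1) := by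
  refine ⟨res_mem k A B M hF.1, ?_⟩
  show dLin k A B M (r + 1) (res k A B M (r + 1) F) = 0
  rw [res_D, (mem_Zc.1 hF).2, map_zero]

theorem hcoh_main (r : ℕ) :
    Nonempty (SQ (Zc M M (bL k A B) (aR k A B) r) (Bc M M (bL k A B) (aR k A B) r) ≃ₗ[k]
      Hcoh k A B M (r + 1)) := by
  refine sq_equiv (Z2 := Zsub k A B M (r + 1)) (B2 := Bsub k A B M (r + 1) ⊓ Zsub k A B M (r + 1))
    (res k A B M (r + 1)) (fun z hz => res_Z k A B M hz) ?_ ?_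
  · intro w hw
    obtain ⟨F, hF, rfl⟩ := res_surj k A B M hw.1
    refine ⟨F, ⟨hF, ?_⟩, by rw [sub_self]; exact zero_mem _⟩
    refine res_inj k A B M (D_mem _ _ hF) ?_
    rw [← res_D]
    exact hw.2
  · intro z hz
    rw [Submodule.mem_inf, and_iff_left (res_Z k A B M hz)]
    rcases r with _ | r
    · constructor
      · rintro ⟨u, _, h⟩
        have hu : u = 0 := by
          funext ⟨⟨q, p⟩, h⟩
          exact absurd h (by show ¬ (q + 1 + p = 0); omega)
        rw [hu, map_zero] at h
        exact res_inj k A B M hz.1 h.symm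
      · intro h
        have : z = 0 := h
        rw [this, map_zero]
        exact zero_mem _
    · constructor
      · rintro ⟨u, hu, h⟩
        obtain ⟨F, hF, rfl⟩ := res_surj k A B M hu
        refine ⟨F, hF, ?_⟩
        refine res_eq k A B M (D_mem _ _ hF) hz.1 ?_
        rw [← res_D]
        exact h
      · rintro ⟨F, hF, rfl⟩
        exact ⟨res k A B M (r + 1) F, res_mem k A B M hF, res_D k A B M _ F⟩

end frozen

end Corner3



/-- the cohomology of the cochain complex
`K⁰ = 0 → Hom_k(M,M) → Hom_k(B⊗M,M) ⊕ Hom_k(M⊗A,M) → ⋯`,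
with `Kⁿ = ⊕_{q+p+1=n} Hom_k(B^{⊗q} ⊗ M ⊗ A^{⊗p}, M)` and the differential described in
`dLin`, is `Ext_{B⊗[k]Aᵒᵖ}(M,M)` shifted by one: `H^{1+r}(K•) ≅ Ext^r_{B⊗Aᵒᵖ}(M,M)` for
all `r ≥ 0`; in particular `H¹(K•) ≅ End_{B⊗Aᵒᵖ}(M)`. -/
theorem stmt_3 :
    (∀ r : ℕ, Nonempty (Hcoh k A B M (1 + r) ≃ₗ[k] (cornerExt k A B M r : Type))) ∧
    Nonempty (Hcoh k A B M 1 ≃ₗ[k] Module.End (B ⊗[k] Aᵐᵒᵖ) M) := by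
  refine ⟨fun r => ?_, ?_⟩
  · rw [Nat.add_comm 1 r]
    exact ⟨(Corner3.hcoh_main k A B M r).some.symm.trans (Corner3.ext_main k A B M r).some⟩
  · exact ⟨(Corner3.hcoh_main k A B M 0).some.symm.trans (Corner3.end_main k A B M).some⟩

end
end
end

section
/- Let Λ = [[A,N],[M,B]] be a null-square projective algebra over the field k. Then there is an exact sequence of k-vector spaces 0 → HH^0(Λ) → HH^0(A) ⊕ HH^0(B) → End_{B⊗A^op}(M) ⊕ End_{A⊗B^op}(N) → HH^1(Λ) → HH^1(A) ⊕ HH^1(B) → 0; that is, there exist k-linear maps making this five-term sequence exact, with the first map injective and the last map surjective. -/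
open scoped TensorProduct
open CategoryTheory MulOpposite

noncomputable section

/-- For a `k`-algebra `R`, `R` is a module over its enveloping algebra `R ⊗[k] Rᵐᵒᵖ`. -/
instance envModule (k R : Type) [Field k] [Ring R] [Algebra k R] :
    Module (R ⊗[k] Rᵐᵒᵖ) R := TensorProduct.Algebra.module

/-- Hochschild cohomology `HH^n(R) = Ext^n_{R ⊗[k] Rᵐᵒᵖ}(R, R)`, computed in the abelian
category of left modules over the enveloping algebra `R ⊗[k] Rᵐᵒᵖ`. -/
def HH (k : Type) [Field k] (R : Type) [Ring R] [Algebra k R] (n : ℕ) : ModuleCat k :=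
  ((Ext k (ModuleCat (R ⊗[k] Rᵐᵒᵖ)) n).obj
    (Opposite.op (ModuleCat.of (R ⊗[k] Rᵐᵒᵖ) R))).obj (ModuleCat.of (R ⊗[k] Rᵐᵒᵖ) R)

/-- The underlying `k`-vector space of `HH^n`. -/
abbrev HHt (k : Type) [Field k] (R : Type) [Ring R] [Algebra k R] (n : ℕ) : Type :=
  (HH k R n : Type)

section

variable (k A B M N : Type) [Field k] [Ring A] [Ring B] [Algebra k A] [Algebra k B]
  [AddCommGroup M] [Module k M] [Module B M] [Module Aᵐᵒᵖ M]
  [SMulCommClass B Aᵐᵒᵖ M] [IsScalarTower k B M] [IsScalarTower k Aᵐᵒᵖ M]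
  [AddCommGroup N] [Module k N] [Module A N] [Module Bᵐᵒᵖ N]
  [SMulCommClass A Bᵐᵒᵖ N] [IsScalarTower k A N] [IsScalarTower k Bᵐᵒᵖ N]

/-- The `B`-`A`-bimodule `M` as a left module over `B ⊗[k] Aᵐᵒᵖ`. -/
instance cornerModuleM : Module (B ⊗[k] Aᵐᵒᵖ) M := TensorProduct.Algebra.module

/-- The `A`-`B`-bimodule `N` as a left module over `A ⊗[k] Bᵐᵒᵖ`. -/
instance cornerModuleN : Module (A ⊗[k] Bᵐᵒᵖ) N := TensorProduct.Algebra.module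

instance cornerTowerM : IsScalarTower k (B ⊗[k] Aᵐᵒᵖ) M :=
  ⟨fun c x m => by
    show TensorProduct.Algebra.moduleAux (c • x) m = c • TensorProduct.Algebra.moduleAux x m
    rw [map_smul]; rfl⟩

instance cornerTowerN : IsScalarTower k (A ⊗[k] Bᵐᵒᵖ) N :=
  ⟨fun c x n => by
    show TensorProduct.Algebra.moduleAux (c • x) n = c • TensorProduct.Algebra.moduleAux x n
    rw [map_smul]; rfl⟩

instance : SMulCommClass k (A ⊗[k] Bᵐᵒᵖ) N := IsScalarTower.to_smulCommClass
instance : SMulCommClass (A ⊗[k] Bᵐᵒᵖ) k N := SMulCommClass.symm _ _ _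

/-- Left action of `A × B` on the corner bimodule `M`: `(a,b) • m = b • m`. -/
instance instLeftM : Module (A × B) M := Module.compHom M (RingHom.snd A B)

/-- Right action of `A × B` on `M`: `op (a,b) • m = op a • m`. -/
instance instRightM : Module (A × B)ᵐᵒᵖ M :=
  Module.compHom M (RingHom.op (RingHom.fst A B))

/-- Left action of `A × B` on the corner bimodule `N`: `(a,b) • n = a • n`. -/
instance instLeftN : Module (A × B) N := Module.compHom N (RingHom.fst A B)

/-- Right action of `A × B` on `N`: `op (a,b) • n = op b • n`. -/
instance instRightN : Module (A × B)ᵐᵒᵖ N :=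
  Module.compHom N (RingHom.op (RingHom.snd A B))

instance : SMulCommClass (A × B) (A × B)ᵐᵒᵖ M :=
  ⟨fun p q m => show p.2 • (op q.unop.1) • m = (op q.unop.1) • p.2 • m from
    smul_comm p.2 (op q.unop.1) m⟩

instance : SMulCommClass (A × B) (A × B)ᵐᵒᵖ N :=
  ⟨fun p q n => show p.1 • (op q.unop.2) • n = (op q.unop.2) • p.1 • n from
    smul_comm p.1 (op q.unop.2) n⟩

instance : IsScalarTower k (A × B) M := ⟨fun c p m => smul_assoc c p.2 m⟩
instance : IsScalarTower k (A × B) N := ⟨fun c p n => smul_assoc c p.1 n⟩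
instance : IsScalarTower k (A × B)ᵐᵒᵖ M := ⟨fun c p m => smul_assoc c (op p.unop.1) m⟩
instance : IsScalarTower k (A × B)ᵐᵒᵖ N := ⟨fun c p n => smul_assoc c (op p.unop.2) n⟩

/-- The null-square algebra `Λ = [[A,N],[M,B]]`: the trivial square-zero extension of
`A × B` by the `(A × B)`-bimodule `M × N`, where `(a,b) • (m,n) = (b•m, a•n)` and
`(m,n) • (a,b) = (m•a, n•b)`. -/
abbrev NullSq : Type := TrivSqZeroExt (A × B) (M × N)


section hom
universe u v
variable {k : Type u} [Ring k]

lemma sc_hom (S : ShortComplex (ModuleCat.{v} k)) :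
    ∃ q : LinearMap.ker S.g.hom →ₗ[k] S.homology, Function.Surjective q ∧
      ∀ x, q x = 0 ↔ ∃ y, S.f.hom y = x.1 := by
  refine ⟨S.moduleCatHomologyIso.toLinearEquiv.symm.toLinearMap ∘ₗ
    (LinearMap.range S.moduleCatToCycles).mkQ, ?_, ?_⟩
  · exact S.moduleCatHomologyIso.toLinearEquiv.symm.surjective.comp (Submodule.mkQ_surjective _)
  · intro x
    have : (S.moduleCatHomologyIso.toLinearEquiv.symm.toLinearMap ∘ₗ
      (LinearMap.range S.moduleCatToCycles).mkQ) x = 0 ↔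
      (LinearMap.range S.moduleCatToCycles).mkQ x = 0 :=
        LinearEquiv.map_eq_zero_iff (S.moduleCatHomologyIso.toLinearEquiv.symm)
    rw [this, Submodule.mkQ_apply, Submodule.Quotient.mk_eq_zero]
    constructor
    · rintro ⟨y, rfl⟩
      exact ⟨y, rfl⟩
    · rintro ⟨y, hy⟩
      exact ⟨y, Subtype.ext hy⟩

lemma cc_hom (K : CochainComplex (ModuleCat.{v} k) ℕ) (i j l : ℕ)
    (hi : (ComplexShape.up ℕ).prev j = i) (hl : (ComplexShape.up ℕ).next j = l) :
    ∃ q : LinearMap.ker (K.d j l).hom →ₗ[k] K.homology j, Function.Surjective q ∧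
      ∀ x, q x = 0 ↔ ∃ y, (K.d i j).hom y = x.1 := by
  obtain ⟨q, hq, hq'⟩ := sc_hom (K.sc' i j l)
  let e := (K.homologyIsoSc' i j l hi hl).toLinearEquiv.symm
  refine ⟨e.toLinearMap ∘ₗ q, e.surjective.comp hq, fun x => ?_⟩
  exact Iff.trans e.map_eq_zero_iff (hq' x)
end hom

section res
set_option linter.unusedSectionVars false
universe v u
variable {C : Type u} [Category.{v} C] [Abelian C] [EnoughProjectives C]
open Limits Projective

lemma proj_d_comp {X Y : C} (f : X ⟶ Y) : Projective.d f ≫ f = 0 :=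
  (by rw [Category.assoc, kernel.condition, comp_zero] :
    (Projective.π (kernel f) ≫ kernel.ι f) ≫ f = 0)

lemma epi_congr {X Y : C} {f f' : X ⟶ Y} (hf : f = f') (h : Epi f') : Epi f := by
  subst hf; exact h

lemma exact_congr {X Y Z : C} {f f' : X ⟶ Y} {g g' : Y ⟶ Z} (hf : f = f') (hg : g = g')
    (w' : f' ≫ g' = 0) (w : f ≫ g = 0) (h : (ShortComplex.mk f' g' w').Exact) :
    (ShortComplex.mk f g w).Exact := by
  subst hf hg; exact h

/-- resolution starting with a prescribed projective -/
def resComplex (S : ShortComplex C) : ChainComplex C ℕ :=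
  ChainComplex.mk' S.X₂ (Projective.over S.X₁) (Projective.π S.X₁ ≫ S.f)
    (fun f => ⟨_, Projective.d f, proj_d_comp f⟩)

lemma resComplex_d_1_0 (S : ShortComplex C) :
    (resComplex S).d 1 0 = Projective.π S.X₁ ≫ S.f := by
  simp [resComplex]

lemma resComplex_exactAt_succ (S : ShortComplex C) (n : ℕ) :
    (resComplex S).ExactAt (n + 1) := by
  rw [HomologicalComplex.exactAt_iff' _ (n + 1 + 1) (n + 1) n (by simp) (by simp)]
  simp only [HomologicalComplex.sc', HomologicalComplex.shortComplexFunctor', resComplex,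
    ChainComplex.mk', ChainComplex.mk]
  match n with
  | 0 =>
    refine exact_congr (ChainComplex.of_d (α := ℕ) _ _ _) (ChainComplex.of_d (α := ℕ) _ _ _) ?_ _ ?_
    · exact proj_d_comp _
    · exact exact_d_f _
  | n + 1 =>
    refine exact_congr (ChainComplex.of_d (α := ℕ) _ _ _) (ChainComplex.of_d (α := ℕ) _ _ _) ?_ _ ?_
    · exact proj_d_comp _
    · exact exact_d_f _

lemma resComplex_proj (S : ShortComplex C) [Projective S.X₂] (n : ℕ) : Projective ((resComplex S).X n) := by
  obtain (_ | _ | _ | n) := n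
  · assumption
  all_goals apply Projective.projective_over

lemma exact_pre (S : ShortComplex C) (hS : S.ShortExact) :
   (ShortComplex.mk (Projective.π S.X₁ ≫ S.f) S.g (by simp)).Exact := by
  let φ : (ShortComplex.mk (Projective.π S.X₁ ≫ S.f) S.g (by simp)) ⟶ S :=
    { τ₁ := Projective.π S.X₁, τ₂ := 𝟙 _, τ₃ := 𝟙 _ }
  have : Epi φ.τ₁ := by dsimp [φ]; infer_instance
  have : IsIso φ.τ₂ := by dsimp [φ]; infer_instance
  have : Mono φ.τ₃ := by dsimp [φ]; infer_instance
  exact (ShortComplex.exact_iff_of_epi_of_isIso_of_mono φ).2 hS.exact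

set_option maxHeartbeats 400000 in
def resOf (S : ShortComplex C) (hS : S.ShortExact) [Projective S.X₂] : ProjectiveResolution S.X₃ where
  complex := resComplex S
  projective := resComplex_proj S
  π := (ChainComplex.toSingle₀Equiv _ _).symm ⟨S.g,
    (congrArg (fun t : Projective.over S.X₁ ⟶ S.X₂ => t ≫ S.g) (resComplex_d_1_0 S)).trans
      (by simp : (Projective.π S.X₁ ≫ S.f) ≫ S.g = 0)⟩
  quasiIso := ⟨fun n => by
    have := hS.epi_g
    cases n
    · rw [ChainComplex.quasiIsoAt₀_iff, ShortComplex.quasiIso_iff_of_zeros']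
      · have h2 : (((ChainComplex.toSingle₀Equiv (resComplex S) S.X₃).symm ⟨S.g,
          (congrArg (fun t : Projective.over S.X₁ ⟶ S.X₂ => t ≫ S.g) (resComplex_d_1_0 S)).trans
          (by simp : (Projective.π S.X₁ ≫ S.f) ≫ S.g = 0)⟩).f 0) = S.g :=
            ChainComplex.toSingle₀Equiv_symm_apply_f_zero _ _
        constructor
        · exact exact_congr (resComplex_d_1_0 S) h2 _ _ (exact_pre S hS)
        · exact epi_congr h2 this
      all_goals rfl
    · rw [quasiIsoAt_iff_exactAt']
      · apply resComplex_exactAt_succ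
      · apply ChainComplex.exactAt_succ_single_obj⟩
end res


section ext
set_option linter.unusedSectionVars false
universe v u w
variable {C : Type u} [Category.{v} C] [Abelian C] [EnoughProjectives C]
open Limits Projective
variable (k : Type w) [Ring k] [Linear k C]

lemma ly_d (X : ChainComplex C ℕ) (Y : C) (i j : ℕ) (y : X.X i ⟶ Y) :
    ((X.linearYonedaObj k Y).d i j).hom y = X.d j i ≫ y := rfl

lemma exists_ext0 (S : ShortComplex C) (hS : S.ShortExact) [Projective S.X₂] (Y : C) :
    ∃ q : (S.X₃ ⟶ Y) →ₗ[k] ((Ext k C 0).obj (Opposite.op S.X₃)).obj Y, Function.Bijective q := by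
  have := hS.epi_g
  let P := resOf S hS
  let e := (P.isoExt (R := k) 0 Y).toLinearEquiv.symm
  obtain ⟨q, hq, hq'⟩ := cc_hom (P.complex.linearYonedaObj k Y) 0 0 1 (by simp) (by simp)
  have h10 : (resComplex S).d 1 0 = Projective.π S.X₁ ≫ S.f := resComplex_d_1_0 S
  let c : (S.X₃ ⟶ Y) →ₗ[k] LinearMap.ker ((P.complex.linearYonedaObj k Y).d 0 1).hom :=
    LinearMap.codRestrict (M₂ := (S.X₂ ⟶ Y)) _ (Linear.leftComp k Y S.g) (fun f => by
      have h : (Projective.π S.X₁ ≫ S.f) ≫ (S.g ≫ f) = 0 := by simp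
      exact (congrArg (fun t : Projective.over S.X₁ ⟶ S.X₂ => t ≫ (S.g ≫ f)) h10).trans h)
  refine ⟨e.toLinearMap ∘ₗ q ∘ₗ c, e.bijective.comp ⟨?_, ?_⟩⟩
  · rw [injective_iff_map_eq_zero]
    intro f hf
    obtain ⟨y, hy⟩ := (hq' _).1 hf
    have h0 : (P.complex.linearYonedaObj k Y).d 0 0 = 0 := HomologicalComplex.shape _ _ _ (by simp)
    rw [h0] at hy
    have hy' : S.g ≫ f = 0 := hy.symm
    exact zero_of_epi_comp _ hy'
  · refine hq.comp ?_
    rintro ⟨g, hg⟩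
    have hg1 : (Projective.π S.X₁ ≫ S.f) ≫ (show S.X₂ ⟶ Y from g) = 0 :=
      (congrArg (fun t : Projective.over S.X₁ ⟶ S.X₂ => t ≫ (show S.X₂ ⟶ Y from g)) h10).symm.trans hg
    rw [Category.assoc] at hg1
    have hg2 := zero_of_epi_comp _ hg1
    refine ⟨hS.exact.desc _ hg2, Subtype.ext ?_⟩
    exact hS.exact.g_desc _ hg2

lemma exact_of_mono {X Y Z W : C} (d : X ⟶ Y) (p : Y ⟶ Z) (i : Z ⟶ W) [Mono i] (hd : d ≫ p = 0)
    (hd0 : d ≫ p ≫ i = 0) (hex0 : (ShortComplex.mk d (p ≫ i) hd0).Exact) :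
    (ShortComplex.mk d p hd).Exact := by
  let φ : (ShortComplex.mk d p hd) ⟶ (ShortComplex.mk d (p ≫ i) hd0) :=
    { τ₁ := 𝟙 _, τ₂ := 𝟙 _, τ₃ := i }
  have : Epi φ.τ₁ := by dsimp [φ]; infer_instance
  have : IsIso φ.τ₂ := by dsimp [φ]; infer_instance
  have : Mono φ.τ₃ := by dsimp [φ]; infer_instance
  exact (ShortComplex.exact_iff_of_epi_of_isIso_of_mono φ).2 hex0

lemma exists_ext1 (S : ShortComplex C) (hS : S.ShortExact) [Projective S.X₂] (Y : C) :
    ∃ q : (S.X₁ ⟶ Y) →ₗ[k] ((Ext k C 1).obj (Opposite.op S.X₃)).obj Y, Function.Surjective q ∧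
      ∀ f, q f = 0 ↔ ∃ g : S.X₂ ⟶ Y, S.f ≫ g = f := by
  have := hS.epi_g
  have := hS.mono_f
  let P := resOf S hS
  let e := (P.isoExt (R := k) 1 Y).toLinearEquiv.symm
  obtain ⟨q, hq, hq'⟩ := cc_hom (P.complex.linearYonedaObj k Y) 0 1 2 (by simp) (by simp)
  have h10 : (resComplex S).d 1 0 = Projective.π S.X₁ ≫ S.f := resComplex_d_1_0 S
  let d : (resComplex S).X 2 ⟶ Projective.over S.X₁ := (resComplex S).d 2 1
  have hd0 : d ≫ Projective.π S.X₁ ≫ S.f = 0 :=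
    (congrArg (fun t : Projective.over S.X₁ ⟶ S.X₂ => d ≫ t) h10).symm.trans
      ((resComplex S).d_comp_d 2 1 0)
  have hd : d ≫ Projective.π S.X₁ = 0 := by
    rw [← cancel_mono S.f]; simpa using hd0
  have hex0 : (ShortComplex.mk d (Projective.π S.X₁ ≫ S.f) hd0).Exact := by
    have h := resComplex_exactAt_succ S 0
    rw [HomologicalComplex.exactAt_iff' _ (0 + 1 + 1) (0 + 1) 0 (by simp) (by simp)] at h
    exact exact_congr rfl h10.symm ((resComplex S).d_comp_d 2 1 0) _ h
  have hex := exact_of_mono d (Projective.π S.X₁) S.f hd hd0 hex0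
  let c : (S.X₁ ⟶ Y) →ₗ[k] LinearMap.ker ((P.complex.linearYonedaObj k Y).d 1 2).hom :=
    LinearMap.codRestrict (M₂ := (Projective.over S.X₁ ⟶ Y)) _
      (Linear.leftComp k Y (Projective.π S.X₁)) (fun f => by
      have h : d ≫ (Projective.π S.X₁ ≫ f) = 0 := by rw [← Category.assoc, hd, zero_comp]
      exact h)
  refine ⟨e.toLinearMap ∘ₗ q ∘ₗ c, e.surjective.comp (hq.comp ?_), ?_⟩
  · rintro ⟨g, hg⟩
    have hg2 : d ≫ (show Projective.over S.X₁ ⟶ Y from g) = 0 := hg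
    have : Epi (ShortComplex.mk d (Projective.π S.X₁) hd).g := by dsimp; infer_instance
    refine ⟨hex.desc _ hg2, Subtype.ext ?_⟩
    exact hex.g_desc _ hg2
  · intro f
    refine (e.map_eq_zero_iff (x := q (c f))).trans ((hq' (c f)).trans ?_)
    have key : ∀ y : S.X₂ ⟶ Y, ((P.complex.linearYonedaObj k Y).d 0 1).hom y =
       (Projective.π S.X₁ ≫ S.f) ≫ y := fun y =>
        (congrArg (fun t : Projective.over S.X₁ ⟶ S.X₂ => t ≫ y) h10)
    constructor
    · rintro ⟨y, hy⟩
      refine ⟨y, ?_⟩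
      have h3 : (Projective.π S.X₁ ≫ S.f) ≫ (show S.X₂ ⟶ Y from y) = Projective.π S.X₁ ≫ f :=
        (key y).symm.trans hy
      rw [← cancel_epi (Projective.π S.X₁), ← h3, Category.assoc]
    · rintro ⟨y, hy⟩
      refine ⟨y, (key y).trans ?_⟩
      rw [Category.assoc, hy]
      rfl
end ext


section hhcomp
variable (k R : Type) [Field k] [Ring R] [Algebra k R]

lemma env_smul (a : R) (b : Rᵐᵒᵖ) (r : R) : (a ⊗ₜ[k] b) • r = a * r * b.unop := by
  rw [mul_assoc]; exact TensorProduct.Algebra.smul_def a b r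

lemma env_tower (c : k) (r : R) : (algebraMap k (R ⊗[k] Rᵐᵒᵖ) c) • r = c • r := by
  rw [Algebra.TensorProduct.algebraMap_apply, env_smul, Algebra.smul_def]; simp

lemma env_zero (r : R) : (0 : R ⊗[k] Rᵐᵒᵖ) • r = 0 := by
  rw [← TensorProduct.zero_tmul R (1 : Rᵐᵒᵖ), env_smul]; simp

/-- regular bimodule -/
def envObj : ModuleCat (R ⊗[k] Rᵐᵒᵖ) := ModuleCat.of (R ⊗[k] Rᵐᵒᵖ) R

/-- multiplication -/
def envMul : R ⊗[k] Rᵐᵒᵖ →ₗ[R ⊗[k] Rᵐᵒᵖ] R := LinearMap.toSpanSingleton _ R 1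

lemma envMul_tmul (a : R) (b : Rᵐᵒᵖ) : envMul k R (a ⊗ₜ[k] b) = a * b.unop := by
  rw [envMul, LinearMap.toSpanSingleton_apply, env_smul, mul_one]

lemma envMul_surj : Function.Surjective (envMul k R) := fun r =>
  ⟨r ⊗ₜ[k] 1, by rw [envMul_tmul]; simp⟩

/-- centre -/
def ctr : Submodule k R := (Subalgebra.center k R).toSubmodule

lemma mem_ctr {z : R} : z ∈ ctr k R ↔ ∀ r, r * z = z * r :=
  Subalgebra.mem_center_iff (R := k)

/-- derivations -/
def derv : Submodule k (R →ₗ[k] R) where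
  carrier := {D | ∀ a b, D (a * b) = a * D b + D a * b}
  zero_mem' := by intro a b; simp
  add_mem' := by
    intro D E hD hE a b
    simp only [Set.mem_ofPred_eq] at hD hE
    rw [LinearMap.add_apply, hD, hE]; simp [mul_add, add_mul]; abel
  smul_mem' := by
    intro c D hD a b
    simp only [Set.mem_ofPred_eq] at hD
    rw [LinearMap.smul_apply, hD]; simp

lemma smul_hom {X Y : ModuleCat (R ⊗[k] Rᵐᵒᵖ)} (c : k) (f : X ⟶ Y) (x : X) :
    (c • f).hom x = (algebraMap k (R ⊗[k] Rᵐᵒᵖ) c) • f.hom x := rfl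

/-- central elements to endomorphisms -/
def ctrHom : ctr k R →ₗ[k] (envObj k R ⟶ envObj k R) where
  toFun z := ModuleCat.ofHom
    { toFun := fun r => r * z.1
      map_add' := fun r s => add_mul _ _ _
      map_smul' := fun s r => by
        induction s with
        | zero => exact (congrArg (· * z.1) (env_zero k R r)).trans
                    ((zero_mul _).trans (env_zero k R _).symm)
        | add x y hx hy => simp only [add_smul, add_mul, RingHom.id_apply] at hx hy ⊢; rw [hx, hy]
        | tmul a b =>
          have := (mem_ctr k R).1 z.2 b.unop
          simp only [env_smul, RingHom.id_apply, mul_assoc, this] }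
  map_add' z w := by ext r; exact mul_add _ _ _
  map_smul' c z := by
    ext r
    refine Eq.trans ?_ (env_tower k R _ _).symm
    exact mul_smul_comm c r z.1

lemma ctrHom_bij : Function.Bijective (ctrHom k R) := by
  constructor
  · intro z w h
    have h1 := congrArg (fun f => f.hom (1 : R)) h
    have h2 : (1 : R) * z.1 = 1 * w.1 := h1
    exact Subtype.ext (by simpa using h2)
  · intro f
    let g : R →ₗ[R ⊗[k] Rᵐᵒᵖ] R := f.hom
    have h1 : ∀ r, g r = r * g 1 := fun r => by
      have := g.map_smul (r ⊗ₜ 1) 1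
      simpa [env_smul] using this
    have h2 : ∀ r, g r = g 1 * r := fun r => by
      have := g.map_smul (1 ⊗ₜ op r) 1
      simpa [env_smul] using this
    refine ⟨⟨g 1, (mem_ctr k R).2 fun r => by rw [← h1, ← h2]⟩, ?_⟩
    ext r
    exact (h1 r).symm

/-- the defining sequence -/
def envSC : ShortComplex (ModuleCat (R ⊗[k] Rᵐᵒᵖ)) := (envMul k R).shortComplexKer

lemma envSC_exact : (envSC k R).ShortExact :=
  LinearMap.shortExact_shortComplexKer (envMul_surj k R)

lemma envSC_proj : Projective (envSC k R).X₂ :=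
  (IsProjective.iff_projective (R := R ⊗[k] Rᵐᵒᵖ) (R ⊗[k] Rᵐᵒᵖ)).1 inferInstance

lemma HH0 : ∃ q : ctr k R →ₗ[k] HHt k R 0, Function.Bijective q := by
  have := envSC_proj k R
  obtain ⟨q, hq⟩ := exists_ext0 k (envSC k R) (envSC_exact k R) (envObj k R)
  exact ⟨q ∘ₗ ctrHom k R, hq.comp (ctrHom_bij k R)⟩

variable {R}

/-- auxiliary map -/
def dphi : (R →ₗ[k] R) →ₗ[k] (R ⊗[k] Rᵐᵒᵖ →ₗ[k] R) where
  toFun D := TensorProduct.lift ((LinearMap.mul k R).compl₂ (D ∘ₗ (opLinearEquiv k).symm.toLinearMap))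
  map_add' D E := by ext a b; simp [mul_add]
  map_smul' c D := by ext a b; simp

lemma dphi_tmul (D : R →ₗ[k] R) (a : R) (b : Rᵐᵒᵖ) : dphi k D (a ⊗ₜ b) = a * D b.unop := by
  simp [dphi]

lemma dphi_mul (D : R →ₗ[k] R) (hD : D ∈ derv k R) (c : R) (d : Rᵐᵒᵖ) (x : R ⊗[k] Rᵐᵒᵖ) :
    dphi k D ((c ⊗ₜ d) * x) = (c ⊗ₜ[k] d) • dphi k D x + c * envMul k R x * D d.unop := by
  have hD' : ∀ a b, D (a * b) = a * D b + D a * b := hD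
  induction x with
  | zero => simp
  | add x y hx hy => simp only [mul_add, map_add, hx, hy, smul_add, add_mul]; abel
  | tmul a b =>
    rw [Algebra.TensorProduct.tmul_mul_tmul, dphi_tmul, dphi_tmul, envMul_tmul, env_smul,
      unop_mul, hD']
    simp only [mul_add, mul_assoc]; abel

variable (R)
/-- derivations to homs from the kernel -/
def derHom : derv k R →ₗ[k] ((envSC k R).X₁ ⟶ envObj k R) where
  toFun D := ModuleCat.ofHom (X := LinearMap.ker (envMul k R))
    { toFun := fun x => dphi k D.1 x.1
      map_add' := fun x y => map_add _ _ _
      map_smul' := fun s x => by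
        have hx : envMul k R x.1 = 0 := x.2
        induction s with
        | zero =>
          simp; exact (env_zero k R _).symm
        | add s t hs ht => 
          simp only [add_smul, Submodule.coe_add, map_add, RingHom.id_apply] at hs ht ⊢; rw [hs, ht]
        | tmul a b =>
          rw [Submodule.coe_smul, smul_eq_mul, dphi_mul k _ D.2, hx]; simp }
  map_add' z w := by
    ext r; exact congrArg (fun t : R ⊗[k] Rᵐᵒᵖ →ₗ[k] R => t r.1) (map_add (dphi k) z.1 w.1)
  map_smul' c z := by
    ext r
    refine Eq.trans ?_ (env_tower k R _ _).symm
    exact congrArg (fun t : R ⊗[k] Rᵐᵒᵖ →ₗ[k] R => t r.1) (map_smul (dphi k) c z.1)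

/-- universal derivation -/
def univD (r : R) : LinearMap.ker (envMul k R) :=
  ⟨1 ⊗ₜ op r - r ⊗ₜ 1, by simp [LinearMap.mem_ker, envMul_tmul]⟩

lemma derHom_surj : Function.Surjective (derHom k R) := by
  intro f
  let g : LinearMap.ker (envMul k R) →ₗ[R ⊗[k] Rᵐᵒᵖ] R := f.hom
  have gk : ∀ (c : k) x, g (algebraMap k (R ⊗[k] Rᵐᵒᵖ) c • x) = c • g x := fun c x => by
    rw [g.map_smul, env_tower]
  let D : R →ₗ[k] R :=
    { toFun := fun r => g (univD k R r)
      map_add' := fun r s => by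
        rw [← map_add]; congr 1; apply Subtype.ext
        simp [univD, TensorProduct.tmul_add, TensorProduct.add_tmul]; abel
      map_smul' := fun c r => by
        rw [RingHom.id_apply, ← gk]; congr 1; apply Subtype.ext
        rw [Submodule.coe_smul, smul_eq_mul, ← Algebra.smul_def]
        simp [univD, smul_sub, TensorProduct.smul_tmul'] }
  have hD : D ∈ derv k R := by
    intro a b
    have h : univD k R (a * b) = (a ⊗ₜ[k] 1 : R ⊗[k] Rᵐᵒᵖ) • univD k R b +
        (1 ⊗ₜ[k] op b : R ⊗[k] Rᵐᵒᵖ) • univD k R a := by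
      apply Subtype.ext
      simp [univD, mul_sub]
    change g _ = a * g _ + g _ * b
    rw [h, map_add, g.map_smul, g.map_smul, env_smul, env_smul]; simp
  have hmem : ∀ x : R ⊗[k] Rᵐᵒᵖ, x - envMul k R x ⊗ₜ 1 ∈ LinearMap.ker (envMul k R) := fun x => by
    rw [LinearMap.mem_ker, map_sub, envMul_tmul]; simp
  have key : ∀ x : R ⊗[k] Rᵐᵒᵖ, dphi k D x = g ⟨x - envMul k R x ⊗ₜ 1, hmem x⟩ := by
    intro x
    induction x with
    | zero => simp; exact (map_zero g).symm
    | add x y hx hy =>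
      rw [map_add, hx, hy, ← map_add]; congr 1; apply Subtype.ext
      simp [TensorProduct.add_tmul]; abel
    | tmul a b =>
      rw [dphi_tmul]
      have : (⟨a ⊗ₜ b - envMul k R (a ⊗ₜ b) ⊗ₜ 1, hmem _⟩ : LinearMap.ker (envMul k R)) =
        (a ⊗ₜ[k] 1 : R ⊗[k] Rᵐᵒᵖ) • univD k R b.unop := by
        apply Subtype.ext
        simp [univD, mul_sub, envMul_tmul]
      rw [this, g.map_smul, env_smul]; simp [D]
  refine ⟨⟨D, hD⟩, ?_⟩
  ext x
  refine (key x.1).trans ?_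
  have : (⟨x.1 - envMul k R x.1 ⊗ₜ 1, hmem x.1⟩ : LinearMap.ker (envMul k R)) = x := by
    apply Subtype.ext
    have hx : envMul k R x.1 = 0 := x.2
    simp [hx]
  rw [this]; rfl

lemma HH1 : ∃ q : derv k R →ₗ[k] HHt k R 1, Function.Surjective q ∧
    ∀ D, q D = 0 ↔ ∃ y : R, ∀ r, D.1 r = y * r - r * y := by
  have := envSC_proj k R
  obtain ⟨q, hq, hq'⟩ := exists_ext1 k (envSC k R) (envSC_exact k R) (envObj k R)
  refine ⟨q ∘ₗ derHom k R, hq.comp (derHom_surj k R), fun D => ?_⟩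
  refine (hq' _).trans ?_
  constructor
  · rintro ⟨f, hf⟩
    let g : R ⊗[k] Rᵐᵒᵖ →ₗ[R ⊗[k] Rᵐᵒᵖ] R := f.hom
    have h1 : ∀ x, g x = x • g 1 := fun x => by rw [← g.map_smul, smul_eq_mul, mul_one]
    have hD' : ∀ a b, D.1 (a * b) = a * D.1 b + D.1 a * b := D.2
    have hD1 : D.1 1 = 0 := by simpa using hD' 1 1
    refine ⟨g 1, fun r => ?_⟩
    have h2 : g (univD k R r).1 = dphi k D.1 (univD k R r).1 :=
      congrArg (fun t => t.hom (univD k R r)) hf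
    rw [h1] at h2
    simpa [univD, dphi_tmul, hD1, sub_smul, env_smul] using h2.symm
  · rintro ⟨y, hy⟩
    refine ⟨ModuleCat.ofHom (X := R ⊗[k] Rᵐᵒᵖ) (LinearMap.toSpanSingleton _ R y), ?_⟩
    have key : ∀ x : R ⊗[k] Rᵐᵒᵖ, x • y = dphi k D.1 x + envMul k R x * y := by
      intro x
      induction x with
      | zero => rw [env_zero]; simp
      | add x z hx hz => rw [add_smul, hx, hz, map_add, map_add, add_mul]; abel
      | tmul a b => rw [dphi_tmul, envMul_tmul, env_smul, hy, mul_sub]; simp [mul_assoc]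
    ext x
    have hx : envMul k R x.1 = 0 := x.2
    refine (key x.1).trans ?_
    rw [hx, zero_mul, add_zero]; rfl
end hhcomp


section bim
set_option linter.unusedSectionVars false

lemma descend {k V W U : Type} [Field k] [AddCommGroup V] [Module k V] [AddCommGroup W] [Module k W]
    [AddCommGroup U] [Module k U] (q : V →ₗ[k] W) (hq : Function.Surjective q) (h : V →ₗ[k] U)
    (hk : ∀ v, q v = 0 → h v = 0) : ∃ f : W →ₗ[k] U, ∀ v, f (q v) = h v := by
  obtain ⟨s, hs⟩ := q.exists_rightInverse_of_surjective (LinearMap.range_eq_top.2 hq)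
  refine ⟨h ∘ₗ s, fun v => ?_⟩
  have h1 : q (s (q v) - v) = 0 := by
    rw [map_sub, sub_eq_zero]; exact LinearMap.congr_fun hs (q v)
  have h2 := hk _ h1
  rwa [map_sub, sub_eq_zero] at h2

variable {k S T M : Type} [Field k] [Ring S] [Ring T] [Algebra k S] [Algebra k T]
  [AddCommGroup M] [Module k M] [Module S M] [Module T M] [Module (S ⊗[k] T) M]

/-- build an endomorphism -/
def mkEnd (hsm : ∀ (s : S) (t : T) (m : M), (s ⊗ₜ[k] t) • m = s • t • m)
    (f : M →+ M) (hs : ∀ (s : S) m, f (s • m) = s • f m) (ht : ∀ (t : T) m, f (t • m) = t • f m) :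
    Module.End (S ⊗[k] T) M where
  toFun := f
  map_add' := map_add f
  map_smul' x m := by
    induction x with
    | zero => rw [← TensorProduct.zero_tmul S (1 : T), RingHom.id_apply, hsm, hsm]; simp
    | add x y hx hy => simp only [add_smul, map_add, RingHom.id_apply] at hx hy ⊢; rw [hx, hy]
    | tmul s t => rw [RingHom.id_apply, hsm, hsm, hs, ht]

lemma end_left (hsm : ∀ (s : S) (t : T) (m : M), (s ⊗ₜ[k] t) • m = s • t • m)
    (φ : Module.End (S ⊗[k] T) M) (s : S) (m : M) : φ (s • m) = s • φ m := by
  have := φ.map_smul (s ⊗ₜ 1) m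
  simpa [hsm] using this

lemma end_right (hsm : ∀ (s : S) (t : T) (m : M), (s ⊗ₜ[k] t) • m = s • t • m)
    (φ : Module.End (S ⊗[k] T) M) (t : T) (m : M) : φ (t • m) = t • φ m := by
  have := φ.map_smul (1 ⊗ₜ t) m
  simpa [hsm] using this

lemma proj_delta {E : Type} [Ring E] [Algebra k E] [Module E M] [IsScalarTower k E M]
    (hP : Module.Projective E M) (D : E →ₗ[k] E) (hD : D ∈ derv k E) :
    ∃ δ : M →ₗ[k] M, ∀ (x : E) m, δ (x • m) = x • δ m + D x • m := by
  obtain ⟨σ, hσ⟩ := hP.out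
  have hD' : ∀ a b, D (a * b) = a * D b + D a * b := hD
  let p : (M →₀ E) →ₗ[E] M := Finsupp.linearCombination E id
  have hσ' : ∀ m, p (σ m) = m := hσ
  let DF : (M →₀ E) →ₗ[k] (M →₀ E) := Finsupp.mapRange.linearMap D
  refine ⟨(p.restrictScalars k) ∘ₗ DF ∘ₗ (σ.restrictScalars k), fun x m => ?_⟩
  have h : DF (σ (x • m)) = x • DF (σ m) + D x • σ m := by
    ext i
    simp [DF, hD']
  change p (DF (σ (x • m))) = x • p (DF (σ m)) + D x • m
  rw [h, map_add, map_smul, map_smul, hσ']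

lemma tensor_derv (dS : S →ₗ[k] S) (hS : dS ∈ derv k S) (dT : T →ₗ[k] T) (hT : dT ∈ derv k T) :
    TensorProduct.map dS LinearMap.id + TensorProduct.map LinearMap.id dT ∈ derv k (S ⊗[k] T) := by
  have hS' : ∀ a b, dS (a * b) = a * dS b + dS a * b := hS
  have hT' : ∀ a b, dT (a * b) = a * dT b + dT a * b := hT
  intro x y
  induction x with
  | zero => simp
  | add x x' hx hx' => simp only [add_mul, map_add, hx, hx']; abel
  | tmul s t =>
    induction y with
    | zero => simp
    | add y y' hy hy' => simp only [mul_add, map_add, hy, hy']; abel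
    | tmul s' t' =>
      simp only [LinearMap.add_apply, Algebra.TensorProduct.tmul_mul_tmul, TensorProduct.map_tmul,
        LinearMap.id_apply, hS', hT', TensorProduct.tmul_add, TensorProduct.add_tmul, mul_add, add_mul]
      abel

lemma exists_delta (hsm : ∀ (s : S) (t : T) (m : M), (s ⊗ₜ[k] t) • m = s • t • m)
    [IsScalarTower k (S ⊗[k] T) M] (hP : Module.Projective (S ⊗[k] T) M)
    (dS : S →ₗ[k] S) (hS : dS ∈ derv k S) (dT : T →ₗ[k] T) (hT : dT ∈ derv k T) :
    ∃ δ : M →ₗ[k] M, (∀ (s : S) m, δ (s • m) = s • δ m + dS s • m) ∧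
      (∀ (t : T) m, δ (t • m) = t • δ m + dT t • m) := by
  obtain ⟨δ, hδ⟩ := proj_delta hP _ (tensor_derv dS hS dT hT)
  have hS' : ∀ a b, dS (a * b) = a * dS b + dS a * b := hS
  have hT' : ∀ a b, dT (a * b) = a * dT b + dT a * b := hT
  have hS1 : dS 1 = 0 := by simpa using hS' 1 1
  have hT1 : dT 1 = 0 := by simpa using hT' 1 1
  refine ⟨δ, fun s m => ?_, fun t m => ?_⟩
  · have := hδ (s ⊗ₜ 1) m
    simpa [hsm, hT1] using this
  · have := hδ (1 ⊗ₜ t) m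
    simpa [hsm, hS1] using this

/-- opposite derivation -/
def opDer (d : S →ₗ[k] S) : Sᵐᵒᵖ →ₗ[k] Sᵐᵒᵖ :=
  (opLinearEquiv k).toLinearMap ∘ₗ d ∘ₗ (opLinearEquiv k).symm.toLinearMap

lemma opDer_op (d : S →ₗ[k] S) (s : S) : opDer d (op s) = op (d s) := rfl

lemma opDer_mem (d : S →ₗ[k] S) (hd : d ∈ derv k S) : opDer d ∈ derv k Sᵐᵒᵖ := by
  have hd' : ∀ a b, d (a * b) = a * d b + d a * b := hd
  intro a b
  obtain ⟨a, rfl⟩ := op_surjective a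
  obtain ⟨b, rfl⟩ := op_surjective b
  rw [← MulOpposite.op_mul, opDer_op, hd', opDer_op, opDer_op, MulOpposite.op_add, MulOpposite.op_mul, MulOpposite.op_mul, add_comm]
end bim

section main
set_option linter.unusedSectionVars false

variable {A B M N}

lemma hsmM (b : B) (a : Aᵐᵒᵖ) (m : M) : (b ⊗ₜ[k] a) • m = b • a • m :=
  TensorProduct.Algebra.smul_def b a m

lemma hsmN (a : A) (b : Bᵐᵒᵖ) (n : N) : (a ⊗ₜ[k] b) • n = a • b • n :=
  TensorProduct.Algebra.smul_def a b n

lemma ns_ext {x y : NullSq A B M N} (h1 : x.fst.1 = y.fst.1) (h2 : x.fst.2 = y.fst.2)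
    (h3 : x.snd.1 = y.snd.1) (h4 : x.snd.2 = y.snd.2) : x = y :=
  TrivSqZeroExt.ext (Prod.ext h1 h2) (Prod.ext h3 h4)

/-- build an element -/
def nsMk (a : A) (b : B) (m : M) (n : N) : NullSq A B M N := ((a, b), (m, n))

@[simp] lemma nsMk1 (a : A) (b : B) (m : M) (n : N) : (nsMk a b m n).fst.1 = a := rfl
@[simp] lemma nsMk2 (a : A) (b : B) (m : M) (n : N) : (nsMk a b m n).fst.2 = b := rfl
@[simp] lemma nsMk3 (a : A) (b : B) (m : M) (n : N) : (nsMk a b m n).snd.1 = m := rfl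
@[simp] lemma nsMk4 (a : A) (b : B) (m : M) (n : N) : (nsMk a b m n).snd.2 = n := rfl

lemma mul1 (x y : NullSq A B M N) : (x * y).fst.1 = x.fst.1 * y.fst.1 := rfl
lemma mul2 (x y : NullSq A B M N) : (x * y).fst.2 = x.fst.2 * y.fst.2 := rfl
lemma mul3 (x y : NullSq A B M N) :
    (x * y).snd.1 = x.fst.2 • y.snd.1 + op y.fst.1 • x.snd.1 := rfl
lemma mul4 (x y : NullSq A B M N) :
    (x * y).snd.2 = x.fst.1 • y.snd.2 + op y.fst.2 • x.snd.2 := rfl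
lemma add1 (x y : NullSq A B M N) : (x + y).fst.1 = x.fst.1 + y.fst.1 := rfl
lemma add2 (x y : NullSq A B M N) : (x + y).fst.2 = x.fst.2 + y.fst.2 := rfl
lemma add3 (x y : NullSq A B M N) : (x + y).snd.1 = x.snd.1 + y.snd.1 := rfl
lemma add4 (x y : NullSq A B M N) : (x + y).snd.2 = x.snd.2 + y.snd.2 := rfl
lemma sub1 (x y : NullSq A B M N) : (x - y).fst.1 = x.fst.1 - y.fst.1 := rfl
lemma sub2 (x y : NullSq A B M N) : (x - y).fst.2 = x.fst.2 - y.fst.2 := rfl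
lemma sub3 (x y : NullSq A B M N) : (x - y).snd.1 = x.snd.1 - y.snd.1 := rfl
lemma sub4 (x y : NullSq A B M N) : (x - y).snd.2 = x.snd.2 - y.snd.2 := rfl
lemma sm1 (c : k) (x : NullSq A B M N) : (c • x).fst.1 = c • x.fst.1 := rfl
lemma sm2 (c : k) (x : NullSq A B M N) : (c • x).fst.2 = c • x.fst.2 := rfl
lemma sm3 (c : k) (x : NullSq A B M N) : (c • x).snd.1 = c • x.snd.1 := rfl
lemma sm4 (c : k) (x : NullSq A B M N) : (c • x).snd.2 = c • x.snd.2 := rfl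
lemma zero1 : (0 : NullSq A B M N).fst.1 = 0 := rfl
lemma zero2 : (0 : NullSq A B M N).fst.2 = 0 := rfl
lemma zero3 : (0 : NullSq A B M N).snd.1 = 0 := rfl
lemma zero4 : (0 : NullSq A B M N).snd.2 = 0 := rfl

lemma ctr_iff (z : NullSq A B M N) : z ∈ ctr k (NullSq A B M N) ↔
    z.fst.1 ∈ ctr k A ∧ z.fst.2 ∈ ctr k B ∧ z.snd.1 = 0 ∧ z.snd.2 = 0 ∧
    (∀ m : M, z.fst.2 • m = op z.fst.1 • m) ∧ (∀ n : N, z.fst.1 • n = op z.fst.2 • n) := by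
  simp only [mem_ctr]
  constructor
  · intro h
    refine ⟨fun a => ?_, fun b => ?_, ?_, ?_, fun m => ?_, fun n => ?_⟩
    · have := congrArg (fun t => t.fst.1) (h (nsMk a 0 0 0))
      simpa [mul1] using this
    · have := congrArg (fun t => t.fst.2) (h (nsMk 0 b 0 0))
      simpa [mul2] using this
    · have := congrArg (fun t : NullSq A B M N => t.snd.1) (h (nsMk 1 0 0 0))
      simp only [mul3, nsMk1, nsMk2, nsMk3, nsMk4] at this
      simpa using this.symm
    · have := congrArg (fun t : NullSq A B M N => t.snd.2) (h (nsMk 1 0 0 0))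
      simp only [mul4, nsMk1, nsMk2, nsMk3, nsMk4] at this
      simpa using this
    · have := congrArg (fun t : NullSq A B M N => t.snd.1) (h (nsMk 0 0 m 0))
      simp only [mul3, nsMk1, nsMk2, nsMk3, nsMk4] at this
      simpa using this.symm
    · have := congrArg (fun t : NullSq A B M N => t.snd.2) (h (nsMk 0 0 0 n))
      simp only [mul4, nsMk1, nsMk2, nsMk3, nsMk4] at this
      simpa using this.symm
  · rintro ⟨h1, h2, h3, h4, h5, h6⟩ r
    apply ns_ext
    · rw [mul1, mul1, h1]
    · rw [mul2, mul2, h2]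
    · rw [mul3, mul3, h3, h5]; simp
    · rw [mul4, mul4, h4, h6]; simp

variable (A B M N)

/-- the first map on centres -/
def g1 : ctr k (NullSq A B M N) →ₗ[k] (ctr k A × ctr k B) where
  toFun z := (⟨z.1.fst.1, ((ctr_iff k z.1).1 z.2).1⟩, ⟨z.1.fst.2, ((ctr_iff k z.1).1 z.2).2.1⟩)
  map_add' _ _ := rfl
  map_smul' _ _ := rfl

lemma g1_inj : Function.Injective (g1 k A B M N) := by
  intro z w h
  have hz := (ctr_iff k z.1).1 z.2
  have hw := (ctr_iff k w.1).1 w.2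
  apply Subtype.ext
  apply ns_ext
  · exact congrArg (fun t => t.1.1) h
  · exact congrArg (fun t => t.2.1) h
  · rw [hz.2.2.1, hw.2.2.1]
  · rw [hz.2.2.2.1, hw.2.2.2.1]

/-- the `M` component -/
def g2M (x : ctr k A × ctr k B) : Module.End (B ⊗[k] Aᵐᵒᵖ) M :=
  mkEnd (hsmM k)
    { toFun := fun m => x.2.1 • m - op x.1.1 • m
      map_zero' := by simp
      map_add' := fun m m' => by simp only [smul_add]; abel }
    (fun b m => by
      have h := (mem_ctr k B).1 x.2.2 b
      simp only [AddMonoidHom.coe_mk, ZeroHom.coe_mk, smul_sub]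
      rw [smul_smul, ← h, mul_smul, smul_comm b (op x.1.1) m])
    (fun a m => by
      have h := (mem_ctr k A).1 x.1.2 a.unop
      have h' : op x.1.1 * a = a * op x.1.1 := by
        rw [← op_unop a, ← MulOpposite.op_mul, ← MulOpposite.op_mul, h]
      simp only [AddMonoidHom.coe_mk, ZeroHom.coe_mk, smul_sub]
      rw [smul_smul (op x.1.1), h', mul_smul, smul_comm x.2.1 a m])

/-- the `N` component -/
def g2N (x : ctr k A × ctr k B) : Module.End (A ⊗[k] Bᵐᵒᵖ) N :=
  mkEnd (hsmN k)
    { toFun := fun m => x.1.1 • m - op x.2.1 • m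
      map_zero' := by simp
      map_add' := fun m m' => by simp only [smul_add]; abel }
    (fun b m => by
      have h := (mem_ctr k A).1 x.1.2 b
      simp only [AddMonoidHom.coe_mk, ZeroHom.coe_mk, smul_sub]
      rw [smul_smul, ← h, mul_smul, smul_comm b (op x.2.1) m])
    (fun a m => by
      have h := (mem_ctr k B).1 x.2.2 a.unop
      have h' : op x.2.1 * a = a * op x.2.1 := by
        rw [← op_unop a, ← MulOpposite.op_mul, ← MulOpposite.op_mul, h]
      simp only [AddMonoidHom.coe_mk, ZeroHom.coe_mk, smul_sub]
      rw [smul_smul (op x.2.1), h', mul_smul, smul_comm x.1.1 a m])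

lemma g2M_apply (x : ctr k A × ctr k B) (m : M) :
    g2M k A B M x m = x.2.1 • m - op x.1.1 • m := rfl

lemma g2N_apply (x : ctr k A × ctr k B) (n : N) :
    g2N k A B N x n = x.1.1 • n - op x.2.1 • n := rfl

/-- the second map -/
def g2 : (ctr k A × ctr k B) →ₗ[k]
    (Module.End (B ⊗[k] Aᵐᵒᵖ) M × Module.End (A ⊗[k] Bᵐᵒᵖ) N) where
  toFun x := (g2M k A B M x, g2N k A B N x)
  map_add' x y := by
    apply Prod.ext
    · ext m
      simp only [g2M_apply, Prod.fst_add, Prod.snd_add, Submodule.coe_add, MulOpposite.op_add, add_smul,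
        LinearMap.add_apply]
      abel
    · ext m
      simp only [g2N_apply, Prod.fst_add, Prod.snd_add, Submodule.coe_add, MulOpposite.op_add, add_smul,
        LinearMap.add_apply]
      abel
  map_smul' c x := by
    apply Prod.ext
    · ext m
      simp only [g2M_apply, Prod.smul_fst, Prod.smul_snd, Submodule.coe_smul, MulOpposite.op_smul, smul_assoc,
        LinearMap.smul_apply, RingHom.id_apply, smul_sub]
    · ext m
      simp only [g2N_apply, Prod.smul_fst, Prod.smul_snd, Submodule.coe_smul, MulOpposite.op_smul, smul_assoc,
        LinearMap.smul_apply, RingHom.id_apply, smul_sub]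

lemma g2_zero_iff (x : ctr k A × ctr k B) : g2 k A B M N x = 0 ↔
    (∀ m : M, x.2.1 • m = op x.1.1 • m) ∧ (∀ n : N, x.1.1 • n = op x.2.1 • n) := by
  constructor
  · intro h
    exact ⟨fun m => sub_eq_zero.1 (LinearMap.congr_fun (congrArg Prod.fst h) m),
      fun m => sub_eq_zero.1 (LinearMap.congr_fun (congrArg Prod.snd h) m)⟩
  · rintro ⟨h1, h2⟩
    apply Prod.ext
    · ext m; exact sub_eq_zero.2 (h1 m)
    · ext m; exact sub_eq_zero.2 (h2 m)

lemma g12_exact : Function.Exact (g1 k A B M N) (g2 k A B M N) := by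
  intro x
  rw [g2_zero_iff]
  constructor
  · rintro ⟨h1, h2⟩
    exact ⟨⟨nsMk x.1.1 x.2.1 0 0, (ctr_iff k _).2 ⟨x.1.2, x.2.2, rfl, rfl, h1, h2⟩⟩, rfl⟩
  · rintro ⟨z, rfl⟩
    exact ((ctr_iff k z.1).1 z.2).2.2.2.2

lemma endM_left (φ : Module.End (B ⊗[k] Aᵐᵒᵖ) M) (b : B) (m : M) : φ (b • m) = b • φ m :=
  end_left (hsmM k) φ b m
lemma endM_right (φ : Module.End (B ⊗[k] Aᵐᵒᵖ) M) (a : Aᵐᵒᵖ) (m : M) : φ (a • m) = a • φ m :=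
  end_right (hsmM k) φ a m
lemma endN_left (φ : Module.End (A ⊗[k] Bᵐᵒᵖ) N) (a : A) (m : N) : φ (a • m) = a • φ m :=
  end_left (hsmN k) φ a m
lemma endN_right (φ : Module.End (A ⊗[k] Bᵐᵒᵖ) N) (b : Bᵐᵒᵖ) (m : N) : φ (b • m) = b • φ m :=
  end_right (hsmN k) φ b m

/-- the third map -/
def g3 : (Module.End (B ⊗[k] Aᵐᵒᵖ) M × Module.End (A ⊗[k] Bᵐᵒᵖ) N) →ₗ[k]
    derv k (NullSq A B M N) where
  toFun f := ⟨
    { toFun := fun x => nsMk 0 0 (f.1 x.snd.1) (f.2 x.snd.2)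
      map_add' := fun x y => ns_ext (add_zero 0).symm (add_zero 0).symm
        (map_add f.1 _ _) (map_add f.2 _ _)
      map_smul' := fun c x => ns_ext (smul_zero c).symm (smul_zero c).symm
        (LinearMap.map_smul_of_tower f.1 c _) (LinearMap.map_smul_of_tower f.2 c _) }, by
    intro x y
    simp only [LinearMap.coe_mk, AddHom.coe_mk]
    apply ns_ext
    · simp [add1, mul1]
    · simp [add2, mul2]
    · rw [add3, mul3, mul3, nsMk3, mul3, map_add, endM_left, endM_right]
      simp only [nsMk1, nsMk2, nsMk3, MulOpposite.op_zero, zero_smul]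
      rw [add_zero, zero_add]
    · rw [add4, mul4, mul4, nsMk4, mul4, map_add, endN_left, endN_right]
      simp only [nsMk1, nsMk2, nsMk4, MulOpposite.op_zero, zero_smul]
      rw [add_zero, zero_add]⟩
  map_add' f g := Subtype.ext <| LinearMap.ext fun x =>
    ns_ext (add_zero 0).symm (add_zero 0).symm rfl rfl
  map_smul' c f := Subtype.ext <| LinearMap.ext fun x =>
    ns_ext (smul_zero c).symm (smul_zero c).symm rfl rfl

lemma g3_apply (f : Module.End (B ⊗[k] Aᵐᵒᵖ) M × Module.End (A ⊗[k] Bᵐᵒᵖ) N)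
    (x : NullSq A B M N) : (g3 k A B M N f).1 x = nsMk 0 0 (f.1 x.snd.1) (f.2 x.snd.2) := rfl

/-- restriction of derivations to the diagonal -/
def rho : derv k (NullSq A B M N) →ₗ[k] (derv k A × derv k B) where
  toFun D := (
    ⟨{ toFun := fun a => (D.1 (nsMk a 0 0 0)).fst.1
       map_add' := fun a a' => by
        rw [← add1, ← map_add]
        congr 3
        exact ns_ext rfl (add_zero 0).symm (add_zero 0).symm (add_zero 0).symm
       map_smul' := fun c a => by
        rw [RingHom.id_apply, ← sm1, ← map_smul]
        congr 3
        exact ns_ext rfl (smul_zero c).symm (smul_zero c).symm (smul_zero c).symm }, by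
      intro a a'
      have h := congrArg (fun t : NullSq A B M N => t.fst.1) (D.2 (nsMk a 0 0 0) (nsMk a' 0 0 0))
      have e : (nsMk a 0 0 0 * nsMk a' 0 0 0 : NullSq A B M N) = nsMk (a * a') 0 0 0 := by
        apply ns_ext
        · rfl
        · rw [mul2]; simp
        · rw [mul3]; simp
        · rw [mul4]; simp
      rw [e] at h
      exact h⟩,
    ⟨{ toFun := fun b => (D.1 (nsMk 0 b 0 0)).fst.2
       map_add' := fun a a' => by
        rw [← add2, ← map_add]
        congr 3
        exact ns_ext (add_zero 0).symm rfl (add_zero 0).symm (add_zero 0).symm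
       map_smul' := fun c a => by
        rw [RingHom.id_apply, ← sm2, ← map_smul]
        congr 3
        exact ns_ext (smul_zero c).symm rfl (smul_zero c).symm (smul_zero c).symm }, by
      intro a a'
      have h := congrArg (fun t : NullSq A B M N => t.fst.2) (D.2 (nsMk 0 a 0 0) (nsMk 0 a' 0 0))
      have e : (nsMk 0 a 0 0 * nsMk 0 a' 0 0 : NullSq A B M N) = nsMk 0 (a * a') 0 0 := by
        apply ns_ext
        · rw [mul1]; simp
        · rfl
        · rw [mul3]; simp
        · rw [mul4]; simp
      rw [e] at h
      exact h⟩)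
  map_add' _ _ := rfl
  map_smul' _ _ := rfl

lemma rho1 (D : derv k (NullSq A B M N)) (a : A) :
    (rho k A B M N D).1.1 a = (D.1 (nsMk a 0 0 0)).fst.1 := rfl
lemma rho2 (D : derv k (NullSq A B M N)) (b : B) :
    (rho k A B M N D).2.1 b = (D.1 (nsMk 0 b 0 0)).fst.2 := rfl

end main

section fin
set_option linter.unusedSectionVars false
set_option linter.unusedSimpArgs false

variable {A B M N}

lemma nsMk_mul (a a' : A) (b b' : B) (m m' : M) (n n' : N) :
    nsMk a b m n * nsMk a' b' m' n' =
      nsMk (a * a') (b * b') (b • m' + op a' • m) (a • n' + op b' • n) := rfl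
lemma nsMk_add (a a' : A) (b b' : B) (m m' : M) (n n' : N) :
    nsMk a b m n + nsMk a' b' m' n' = nsMk (a + a') (b + b') (m + m') (n + n') := rfl
lemma nsMk_eta (x : NullSq A B M N) : x = nsMk x.fst.1 x.fst.2 x.snd.1 x.snd.2 := rfl
lemma nsMk_one : (1 : NullSq A B M N) = nsMk 1 1 0 0 := rfl
lemma nsMk_zero : (0 : NullSq A B M N) = nsMk 0 0 0 0 := rfl

/-- inner derivation -/
def innD (R : Type) [Ring R] [Algebra k R] (y : R) : derv k R :=
  ⟨LinearMap.mulLeft k y - LinearMap.mulRight k y, by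
    intro a b
    simp only [LinearMap.sub_apply, LinearMap.mulLeft_apply, LinearMap.mulRight_apply]
    noncomm_ring⟩

lemma descendD {V W U : Type} [AddCommMonoid V] [Module k V] [AddCommGroup W] [Module k W]
    [AddCommGroup U] [Module k U] (q : V →ₗ[k] W) (hq : Function.Surjective q)
    (h : V →ₗ[k] U)
    (hk : ∀ v, q v = 0 → h v = 0) : ∃ f : W →ₗ[k] U, ∀ v, f (q v) = h v := by
  letI : AddCommGroup V := Module.addCommMonoidToAddCommGroup k
  exact descend q hq h hk

lemma innD_apply (R : Type) [Ring R] [Algebra k R] (y r : R) :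
    (innD k R y).1 r = y * r - r * y := rfl

lemma rho_inner (D : derv k (NullSq A B M N)) (y : NullSq A B M N)
    (h : ∀ r, D.1 r = y * r - r * y) :
    (∀ a, (rho k A B M N D).1.1 a = y.fst.1 * a - a * y.fst.1) ∧
    (∀ b, (rho k A B M N D).2.1 b = y.fst.2 * b - b * y.fst.2) :=
  ⟨fun a => by rw [rho1, h]; rfl, fun b => by rw [rho2, h]; rfl⟩

lemma g3_inner_iff (f : Module.End (B ⊗[k] Aᵐᵒᵖ) M × Module.End (A ⊗[k] Bᵐᵒᵖ) N) :
    (∃ y, ∀ r, (g3 k A B M N f).1 r = y * r - r * y) ↔ ∃ x, g2 k A B M N x = f := by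
  constructor
  · rintro ⟨y, h⟩
    have hA : y.fst.1 ∈ ctr k A := (mem_ctr k A).2 fun a =>
      (sub_eq_zero.1 (congrArg (fun t : NullSq A B M N => t.fst.1) (h (nsMk a 0 0 0))).symm).symm
    have hB : y.fst.2 ∈ ctr k B := (mem_ctr k B).2 fun b =>
      (sub_eq_zero.1 (congrArg (fun t : NullSq A B M N => t.fst.2) (h (nsMk 0 b 0 0))).symm).symm
    refine ⟨(⟨_, hA⟩, ⟨_, hB⟩), ?_⟩
    apply Prod.ext
    · refine LinearMap.ext fun m => ?_
      have := congrArg (fun t : NullSq A B M N => t.snd.1) (h (nsMk 0 0 m 0))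
      simp only [g3_apply, sub3, mul3, nsMk1, nsMk2, nsMk3, nsMk4, MulOpposite.op_zero, zero_smul,
        add_zero, zero_add] at this
      exact this.symm
    · refine LinearMap.ext fun n => ?_
      have := congrArg (fun t : NullSq A B M N => t.snd.2) (h (nsMk 0 0 0 n))
      simp only [g3_apply, sub4, mul4, nsMk1, nsMk2, nsMk3, nsMk4, MulOpposite.op_zero, zero_smul,
        add_zero, zero_add] at this
      exact this.symm
  · rintro ⟨x, rfl⟩
    refine ⟨nsMk x.1.1 x.2.1 0 0, fun r => ?_⟩
    apply ns_ext
    · have := (mem_ctr k A).1 x.1.2 r.fst.1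
      simp only [g3_apply, sub1, mul1, nsMk1, this, sub_self]
    · have := (mem_ctr k B).1 x.2.2 r.fst.2
      simp only [g3_apply, sub2, mul2, nsMk2, this, sub_self]
    · simp only [g3_apply, sub3, mul3, nsMk1, nsMk2, nsMk3, smul_zero, add_zero, zero_add]
      rfl
    · simp only [g3_apply, sub4, mul4, nsMk1, nsMk2, nsMk4, smul_zero, add_zero, zero_add]
      rfl

lemma rho_g3 (f : Module.End (B ⊗[k] Aᵐᵒᵖ) M × Module.End (A ⊗[k] Bᵐᵒᵖ) N) :
    rho k A B M N (g3 k A B M N f) = 0 := rfl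

lemma killed (D : derv k (NullSq A B M N)) (he : D.1 (nsMk 1 0 0 0) = 0)
    (hr : rho k A B M N D = 0) : ∃ f, g3 k A B M N f = D := by
  have hD : ∀ x y, D.1 (x * y) = x * D.1 y + D.1 x * y := D.2
  have h1 : D.1 1 = 0 := by simpa using hD 1 1
  have he' : D.1 (nsMk 0 1 0 0) = 0 := by
    have e : (nsMk 0 1 0 0 : NullSq A B M N) = 1 - nsMk 1 0 0 0 := by
      apply ns_ext <;> simp [nsMk_one, sub1, sub2, sub3, sub4]
    rw [e, map_sub, h1, he, sub_zero]
  have L : ∀ u x : NullSq A B M N, D.1 u = 0 → D.1 (u * x) = u * D.1 x := fun u x h => by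
    rw [hD, h, zero_mul, add_zero]
  have R : ∀ u x : NullSq A B M N, D.1 u = 0 → D.1 (x * u) = D.1 x * u := fun u x h => by
    rw [hD, h, mul_zero, zero_add]
  have dA : ∀ a, D.1 (nsMk a 0 0 0) = 0 := by
    intro a
    have l := L (nsMk 1 0 0 0) (nsMk a 0 0 0) he
    have r := R (nsMk 1 0 0 0) (nsMk a 0 0 0) he
    simp only [nsMk_mul, one_mul, mul_one, mul_zero, smul_zero, add_zero] at l r
    apply ns_ext
    · exact LinearMap.congr_fun (congrArg (fun t => t.1.1) hr) a
    · rw [l, mul2]; simp only [nsMk2, zero_mul]; rfl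
    · rw [l, mul3]; simp only [nsMk2, nsMk3, zero_smul, smul_zero, add_zero]; rfl
    · rw [r, mul4]; simp only [nsMk2, nsMk4, MulOpposite.op_zero, zero_smul, smul_zero, add_zero]; rfl
  have dB : ∀ b, D.1 (nsMk 0 b 0 0) = 0 := by
    intro b
    have l := L (nsMk 0 1 0 0) (nsMk 0 b 0 0) he'
    have r := R (nsMk 0 1 0 0) (nsMk 0 b 0 0) he'
    simp only [nsMk_mul, one_mul, mul_one, mul_zero, smul_zero, add_zero] at l r
    apply ns_ext
    · rw [l, mul1]; simp only [nsMk1, zero_mul]; rfl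
    · exact LinearMap.congr_fun (congrArg (fun t => t.2.1) hr) b
    · rw [r, mul3]; simp only [nsMk1, nsMk3, MulOpposite.op_zero, zero_smul, smul_zero, add_zero]; rfl
    · rw [l, mul4]; simp only [nsMk1, nsMk4, zero_smul, smul_zero, add_zero]; rfl
  have dM : ∀ m, D.1 (nsMk 0 0 m 0) = nsMk 0 0 (D.1 (nsMk 0 0 m 0)).snd.1 0 := by
    intro m
    have l := L (nsMk 0 1 0 0) (nsMk 0 0 m 0) he'
    have r := R (nsMk 1 0 0 0) (nsMk 0 0 m 0) he
    simp only [nsMk_mul, one_mul, mul_one, mul_zero, smul_zero, add_zero, one_smul, zero_add,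
      MulOpposite.op_one] at l r
    apply ns_ext
    · rw [l, mul1]; simp only [nsMk1, zero_mul]
    · rw [r, mul2]; simp only [nsMk2, mul_zero]
    · rfl
    · rw [l, mul4]; simp only [nsMk1, nsMk4, zero_smul, smul_zero, add_zero]
  have dN : ∀ n, D.1 (nsMk 0 0 0 n) = nsMk 0 0 0 (D.1 (nsMk 0 0 0 n)).snd.2 := by
    intro n
    have l := L (nsMk 1 0 0 0) (nsMk 0 0 0 n) he
    have r := R (nsMk 0 1 0 0) (nsMk 0 0 0 n) he'
    simp only [nsMk_mul, one_mul, mul_one, mul_zero, smul_zero, add_zero, one_smul, zero_add,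
      MulOpposite.op_one] at l r
    apply ns_ext
    · rw [r, mul1]; simp only [nsMk1, mul_zero]
    · rw [l, mul2]; simp only [nsMk2, zero_mul]
    · rw [l, mul3]; simp only [nsMk2, nsMk3, zero_smul, smul_zero, add_zero]
    · rfl
  let φ : Module.End (B ⊗[k] Aᵐᵒᵖ) M := mkEnd (hsmM k)
    (AddMonoidHom.mk' (fun m => (D.1 (nsMk 0 0 m 0)).snd.1) (fun m m' => by
      rw [← add3, ← map_add, nsMk_add]; simp only [add_zero]))
    (fun b m => by
      have l := L (nsMk 0 b 0 0) (nsMk 0 0 m 0) (dB b)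
      simp only [nsMk_mul, mul_zero, smul_zero, add_zero] at l
      simp only [AddMonoidHom.mk'_apply]
      rw [l, mul3]; simp only [nsMk2, nsMk3, smul_zero, add_zero])
    (fun a m => by
      have l := R (nsMk a.unop 0 0 0) (nsMk 0 0 m 0) (dA a.unop)
      simp only [nsMk_mul, mul_zero, zero_mul, smul_zero, add_zero, zero_add, op_unop] at l
      simp only [AddMonoidHom.mk'_apply]
      rw [l, mul3]; simp only [nsMk1, nsMk3, smul_zero, zero_add, op_unop])
  let ψ : Module.End (A ⊗[k] Bᵐᵒᵖ) N := mkEnd (hsmN k)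
    (AddMonoidHom.mk' (fun n => (D.1 (nsMk 0 0 0 n)).snd.2) (fun m m' => by
      rw [← add4, ← map_add, nsMk_add]; simp only [add_zero]))
    (fun a n => by
      have l := L (nsMk a 0 0 0) (nsMk 0 0 0 n) (dA a)
      simp only [nsMk_mul, mul_zero, smul_zero, add_zero] at l
      simp only [AddMonoidHom.mk'_apply]
      rw [l, mul4]; simp only [nsMk1, nsMk4, smul_zero, add_zero])
    (fun b n => by
      have l := R (nsMk 0 b.unop 0 0) (nsMk 0 0 0 n) (dB b.unop)
      simp only [nsMk_mul, mul_zero, zero_mul, smul_zero, add_zero, zero_add, op_unop] at l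
      simp only [AddMonoidHom.mk'_apply]
      rw [l, mul4]; simp only [nsMk2, nsMk4, smul_zero, zero_add, op_unop])
  refine ⟨(φ, ψ), Subtype.ext (LinearMap.ext fun x => ?_)⟩
  have e : x = nsMk x.fst.1 0 0 0 + nsMk 0 x.fst.2 0 0 + nsMk 0 0 x.snd.1 0
      + nsMk 0 0 0 x.snd.2 := by
    simp only [nsMk_add, add_zero, zero_add]
    rfl
  rw [g3_apply]
  conv_rhs => rw [e, map_add, map_add, map_add, dA, dB, dM, dN, add_zero, zero_add, nsMk_add,
    add_zero, add_zero, zero_add, add_zero]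
  rfl

lemma killed' (D : derv k (NullSq A B M N)) (yA : A) (yB : B)
    (hA : ∀ a, (rho k A B M N D).1.1 a = yA * a - a * yA)
    (hB : ∀ b, (rho k A B M N D).2.1 b = yB * b - b * yB) :
    ∃ f y, g3 k A B M N f + innD k (NullSq A B M N) y = D := by
  have hD : ∀ x y, D.1 (x * y) = x * D.1 y + D.1 x * y := D.2
  let y : NullSq A B M N := nsMk yA yB (D.1 (nsMk 1 0 0 0)).snd.1 (-(D.1 (nsMk 1 0 0 0)).snd.2)
  have hy := rho_inner k (innD k (NullSq A B M N) y) y (fun r => rfl)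
  obtain ⟨f, hf⟩ := killed k (D - innD k (NullSq A B M N) y) (by
    change D.1 (nsMk 1 0 0 0) - (y * nsMk 1 0 0 0 - nsMk 1 0 0 0 * y) = 0
    rw [sub_eq_zero]
    apply ns_ext
    · rw [← rho1 k A B M N, hA]; rfl
    · have := congrArg (fun t : NullSq A B M N => t.fst.2) (hD (nsMk 1 0 0 0) (nsMk 1 0 0 0))
      simp only [nsMk_mul, one_mul, mul_one, mul_zero, smul_zero, add_zero] at this
      rw [add2, mul2, mul2] at this
      simp only [nsMk2, zero_mul, mul_zero, add_zero] at this
      rw [this, sub2, mul2, mul2]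
      simp only [nsMk2, zero_mul, mul_zero, sub_zero]
    · rw [sub3, mul3, mul3]
      simp only [y, nsMk1, nsMk2, nsMk3, smul_zero, zero_smul, zero_add, add_zero, sub_zero,
        MulOpposite.op_one, one_smul]
    · rw [sub4, mul4, mul4]
      simp only [y, nsMk1, nsMk2, nsMk4, smul_zero, zero_smul, zero_add, add_zero, sub_zero,
        MulOpposite.op_zero, one_smul, zero_sub, neg_neg])
    (by
      apply Prod.ext
      · exact Subtype.ext (LinearMap.ext fun a => sub_eq_zero.2 ((hA a).trans (hy.1 a).symm))
      · exact Subtype.ext (LinearMap.ext fun b => sub_eq_zero.2 ((hB b).trans (hy.2 b).symm)))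
  refine ⟨f, y, Subtype.ext (LinearMap.ext fun r => ?_)⟩
  have h : (g3 k A B M N f).1 r = D.1 r - (innD k (NullSq A B M N) y).1 r :=
    LinearMap.congr_fun (congrArg Subtype.val hf) r
  change (g3 k A B M N f).1 r + (innD k (NullSq A B M N) y).1 r = D.1 r
  rw [h, sub_add_cancel]

lemma rho_surj (hM : Module.Projective (B ⊗[k] Aᵐᵒᵖ) M)
    (hN : Module.Projective (A ⊗[k] Bᵐᵒᵖ) N) : Function.Surjective (rho k A B M N) := by
  rintro ⟨dA, dB⟩
  obtain ⟨δ, hδ1, hδ2⟩ := exists_delta (hsmM k) hM dB.1 dB.2 (opDer dA.1) (opDer_mem _ dA.2)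
  obtain ⟨ε, hε1, hε2⟩ := exists_delta (hsmN k) hN dA.1 dA.2 (opDer dB.1) (opDer_mem _ dB.2)
  have hA : ∀ x y, dA.1 (x * y) = x * dA.1 y + dA.1 x * y := dA.2
  have hB : ∀ x y, dB.1 (x * y) = x * dB.1 y + dB.1 x * y := dB.2
  refine ⟨⟨
    { toFun := fun x => nsMk (dA.1 x.fst.1) (dB.1 x.fst.2) (δ x.snd.1) (ε x.snd.2)
      map_add' := fun x y => ns_ext (map_add dA.1 _ _) (map_add dB.1 _ _)
        (map_add δ _ _) (map_add ε _ _)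
      map_smul' := fun c x => ns_ext (map_smul dA.1 _ _) (map_smul dB.1 _ _)
        (map_smul δ _ _) (map_smul ε _ _) }, ?_⟩, rfl⟩
  intro x y
  simp only [LinearMap.coe_mk, AddHom.coe_mk]
  apply ns_ext
  · exact hA _ _
  · exact hB _ _
  · rw [add3, mul3, mul3, nsMk3, mul3, map_add, hδ1, hδ2, opDer_op]
    simp only [nsMk1, nsMk2, nsMk3]
    abel
  · rw [add4, mul4, mul4, nsMk4, mul4, map_add, hε1, hε2, opDer_op]
    simp only [nsMk1, nsMk2, nsMk4]
    abel

end fin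

/-- for a null-square projective algebra `Λ = [[A,N],[M,B]]` there is a
five-term exact sequence
`0 → HH⁰(Λ) → HH⁰(A) ⊕ HH⁰(B) → End_{B⊗Aᵒᵖ}(M) ⊕ End_{A⊗Bᵒᵖ}(N) → HH¹(Λ) → HH¹(A) ⊕ HH¹(B) → 0`. -/
theorem stmt_5
    (hM : Module.Projective (B ⊗[k] Aᵐᵒᵖ) M)
    (hN : Module.Projective (A ⊗[k] Bᵐᵒᵖ) N) :
    ∃ (f₁ : HHt k (NullSq A B M N) 0 →ₗ[k] (HHt k A 0 × HHt k B 0))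
      (f₂ : (HHt k A 0 × HHt k B 0) →ₗ[k]
        (Module.End (B ⊗[k] Aᵐᵒᵖ) M × Module.End (A ⊗[k] Bᵐᵒᵖ) N))
      (f₃ : (Module.End (B ⊗[k] Aᵐᵒᵖ) M × Module.End (A ⊗[k] Bᵐᵒᵖ) N) →ₗ[k]
        HHt k (NullSq A B M N) 1)
      (f₄ : HHt k (NullSq A B M N) 1 →ₗ[k] (HHt k A 1 × HHt k B 1)),
      Function.Injective f₁ ∧
      Function.Exact f₁ f₂ ∧
      Function.Exact f₂ f₃ ∧
      Function.Exact f₃ f₄ ∧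
      Function.Surjective f₄ := by
  obtain ⟨eΛ, heΛ⟩ := HH0 k (NullSq A B M N)
  obtain ⟨eA, heA⟩ := HH0 k A
  obtain ⟨eB, heB⟩ := HH0 k B
  obtain ⟨qΛ, hqΛ, kΛ⟩ := HH1 k (NullSq A B M N)
  obtain ⟨qA, hqA, kA⟩ := HH1 k A
  obtain ⟨qB, hqB, kB⟩ := HH1 k B
  let EΛ := LinearEquiv.ofBijective eΛ heΛ
  let EAB := (LinearEquiv.ofBijective eA heA).prodCongr (LinearEquiv.ofBijective eB heB)
  obtain ⟨f4, h4⟩ := descendD k qΛ hqΛ ((qA.prodMap qB) ∘ₗ rho k A B M N) (fun D hD => by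
    obtain ⟨y, hy⟩ := (kΛ D).1 hD
    have := rho_inner k D y hy
    exact Prod.ext ((kA _).2 ⟨_, this.1⟩) ((kB _).2 ⟨_, this.2⟩))
  have h4' : ∀ D, f4 (qΛ D) = (qA (rho k A B M N D).1, qB (rho k A B M N D).2) := h4
  refine ⟨EAB.toLinearMap ∘ₗ g1 k A B M N ∘ₗ EΛ.symm.toLinearMap,
    g2 k A B M N ∘ₗ EAB.symm.toLinearMap, qΛ ∘ₗ g3 k A B M N, f4, ?_, ?_, ?_, ?_, ?_⟩
  · exact EAB.injective.comp ((g1_inj k A B M N).comp EΛ.symm.injective)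
  · intro x
    refine (g12_exact k A B M N (EAB.symm x)).trans ?_
    constructor
    · rintro ⟨z, hz⟩
      refine ⟨EΛ z, ?_⟩
      change EAB (g1 k A B M N (EΛ.symm (EΛ z))) = x
      rw [LinearEquiv.symm_apply_apply, hz, LinearEquiv.apply_symm_apply]
    · rintro ⟨z, rfl⟩
      refine ⟨EΛ.symm z, ?_⟩
      change _ = EAB.symm (EAB _)
      rw [LinearEquiv.symm_apply_apply]
      rfl
  · intro f
    refine ((kΛ (g3 k A B M N f)).trans (g3_inner_iff k f)).trans ?_
    constructor
    · rintro ⟨x, hx⟩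
      refine ⟨EAB x, ?_⟩
      change g2 k A B M N (EAB.symm (EAB x)) = f
      rw [LinearEquiv.symm_apply_apply, hx]
    · rintro ⟨x, hx⟩
      exact ⟨EAB.symm x, hx⟩
  · intro w
    constructor
    · intro hw
      obtain ⟨D, rfl⟩ := hqΛ w
      rw [h4'] at hw
      obtain ⟨yA, hA⟩ := (kA _).1 (congrArg Prod.fst hw)
      obtain ⟨yB, hB⟩ := (kB _).1 (congrArg Prod.snd hw)
      obtain ⟨f, y, hf⟩ := killed' k D yA yB hA hB
      refine ⟨f, ?_⟩
      change qΛ (g3 k A B M N f) = qΛ D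
      rw [← hf, map_add, (kΛ (innD k (NullSq A B M N) y)).2 ⟨y, fun r => rfl⟩, add_zero]
    · rintro ⟨f, rfl⟩
      change f4 (qΛ (g3 k A B M N f)) = 0
      rw [h4', rho_g3]
      exact Prod.ext (map_zero qA) (map_zero qB)
  · rintro ⟨u, v⟩
    obtain ⟨dA, rfl⟩ := hqA u
    obtain ⟨dB, rfl⟩ := hqB v
    obtain ⟨D, hD⟩ := rho_surj k hM hN (dA, dB)
    refine ⟨qΛ D, ?_⟩
    rw [h4', hD]

end
end
end
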